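/- Hoheisel's theorem (qualitative form): There is an absolute constant C > 0 such that for all real δ with 0 < δ < 1/4 and all real x ≥ C, one has | ∑_{x < n ≤ x + x^{1−δ}} Λ(n) − x^{1−δ} | ≤ C · x^{1−δ} · ( δ^{1/5} + (log x)^{−1/20} ), where Λ is the von Mangoldt function. In particular, for δ sufficiently small and x sufficiently large, the interval (x, x + x^{1−δ}] contains a prime. -/

import Mathlib

namespace Hoh
open Finset Real
open ArithmeticFunction (vonMangoldt)

/-- First Mertens estimate. -/
lemma mertens_one : ∃ C : ℝ, 0 < C ∧ ∀ n : ℕ, 1 ≤ n →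
    |∑ d ∈ Ioc 0 n, vonMangoldt d / d - log n| ≤ C := by
  refine ⟨log 4 + 5, by positivity, fun n hn => ?_⟩
  have hn0 : (0:ℝ) < n := by exact_mod_cast hn
  have h1 : ∑ k ∈ Ioc 0 n, log k = ∑ d ∈ Ioc 0 n, vonMangoldt d * ((n / d : ℕ) : ℝ) := by
    have := ArithmeticFunction.sum_Ioc_mul_zeta_eq_sum (vonMangoldt) n
    rw [ArithmeticFunction.vonMangoldt_mul_zeta] at this
    simpa using this
  have h2 : ∑ k ∈ Ioc 0 n, log k = log (n.factorial : ℝ) := by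
    clear h1 hn hn0
    induction n with
    | zero => simp
    | succ n ih =>
      rw [← Finset.insert_Ioc_right_eq_Ioc_add_one (Nat.zero_le n), sum_insert (by simp), ih,
        Nat.factorial_succ, Nat.cast_mul, Real.log_mul (by positivity) (by positivity)]
  have h3 : log (n.factorial : ℝ) ≤ n * log n := by
    rw [← Real.log_pow]
    apply Real.log_le_log (by positivity)
    exact_mod_cast Nat.factorial_le_pow n
  have h4 : n * log n - n ≤ log (n.factorial : ℝ) := by
    have := Stirling.le_log_factorial_stirling (n := n) (by omega)
    have h5 : 0 ≤ log (n:ℝ) := Real.log_natCast_nonneg n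
    have h6 : 0 ≤ log (2 * π) := Real.log_nonneg (by nlinarith [Real.pi_gt_three])
    linarith
  have h7 : ∑ d ∈ Ioc 0 n, vonMangoldt d * ((n / d : ℕ) : ℝ) ≤
      n * ∑ d ∈ Ioc 0 n, vonMangoldt d / d := by
    rw [mul_sum]
    apply sum_le_sum
    intro d hd
    have h8 : ((n / d : ℕ) : ℝ) ≤ n / d := Nat.cast_div_le
    calc _ ≤ vonMangoldt d * ((n:ℝ) / d) := by gcongr
      _ = _ := by ring
  have h9 : n * ∑ d ∈ Ioc 0 n, vonMangoldt d / d ≤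
      ∑ d ∈ Ioc 0 n, vonMangoldt d * ((n / d : ℕ) : ℝ) + (log 4 + 4) * n := by
    have h10 := Chebyshev.psi_le_const_mul_self (x := n) (by positivity)
    have h11 : Chebyshev.psi n = ∑ d ∈ Ioc 0 n, vonMangoldt d := by
      rw [Chebyshev.psi]; simp
    rw [h11] at h10
    refine le_trans ?_ (add_le_add_right h10 _)
    rw [mul_sum, ← sum_add_distrib]
    apply sum_le_sum
    intro d hd
    have hd0 : 0 < d := (mem_Ioc.mp hd).1
    have h8 : (n:ℝ) / d ≤ ((n / d : ℕ) : ℝ) + 1 := by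
      rw [div_le_iff₀ (by exact_mod_cast hd0)]
      have := Nat.lt_succ_iff.mp (Nat.lt_succ_of_lt (Nat.lt_div_mul_add (a := n) hd0))
      have h : (n:ℝ) ≤ ((n/d*d + d : ℕ):ℝ) := by exact_mod_cast this
      push_cast at h ⊢
      nlinarith
    calc _ = vonMangoldt d * ((n:ℝ) / d) := by ring
      _ ≤ vonMangoldt d * (((n / d : ℕ) : ℝ) + 1) := by gcongr
      _ = _ := by ring
  rw [← h1, h2] at h7 h9
  have h12 : n * (∑ d ∈ Ioc 0 n, vonMangoldt d / d) ≤ n * (log n + (log 4 + 4)) := by linarith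
  have h13 : n * (log n - 1) ≤ n * (∑ d ∈ Ioc 0 n, vonMangoldt d / d) := by linarith
  have h14 := le_of_mul_le_mul_left h12 hn0
  have h15 := le_of_mul_le_mul_left h13 hn0
  have : 0 ≤ log (4:ℝ) := by positivity
  rw [abs_le]; constructor <;> linarith

lemma primesLE_subset_Ioc (n : ℕ) : Nat.primesLE n ⊆ Ioc 0 n := by
  intro p hp
  have := Nat.mem_primesLE.mp hp
  exact mem_Ioc.mpr ⟨this.2.pos, this.1⟩

lemma sum_log_div_prime_le : ∃ C : ℝ, 0 < C ∧ ∀ n : ℕ, 1 ≤ n →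
    ∑ p ∈ Nat.primesLE n, log p / p ≤ log n + C := by
  obtain ⟨C, hC, h⟩ := mertens_one
  refine ⟨C, hC, fun n hn => ?_⟩
  have := (abs_le.mp (h n hn)).2
  calc ∑ p ∈ Nat.primesLE n, log p / p = ∑ p ∈ Nat.primesLE n, vonMangoldt p / p := by
        apply sum_congr rfl
        intro p hp
        rw [ArithmeticFunction.vonMangoldt_apply_prime (Nat.mem_primesLE.mp hp).2]
    _ ≤ ∑ d ∈ Ioc 0 n, vonMangoldt d / d := by
        apply sum_le_sum_of_subset_of_nonneg (primesLE_subset_Ioc n)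
        intro i _ _
        exact div_nonneg ArithmeticFunction.vonMangoldt_nonneg (by positivity)
    _ ≤ _ := by linarith

lemma sum_inv_prime_sqrt_le : ∃ C : ℝ, 0 < C ∧ ∀ z : ℕ,
    ∑ p ∈ Nat.primesLE z \ Nat.primesLE (Nat.sqrt z), (1:ℝ) / p ≤ C := by
  obtain ⟨C, hC, h⟩ := sum_log_div_prime_le
  refine ⟨2 + 2 * C / log 2, by positivity, fun z => ?_⟩
  rcases Nat.lt_or_ge z 2 with hz | hz
  · have : Nat.primesLE z = ∅ := by interval_cases z <;> simp
    rw [this]; simp; positivity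
  have hz2 : (2:ℝ) ≤ z := by exact_mod_cast hz
  have hl2 : 0 < log (2:ℝ) := Real.log_pos (by norm_num)
  have hlz : log 2 ≤ log (z:ℝ) := Real.log_le_log (by norm_num) hz2
  have hlz0 : 0 < log (z:ℝ) := hl2.trans_le hlz
  have key : ∑ p ∈ Nat.primesLE z \ Nat.primesLE (Nat.sqrt z), (1:ℝ) / p ≤
      (2 / log z) * ∑ p ∈ Nat.primesLE z, log p / p := by
    rw [mul_sum]
    refine le_trans (sum_le_sum (g := fun p : ℕ => 2 / log z * (log p / p)) ?_)
      (sum_le_sum_of_subset_of_nonneg sdiff_subset ?_)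
    · intro p hp
      rw [mem_sdiff, Nat.mem_primesLE, Nat.mem_primesLE] at hp
      have h1 : Nat.sqrt z < p := by
        by_contra hcon
        exact hp.2 ⟨by omega, hp.1.2⟩
      have h2 : z < p * p := Nat.sqrt_lt.mp h1
      have hp0 : (0:ℝ) < p := by exact_mod_cast hp.1.2.pos
      have h3 : log (z:ℝ) ≤ 2 * log p := by
        have : (z:ℝ) ≤ p ^ 2 := by
          have : z ≤ p ^ 2 := by nlinarith
          exact_mod_cast this
        have := Real.log_le_log (by linarith) this
        rwa [Real.log_pow] at this
      rw [div_mul_div_comm, div_le_div_iff₀ hp0 (by positivity)]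
      nlinarith
    · intro p _ _
      have : 0 ≤ log (p:ℝ) := Real.log_natCast_nonneg p
      positivity
  refine key.trans ?_
  have h1 := h z (by omega)
  calc (2 / log z) * ∑ p ∈ Nat.primesLE z, log p / p ≤ (2 / log z) * (log z + C) := by
        gcongr
    _ = 2 + 2 * C / log z := by field_simp
    _ ≤ _ := by gcongr

/-- `∏_{p ≤ z} (1 - 1/p)`. -/
noncomputable def V (z : ℕ) : ℝ := ∏ p ∈ Nat.primesLE z, (1 - 1 / (p:ℝ))

lemma V_pos (z : ℕ) : 0 < V z := by
  apply prod_pos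
  intro p hp
  have h : (2:ℝ) ≤ p := by exact_mod_cast (Nat.mem_primesLE.mp hp).2.two_le
  have : 1 / (p:ℝ) ≤ 1 / 2 := by gcongr
  linarith

lemma V_le_one (z : ℕ) : V z ≤ 1 := by
  apply prod_le_one
  · intro p hp
    have h : (2:ℝ) ≤ p := by exact_mod_cast (Nat.mem_primesLE.mp hp).2.two_le
    have : 1 / (p:ℝ) ≤ 1 / 2 := by gcongr
    linarith
  · intro p hp
    have : 0 ≤ 1 / (p:ℝ) := by positivity
    linarith

/-- `V z ≤ 1 / log z`. -/
lemma V_mul_log_le (z : ℕ) (hz : 1 ≤ z) : V z * log z ≤ 1 := by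
  let f : ℕ →* ℝ :=
    { toFun := fun n => (n:ℝ)⁻¹, map_one' := by simp,
      map_mul' := by intro a b; push_cast; rw [mul_inv] }
  have h := EulerProduct.summable_and_hasSum_smoothNumbers_prod_primesBelow_geometric (f := f)
    (by intro p hp
        have : (1:ℝ) < p := by exact_mod_cast hp.one_lt
        simpa [f] using inv_lt_one_of_one_lt₀ this) (z+1)
  have hV : ∏ p ∈ (z+1).primesBelow, (1 - f p)⁻¹ = (V z)⁻¹ := by
    rw [V, prod_inv_distrib]
    simp [f, Nat.primesLE]
  rw [hV] at h
  have hs : log z ≤ (V z)⁻¹ := by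
    have h1 : ∑ n ∈ Ioc 0 z, ((n:ℝ)⁻¹) ≤ (V z)⁻¹ := by
      let g : Ioc 0 z ↪ Nat.smoothNumbers (z+1) :=
        ⟨fun n => ⟨n.1, by
          have := mem_Ioc.mp n.2
          rw [Nat.mem_smoothNumbers']
          intro p hp hd
          have := Nat.le_of_dvd this.1 hd
          omega⟩, by
          intro a b hab
          have h5 := congrArg Subtype.val hab
          exact Subtype.ext h5⟩
      have := sum_le_hasSum ((univ : Finset (Ioc 0 z)).map g) (fun i _ => by simp [f]) h.2
      rw [sum_map] at this
      refine le_trans (le_of_eq ?_) this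
      rw [← sum_coe_sort]
      rfl
    have h2 := log_add_one_le_harmonic z
    have h3 : ((harmonic z : ℚ) : ℝ) = ∑ n ∈ Ioc 0 z, ((n:ℝ)⁻¹) := by
      rw [harmonic_eq_sum_Icc]; push_cast; rfl
    have h4 : log (z:ℝ) ≤ log ((z + 1 : ℕ):ℝ) := by
      apply Real.log_le_log
      · exact_mod_cast hz
      · push_cast; linarith
    push_cast at h4
    push_cast at h2
    linarith
  calc V z * log z ≤ V z * (V z)⁻¹ := by gcongr; exact (V_pos z).le
    _ = 1 := mul_inv_cancel₀ (V_pos z).ne'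

end Hoh

namespace Hoh
open Finset Real
open ArithmeticFunction (vonMangoldt)

instance primorial_neZero (z : ℕ) : NeZero (primorial z) := ⟨primorial_ne_zero z⟩

/-- The indicator function of the integers without prime factors `≤ z`. -/
noncomputable def rI (z n : ℕ) : ℝ := if n.Coprime (primorial z) then 1 else 0

/-- The principal character modulo the primorial of `z`. -/
noncomputable abbrev chi (z : ℕ) : DirichletCharacter ℂ (primorial z) := 1

lemma chi_apply (z n : ℕ) : (chi z) (n : ZMod (primorial z)) = (rI z n : ℂ) := by
  unfold rI
  split_ifs with h
  · rw [MulChar.one_apply ((ZMod.isUnit_iff_coprime _ _).mpr h)]; simp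
  · rw [MulChar.map_nonunit _ (fun hu => h ((ZMod.isUnit_iff_coprime _ _).mp hu))]; simp

lemma rI_nonneg (z n : ℕ) : 0 ≤ rI z n := by unfold rI; split_ifs <;> norm_num
lemma rI_le_one (z n : ℕ) : rI z n ≤ 1 := by unfold rI; split_ifs <;> norm_num
lemma rI_one (z : ℕ) : rI z 1 = 1 := by simp [rI]
lemma rI_mul (z m n : ℕ) : rI z (m * n) = rI z m * rI z n := by
  unfold rI
  simp only [Nat.coprime_mul_iff_left]
  split_ifs <;> simp_all

lemma rI_eq_one_iff {z n : ℕ} : rI z n = 1 ↔ ∀ p, p.Prime → p ≤ z → ¬ p ∣ n := by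
  have : rI z n = 1 ↔ n.Coprime (primorial z) := by
    unfold rI; split_ifs with h
    exacts [⟨fun _ => h, fun _ => rfl⟩, ⟨fun e => by norm_num at e, fun e => absurd e h⟩]
  rw [this]
  constructor
  · intro h p hp hpz hpn
    exact Nat.Prime.not_coprime_iff_dvd.mpr ⟨p, hp, hpn, hp.dvd_primorial_iff.mpr hpz⟩ h
  · intro h
    by_contra hc
    obtain ⟨p, hp, h1, h2⟩ := Nat.Prime.not_coprime_iff_dvd.mp hc
    exact h p hp (hp.dvd_primorial_iff.mp h2) h1

lemma rI_eq_zero_or_one (z n : ℕ) : rI z n = 0 ∨ rI z n = 1 := by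
  unfold rI; split_ifs <;> simp

lemma lt_of_rI_ne_zero {z n : ℕ} (h : rI z n ≠ 0) (hn : 2 ≤ n) : z < n := by
  have h1 := (rI_eq_zero_or_one z n).resolve_left h
  rw [rI_eq_one_iff] at h1
  by_contra hc
  exact h1 _ (Nat.minFac_prime (by omega)) ((Nat.minFac_le (by omega)).trans (by omega))
    (Nat.minFac_dvd n)

/-- The Dirichlet series of `rI z` at real points. -/
noncomputable def Fr (z : ℕ) (σ : ℝ) : ℝ := ∑' n : ℕ, rI z n / (n:ℝ) ^ σ

lemma Fr_summable (z : ℕ) {σ : ℝ} (hσ : 1 < σ) : Summable fun n : ℕ => rI z n / (n:ℝ) ^ σ := by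
  refine Summable.of_nonneg_of_le (fun n => by have := rI_nonneg z n; positivity) (fun n => ?_)
    (Real.summable_one_div_nat_rpow.mpr hσ)
  have := rI_le_one z n
  gcongr

lemma one_le_Fr (z : ℕ) {σ : ℝ} (hσ : 1 < σ) : 1 ≤ Fr z σ := by
  have := (Fr_summable z hσ).le_tsum 1 (fun n _ => by have := rI_nonneg z n; positivity)
  simpa [rI_one, Fr] using this

lemma term_chi_ofReal (z n : ℕ) {σ : ℝ} (hσ : σ ≠ 0) :
    LSeries.term (fun n => chi z n) (σ:ℂ) n = ((rI z n / (n:ℝ) ^ σ : ℝ) : ℂ) := by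
  rcases Nat.eq_zero_or_pos n with rfl | hn
  · simp [Real.zero_rpow hσ]
  · rw [LSeries.term_of_ne_zero hn.ne', chi_apply, Complex.ofReal_div,
      Complex.ofReal_cpow (by positivity)]
    simp

lemma LSeries_chi_ofReal (z : ℕ) {σ : ℝ} (hσ : 1 < σ) :
    LSeries (fun n => chi z n) (σ:ℂ) = (Fr z σ : ℂ) := by
  rw [LSeries, Fr, Complex.ofReal_tsum]
  exact tsum_congr fun n => term_chi_ofReal z n (by linarith)

lemma zeta_le {σ : ℝ} (hσ : 1 < σ) : ∑' n : ℕ, 1 / ((n:ℝ) + 1) ^ σ ≤ 1 + 1 / (σ - 1) := by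
  have h := ZetaAsymptotics.zeta_limit_aux1 hσ
  have h2 : 0 ≤ ZetaAsymptotics.termTSum σ := tsum_nonneg fun n => ZetaAsymptotics.term_nonneg _ _
  have : 0 ≤ σ * ZetaAsymptotics.termTSum σ := by positivity
  linarith

lemma Fr_eq (z : ℕ) {σ : ℝ} (hσ : 1 < σ) :
    Fr z σ = (∏ p ∈ Nat.primesLE z, (1 - (p:ℝ) ^ (-σ))) * ∑' n : ℕ, 1 / ((n:ℝ) + 1) ^ σ := by
  have h1 := DirichletCharacter.LFunctionTrivChar_eq_mul_riemannZeta (N := primorial z) (s := (σ:ℂ))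
    (by norm_cast; linarith)
  rw [DirichletCharacter.LFunctionTrivChar, DirichletCharacter.LFunction_eq_LSeries _ (by simpa),
    LSeries_chi_ofReal z hσ, zeta_eq_tsum_one_div_nat_add_one_cpow (by simpa),
    primeFactors_primorial] at h1
  rw [← Complex.ofReal_inj, h1]
  push_cast
  congr 1
  · apply prod_congr rfl
    intro p hp
    rw [Complex.ofReal_cpow (by positivity)]
    simp
  · apply tsum_congr
    intro n
    rw [Complex.ofReal_cpow (by positivity)]
    simp

lemma Fr_le : ∃ C : ℝ, 0 < C ∧ ∀ z : ℕ, 2 ≤ z → ∀ σ : ℝ, 1 < σ → σ ≤ 1 + 1 / log z →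
    Fr z σ ≤ C * V z / (σ - 1) := by
  obtain ⟨C, hC, h⟩ := sum_log_div_prime_le
  refine ⟨exp (2 * (1 + C / log 2)) * (1 + 1 / log 2), by positivity, fun z hz σ hσ hσ2 => ?_⟩
  have hl2 : 0 < log (2:ℝ) := Real.log_pos (by norm_num)
  have hlz : log 2 ≤ log (z:ℝ) := Real.log_le_log (by norm_num) (by exact_mod_cast hz)
  have hlz0 : 0 < log (z:ℝ) := hl2.trans_le hlz
  rw [Fr_eq z hσ]
  have h1 : ∏ p ∈ Nat.primesLE z, (1 - (p:ℝ) ^ (-σ)) ≤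
      ∏ p ∈ Nat.primesLE z, ((1 - 1 / (p:ℝ)) * exp (2 * (σ - 1) * (log p / p))) := by
    apply prod_le_prod
    · intro p hp
      have hp1 : (1:ℝ) ≤ p := by exact_mod_cast (Nat.mem_primesLE.mp hp).2.one_le
      have := Real.rpow_le_one_of_one_le_of_nonpos hp1 (z := -σ) (by linarith)
      linarith
    · intro p hp
      have hp1 : (2:ℝ) ≤ p := by exact_mod_cast (Nat.mem_primesLE.mp hp).2.two_le
      have hp0 : (0:ℝ) < p := by linarith
      have hlp : 0 ≤ log (p:ℝ) := Real.log_nonneg (by linarith)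
      have e1 : (p:ℝ) ^ (-σ) = (1 / p) * (p:ℝ) ^ (-(σ - 1)) := by
        rw [show -σ = -1 + -(σ - 1) by ring, Real.rpow_add hp0, Real.rpow_neg_one]; simp
      have e2 : 1 - (σ - 1) * log p ≤ (p:ℝ) ^ (-(σ - 1)) := by
        rw [Real.rpow_def_of_pos hp0]
        have := Real.add_one_le_exp (log p * -(σ-1))
        linarith
      have e3 : 2 * (σ - 1) * (log p / p) + 1 ≤ exp (2 * (σ - 1) * (log p / p)) :=
        Real.add_one_le_exp _
      have e4 : 1 / (p:ℝ) ≤ 1 / 2 := by gcongr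
      have e5 : 0 ≤ (σ - 1) * (log p / p) :=
        mul_nonneg (by linarith) (by positivity)
      have e6 : 0 < 1 / (p:ℝ) := by positivity
      calc 1 - (p:ℝ) ^ (-σ) = 1 - (1/p) * (p:ℝ) ^ (-(σ - 1)) := by rw [e1]
        _ ≤ 1 - (1/p) * (1 - (σ - 1) * log p) := by gcongr
        _ = (1 - 1 / p) + (σ - 1) * (log p / p) := by ring
        _ ≤ (1 - 1 / p) * (2 * (σ - 1) * (log p / p) + 1) := by nlinarith
        _ ≤ _ := by gcongr; linarith
  rw [prod_mul_distrib, ← Real.exp_sum, ← mul_sum] at h1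
  have h2 : exp (2 * (σ - 1) * ∑ p ∈ Nat.primesLE z, log p / p) ≤ exp (2 * (1 + C / log 2)) := by
    apply Real.exp_le_exp.mpr
    have h3 := h z (by omega)
    have h4 : σ - 1 ≤ 1 / log z := by linarith
    calc 2 * (σ - 1) * ∑ p ∈ Nat.primesLE z, log p / p ≤ 2 * (1 / log z) * (log z + C) := by
          gcongr
      _ = 2 * (1 + C / log z) := by field_simp
      _ ≤ _ := by gcongr
  have h5 : 1 + 1 / (σ - 1) ≤ (1 + 1 / log 2) / (σ - 1) := by
    have : σ - 1 ≤ 1 / log 2 := by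
      have : 1 / log (z:ℝ) ≤ 1 / log 2 := by gcongr
      linarith
    rw [add_div]
    have h6 : 1 ≤ 1 / log 2 / (σ - 1) := by rw [le_div_iff₀ (by linarith)]; linarith
    linarith
  have hV := V_pos z
  have h0 : 0 ≤ ∑' n : ℕ, 1 / ((n:ℝ) + 1) ^ σ := tsum_nonneg fun n => by positivity
  calc _ ≤ (V z * exp (2 * (1 + C / log 2))) * ((1 + 1 / log 2) / (σ - 1)) := by
        apply mul_le_mul (h1.trans _) ((zeta_le hσ).trans h5) h0 (by positivity)
        exact mul_le_mul_of_nonneg_left h2 hV.le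
    _ = _ := by ring

lemma V_ge : ∃ c : ℝ, 0 < c ∧ ∀ z : ℕ, 2 ≤ z → c ≤ V z * log z := by
  obtain ⟨C, hC, h⟩ := Fr_le
  refine ⟨1 / C, by positivity, fun z hz => ?_⟩
  have hlz0 : 0 < log (z:ℝ) := Real.log_pos (by exact_mod_cast hz)
  have h0 : 0 < 1 / log (z:ℝ) := by positivity
  have h1 := (one_le_Fr z (σ := 1 + 1 / log z) (by linarith)).trans
    (h z hz (1 + 1 / log z) (by linarith) le_rfl)
  rw [add_sub_cancel_left, div_div_eq_mul_div, div_one] at h1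
  rw [div_le_iff₀ hC]
  linarith

/-- Rankin bound for the logarithmic sum of rough numbers. -/
lemma sum_rI_div_le : ∃ C : ℝ, 0 < C ∧ ∀ z : ℕ, 2 ≤ z → ∀ M : ℝ, (z:ℝ) ≤ M →
    ∑ n ∈ Ioc 0 ⌊M⌋₊, rI z n / n ≤ C * V z * log M := by
  obtain ⟨C, hC, h⟩ := Fr_le
  refine ⟨exp 1 * C, by positivity, fun z hz M hM => ?_⟩
  have hz2 : (2:ℝ) ≤ z := by exact_mod_cast hz
  have hlz0 : 0 < log (z:ℝ) := Real.log_pos (by linarith)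
  have hlM : log z ≤ log M := Real.log_le_log (by linarith) hM
  have hlM0 : 0 < log M := by linarith
  have h0 : 0 < 1 / log M := by positivity
  have h1 := h z hz (1 + 1 / log M) (by linarith) (by gcongr)
  rw [add_sub_cancel_left, div_div_eq_mul_div, div_one] at h1
  calc ∑ n ∈ Ioc 0 ⌊M⌋₊, rI z n / n ≤
        ∑ n ∈ Ioc 0 ⌊M⌋₊, exp 1 * (rI z n / (n:ℝ) ^ (1 + 1 / log M)) := by
        apply sum_le_sum
        intro n hn
        rw [mem_Ioc] at hn
        have hn0 : (0:ℝ) < n := by exact_mod_cast hn.1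
        have hnM : (n:ℝ) ≤ M := (Nat.le_floor_iff (by linarith)).mp hn.2
        have h2 : (n:ℝ) ^ (1 + 1 / log M) ≤ exp 1 * n := by
          rw [Real.rpow_add hn0, Real.rpow_one, mul_comm]
          gcongr
          rw [Real.rpow_def_of_pos hn0]
          apply Real.exp_le_exp.mpr
          rw [mul_one_div, div_le_one hlM0]
          exact Real.log_le_log hn0 hnM
        have := rI_nonneg z n
        rw [← mul_div_assoc, div_le_div_iff₀ hn0 (by positivity)]
        nlinarith
    _ = exp 1 * ∑ n ∈ Ioc 0 ⌊M⌋₊, rI z n / (n:ℝ) ^ (1 + 1 / log M) := by rw [mul_sum]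
    _ ≤ exp 1 * Fr z (1 + 1 / log M) := by
        gcongr
        exact (Fr_summable z (by linarith)).sum_le_tsum _
          (fun n _ => by have := rI_nonneg z n; positivity)
    _ ≤ exp 1 * (C * V z * log M) := by gcongr
    _ = _ := by ring

end Hoh

namespace Hoh
open Finset Real

/-- Multi-affine polynomials in the variables indexed by `Q`, with coefficients of total size
at most `R`. -/
def Rep (Q : Finset ℕ) (f : (ℕ → ℝ) → ℝ) (R : ℝ) : Prop :=
  ∃ (ι : Type) (_ : Fintype ι) (S : ι → Finset ℕ) (l : ι → ℝ), (∀ i, S i ⊆ Q) ∧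
    (∀ a, f a = ∑ i, l i * ∏ p ∈ S i, a p) ∧ ∑ i, |l i| ≤ R

lemma Rep.mono {Q Q' : Finset ℕ} {f : (ℕ → ℝ) → ℝ} {R R' : ℝ} (h : Rep Q f R) (hQ : Q ⊆ Q')
    (hR : R ≤ R') : Rep Q' f R' := by
  obtain ⟨ι, _, S, l, h1, h2, h3⟩ := h
  exact ⟨ι, _, S, l, fun i => (h1 i).trans hQ, h2, h3.trans hR⟩

lemma Rep.one (Q : Finset ℕ) : Rep Q (fun _ => 1) 1 :=
  ⟨Unit, inferInstance, fun _ => ∅, fun _ => 1, by simp, by simp, by simp⟩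

lemma Rep.var (p : ℕ) : Rep {p} (fun a => a p) 1 :=
  ⟨Unit, inferInstance, fun _ => {p}, fun _ => 1, by simp, by simp, by simp⟩

lemma Rep.neg {Q : Finset ℕ} {f : (ℕ → ℝ) → ℝ} {R : ℝ} (h : Rep Q f R) :
    Rep Q (fun a => - f a) R := by
  obtain ⟨ι, _, S, l, h1, h2, h3⟩ := h
  exact ⟨ι, _, S, fun i => - l i, h1, fun a => by simp [h2], by simpa using h3⟩

lemma Rep.add {Q : Finset ℕ} {f g : (ℕ → ℝ) → ℝ} {R R' : ℝ} (hf : Rep Q f R) (hg : Rep Q g R') :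
    Rep Q (fun a => f a + g a) (R + R') := by
  obtain ⟨ι, _, S, l, h1, h2, h3⟩ := hf
  obtain ⟨ι', _, S', l', h1', h2', h3'⟩ := hg
  refine ⟨ι ⊕ ι', inferInstance, Sum.elim S S', Sum.elim l l', ?_, ?_, ?_⟩
  · rintro (i | i)
    exacts [h1 i, h1' i]
  · intro a
    simp [h2, h2']
  · simp only [Fintype.sum_sum_type, Sum.elim_inl, Sum.elim_inr]
    exact add_le_add h3 h3'

lemma Rep.sub {Q : Finset ℕ} {f g : (ℕ → ℝ) → ℝ} {R R' : ℝ} (hf : Rep Q f R) (hg : Rep Q g R') :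
    Rep Q (fun a => f a - g a) (R + R') := by
  simpa only [sub_eq_add_neg] using hf.add hg.neg

lemma Rep.mul {Q Q' : Finset ℕ} {f g : (ℕ → ℝ) → ℝ} {R R' : ℝ} (hf : Rep Q f R)
    (hg : Rep Q' g R') (hQ : Disjoint Q Q') : Rep (Q ∪ Q') (fun a => f a * g a) (R * R') := by
  obtain ⟨ι, _, S, l, h1, h2, h3⟩ := hf
  obtain ⟨ι', _, S', l', h1', h2', h3'⟩ := hg
  refine ⟨ι × ι', inferInstance, fun i => S i.1 ∪ S' i.2, fun i => l i.1 * l' i.2, ?_, ?_, ?_⟩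
  · exact fun i => union_subset_union (h1 _) (h1' _)
  · intro a
    show f a * g a = ∑ i : ι × ι', (l i.1 * l' i.2) * ∏ p ∈ S i.1 ∪ S' i.2, a p
    rw [h2, h2', sum_mul_sum, Fintype.sum_prod_type]
    refine sum_congr rfl fun i _ => sum_congr rfl fun j _ => ?_
    rw [prod_union (disjoint_of_subset_left (h1 i) (disjoint_of_subset_right (h1' j) hQ))]
    ring
  · simp only [abs_mul, Fintype.sum_prod_type]
    rw [← Fintype.sum_mul_sum]
    exact mul_le_mul h3 h3' (sum_nonneg fun _ _ => abs_nonneg _)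
      ((sum_nonneg fun _ _ => abs_nonneg _).trans h3)

/-- Inclusion-exclusion polynomial truncated at degree `k`. -/
def truncIE : ℕ → List ℕ → (ℕ → ℝ) → ℝ
  | _, [], _ => 1
  | 0, _ :: _, _ => 1
  | k + 1, p :: l, a => truncIE (k + 1) l a - a p * truncIE k l a

/-- Elementary symmetric polynomials. -/
def elemSymm : ℕ → List ℕ → (ℕ → ℝ) → ℝ
  | 0, _, _ => 1
  | _ + 1, [], _ => 0
  | k + 1, p :: l, a => elemSymm (k + 1) l a + a p * elemSymm k l a

lemma elemSymm_le (a : ℕ → ℝ) (ha : ∀ p, 0 ≤ a p) (l : List ℕ) :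
    ∀ k, elemSymm k l a ≤ (l.map a).sum ^ k / k.factorial := by
  induction l with
  | nil => intro k; cases k <;> simp [elemSymm]
  | cons p l ih =>
    intro k
    cases k with
    | zero => simp [elemSymm]
    | succ k =>
      rw [elemSymm]
      have hs : 0 ≤ (l.map a).sum := List.sum_nonneg (by simpa using fun _ _ => ha _)
      have hp := ha p
      simp only [List.map_cons, List.sum_cons]
      set s := (l.map a).sum
      have hB : s ^ (k+1) + (k+1) * a p * s ^ k ≤ (a p + s) ^ (k+1) := by
        clear_value s
        clear ih
        induction k with
        | zero => simp; linarith
        | succ k ih =>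
          push_cast
          have h1 : 0 ≤ ((k:ℝ) + 1) * a p ^ 2 * s ^ k := by positivity
          calc _ ≤ (s ^ (k+1) + (k+1) * a p * s ^ k) * (a p + s) := by ring_nf at h1 ⊢; linarith
            _ ≤ (a p + s) ^ (k+1) * (a p + s) := by gcongr
            _ = _ := by ring
      calc _ ≤ s ^ (k+1) / (k+1).factorial + a p * (s ^ k / k.factorial) := by
            gcongr
            exacts [ih _, ih _]
        _ = (s ^ (k+1) + (k+1) * a p * s ^ k) / (k+1).factorial := by
            rw [Nat.factorial_succ]; push_cast; field_simp
        _ ≤ _ := by gcongr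

lemma one_sub_prod_le (a : ℕ → ℝ) (ha : ∀ p, 0 ≤ a p) (ha1 : ∀ p, a p ≤ 1) (l : List ℕ) :
    0 ≤ (l.map fun p => 1 - a p).prod ∧ (l.map fun p => 1 - a p).prod ≤ 1 ∧
      1 - (l.map fun p => 1 - a p).prod ≤ elemSymm 1 l a := by
  induction l with
  | nil => simp [elemSymm]
  | cons p l ih =>
    simp only [List.map_cons, List.prod_cons, elemSymm]
    have := ha p; have := ha1 p
    obtain ⟨h1, h2, h3⟩ := ih
    refine ⟨by apply mul_nonneg <;> linarith, by nlinarith, by nlinarith⟩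

lemma truncIE_bound (a : ℕ → ℝ) (ha : ∀ p, 0 ≤ a p) (ha1 : ∀ p, a p ≤ 1) (l : List ℕ) :
    ∀ k, 0 ≤ (-1) ^ k * (truncIE k l a - (l.map fun p => 1 - a p).prod) ∧
      (-1) ^ k * (truncIE k l a - (l.map fun p => 1 - a p).prod) ≤ elemSymm (k+1) l a := by
  induction l with
  | nil => intro k; simp [truncIE, elemSymm]
  | cons p l ih =>
    intro k
    cases k with
    | zero =>
      obtain ⟨h1, h2, h3⟩ := one_sub_prod_le a ha ha1 (p :: l)
      simp only [truncIE, pow_zero, one_mul]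
      constructor <;> linarith
    | succ k =>
      have e : (-1:ℝ) ^ (k+1) * (truncIE (k+1) (p :: l) a - ((p::l).map fun p => 1 - a p).prod) =
          (-1) ^ (k+1) * (truncIE (k+1) l a - (l.map fun p => 1 - a p).prod) +
          a p * ((-1) ^ k * (truncIE k l a - (l.map fun p => 1 - a p).prod)) := by
        simp only [truncIE, List.map_cons, List.prod_cons]; ring
      rw [e, elemSymm]
      have := ha p
      obtain ⟨h1, h2⟩ := ih (k+1)
      obtain ⟨h3, h4⟩ := ih k
      constructor
      · positivity
      · gcongr

lemma truncIE_rep (l : List ℕ) (hl : l.Nodup) :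
    ∀ k, Rep l.toFinset (truncIE k l) ((1 + (l.length : ℝ)) ^ k) := by
  induction l with
  | nil =>
    intro k
    have : truncIE k [] = fun _ => 1 := by ext a; simp [truncIE]
    rw [this]; simpa using Rep.one ∅
  | cons p l ih =>
    intro k
    rw [List.nodup_cons] at hl
    cases k with
    | zero =>
      have : truncIE 0 (p :: l) = fun _ => 1 := by ext a; simp [truncIE]
      rw [this]; simpa using Rep.one _
    | succ k =>
      have h1 := (ih hl.2 (k+1)).mono (Q' := (p :: l).toFinset) (by simp) le_rfl
      have h2 := ((Rep.var p).mul (ih hl.2 k) (by simpa using hl.1)).mono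
        (Q' := (p :: l).toFinset) (by simp) le_rfl
      have h3 := h1.sub h2
      have e : truncIE (k+1) (p :: l) = fun a => truncIE (k+1) l a - a p * truncIE k l a := by
        ext a; simp [truncIE]
      rw [e]
      refine h3.mono subset_rfl ?_
      rw [one_mul, List.length_cons]
      push_cast
      have h0 : (0:ℝ) ≤ l.length := by positivity
      calc (1 + (l.length:ℝ)) ^ (k+1) + (1 + (l.length:ℝ)) ^ k =
            (1 + (l.length:ℝ)) ^ k * (1 + (l.length + 1)) := by ring
        _ ≤ (1 + ((l.length:ℝ) + 1)) ^ k * (1 + (l.length + 1)) := by gcongr; linarith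
        _ = _ := by ring

/-- Upper and lower truncations of `∏ (1 - a p)` over a set of indices. -/
lemma stage_exists (Q : Finset ℕ) (b : ℕ) : ∃ fu fl : (ℕ → ℝ) → ℝ,
    Rep Q fu ((1 + (#Q : ℝ)) ^ (2 * b + 1)) ∧ Rep Q fl ((1 + (#Q : ℝ)) ^ (2 * b + 1)) ∧
    ∀ a : ℕ → ℝ, (∀ p, 0 ≤ a p) → (∀ p, a p ≤ 1) →
      ∏ p ∈ Q, (1 - a p) ≤ fu a ∧ fl a ≤ ∏ p ∈ Q, (1 - a p) ∧
      fu a ≤ ∏ p ∈ Q, (1 - a p) + (∑ p ∈ Q, a p) ^ (2 * b + 1) / (2 * b + 1).factorial ∧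
      ∏ p ∈ Q, (1 - a p) ≤ fl a + (∑ p ∈ Q, a p) ^ (2 * b + 2) / (2 * b + 2).factorial := by
  refine ⟨truncIE (2*b) Q.toList, truncIE (2*b+1) Q.toList, ?_, ?_, ?_⟩
  · have := truncIE_rep Q.toList Q.nodup_toList (2*b)
    rw [toList_toFinset, length_toList] at this
    refine this.mono subset_rfl ?_
    exact pow_le_pow_right₀ (by linarith [(Nat.cast_nonneg (#Q) : (0:ℝ) ≤ _)]) (by omega)
  · have := truncIE_rep Q.toList Q.nodup_toList (2*b+1)
    rwa [toList_toFinset, length_toList] at this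
  · intro a ha ha1
    have e1 : (Q.toList.map fun p => 1 - a p).prod = ∏ p ∈ Q, (1 - a p) := prod_map_toList _ _
    have e2 : (Q.toList.map a).sum = ∑ p ∈ Q, a p := sum_map_toList _ _
    obtain ⟨h1, h2⟩ := truncIE_bound a ha ha1 Q.toList (2*b)
    obtain ⟨h3, h4⟩ := truncIE_bound a ha ha1 Q.toList (2*b+1)
    have h5 := elemSymm_le a ha Q.toList (2*b+1)
    have h6 := elemSymm_le a ha Q.toList (2*b+2)
    rw [e1, pow_succ, pow_mul] at h3 h4
    rw [e1, pow_mul] at h1 h2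
    rw [e2] at h5 h6
    norm_num at h1 h2 h3 h4
    refine ⟨h1, h3, ?_, ?_⟩
    · linarith
    · linarith

end Hoh

namespace Hoh
open Finset Real

lemma exp_neg_two_mul_le {x : ℝ} (hx : 0 ≤ x) (hx2 : x ≤ 1 / 2) : exp (-(2 * x)) ≤ 1 - x := by
  rw [Real.exp_neg, inv_le_comm₀ (exp_pos _) (by linarith)]
  have h1 := Real.add_one_le_exp (2 * x)
  refine le_trans ?_ h1
  rw [inv_le_iff_one_le_mul₀ (by linarith)]
  nlinarith

lemma factorial_small (C : ℝ) (hC : 0 < C) : ∃ b0 : ℕ, ∀ b, b0 ≤ b → ∀ n, b ≤ n →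
    C ^ n / n.factorial ≤ 1 / 100 * exp (-(2 * C)) * exp (-(b:ℝ)) := by
  have h := FloorSemiring.tendsto_pow_div_factorial_atTop (C * exp 1)
  have h2 := h.eventually (gt_mem_nhds (show (0:ℝ) < 1 / 100 * exp (-(2 * C)) by positivity))
  obtain ⟨b0, hb0⟩ := Filter.eventually_atTop.mp h2
  refine ⟨b0, fun b hb n hn => ?_⟩
  have h3 := hb0 n (hb.trans hn)
  have e : C ^ n / n.factorial = ((C * exp 1) ^ n / n.factorial) * exp (-(n:ℝ)) := by
    rw [mul_pow, ← Real.exp_nat_mul, mul_one, Real.exp_neg]; field_simp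
  rw [e]
  gcongr

lemma sieve_arith {V1 V2 u1 l1 u2 l2 ε μ e : ℝ} (hV1 : 0 < V1) (hV2 : 0 < V2)
    (h1 : V1 ≤ u1) (h3 : V2 ≤ u2) (h4 : l2 ≤ V2)
    (g1 : u1 ≤ (1 + 2 * ε) * V1) (g2 : (1 - 2 * ε) * V1 ≤ l1)
    (g3 : u2 ≤ (1 + μ) * V2) (g4 : (1 - μ) * V2 ≤ l2) (hε : ε ≤ 0.4 * e) (hμ : μ ≤ 0.01 * e)
    (he : e ≤ 1) (hμ0 : 0 ≤ μ) (hε0 : 0 ≤ ε) :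
    u1 * u2 ≤ (1 + 2 * e) * (V1 * V2) ∧
      (1 - 2 * e) * (V1 * V2) ≤ l1 * u2 + u1 * l2 - u1 * u2 := by
  have hV : 0 < V1 * V2 := by positivity
  have hprod : ε * μ ≤ 0.01 * e := by nlinarith
  constructor
  · calc u1 * u2 ≤ ((1 + 2 * ε) * V1) * ((1 + μ) * V2) := by gcongr; linarith
      _ = (1 + 2 * ε + μ + 2 * (ε * μ)) * (V1 * V2) := by ring
      _ ≤ _ := mul_le_mul_of_nonneg_right (by linarith) hV.le
  · have a1 : (V1 - l1) * u2 ≤ (2 * ε * V1) * ((1 + μ) * V2) := by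
      apply mul_le_mul _ g3 (by linarith) (by positivity)
      linarith
    have a2 : u1 * (V2 - l2) ≤ ((1 + 2 * ε) * V1) * (μ * V2) := by
      apply mul_le_mul g1 _ (by linarith) (by positivity)
      linarith
    have a3 : (u1 - V1) * (u2 - V2) ≤ (2 * ε * V1) * (μ * V2) := by
      apply mul_le_mul _ _ (by linarith) (by positivity) <;> linarith
    have a4 : l1 * u2 + u1 * l2 - u1 * u2 =
      V1 * V2 - (V1 - l1) * u2 - u1 * (V2 - l2) - (u1 - V1) * (u2 - V2) := by ring
    have a5 : (1 - 2 * e) * (V1 * V2) ≤ (1 - (2 * ε + μ + 6 * (ε * μ))) * (V1 * V2) :=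
      mul_le_mul_of_nonneg_right (by linarith) hV.le
    nlinarith

/-- The fundamental lemma of the sieve (Brun-Hooley form). -/
lemma sieve_fundamental : ∃ b0 : ℕ, 1 ≤ b0 ∧ ∀ z : ℕ, 1 ≤ z → ∀ b : ℕ, b0 ≤ b →
    ∃ fu fl : (ℕ → ℝ) → ℝ,
    Rep (Nat.primesLE z) fu ((z:ℝ) ^ (4 * b + 10)) ∧
    Rep (Nat.primesLE z) fl ((z:ℝ) ^ (4 * b + 10)) ∧
    (∀ a : ℕ → ℝ, (∀ p, 0 ≤ a p) → (∀ p, a p ≤ 1) →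
      ∏ p ∈ Nat.primesLE z, (1 - a p) ≤ fu a ∧ fl a ≤ ∏ p ∈ Nat.primesLE z, (1 - a p)) ∧
    fu (fun p => 1 / (p:ℝ)) ≤ (1 + 2 * exp (-(b:ℝ))) * V z ∧
    (1 - 2 * exp (-(b:ℝ))) * V z ≤ fl (fun p => 1 / (p:ℝ)) := by
  obtain ⟨C, hC, hsum⟩ := sum_inv_prime_sqrt_le
  obtain ⟨b0, hb0⟩ := factorial_small C hC
  refine ⟨b0 + 1, by omega, fun z => ?_⟩
  induction z using Nat.strong_induction_on with
  | _ z ih =>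
  intro hz b hb
  rcases Nat.lt_or_ge z 2 with hz1 | hz2
  · obtain rfl : z = 1 := by omega
    refine ⟨fun _ => 1, fun _ => 1, by simpa using Rep.one _, by simpa using Rep.one _, ?_, ?_, ?_⟩
    · simp
    · simp [V]; positivity
    · simp [V]; positivity
  set w := Nat.sqrt z with hw
  have hwz : w < z := Nat.sqrt_lt_self (by omega)
  have hw1 : 1 ≤ w := Nat.sqrt_pos.mpr (by omega)
  have hww : (w:ℝ) ^ 2 ≤ z := by exact_mod_cast Nat.sqrt_le' z
  obtain ⟨u1, l1, ru1, rl1, hb1, mu1, ml1⟩ := ih w hwz hw1 (b+1) (by omega)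
  set Q := Nat.primesLE z \ Nat.primesLE w with hQ
  obtain ⟨u2, l2, ru2, rl2, hb2⟩ := stage_exists Q b
  have hsub : Nat.primesLE w ⊆ Nat.primesLE z := Nat.primesLE_mono hwz.le
  have hdisj : Disjoint (Nat.primesLE w) Q := disjoint_sdiff
  have hun : Nat.primesLE w ∪ Q = Nat.primesLE z := union_sdiff_of_subset hsub
  have hcard : (1:ℝ) + #Q ≤ z := by
    have h1 : #Q ≤ z - 1 := by
      calc #Q ≤ #(Nat.primesLE z) := card_le_card sdiff_subset
        _ ≤ #(Ioc 1 z) := card_le_card (fun p hp => by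
            have := Nat.mem_primesLE.mp hp
            exact mem_Ioc.mpr ⟨this.2.one_lt, this.1⟩)
        _ = z - 1 := by simp
    have h2 : 1 + #Q ≤ z := by omega
    exact_mod_cast h2
  have hz2' : (2:ℝ) ≤ z := by exact_mod_cast hz2
  have hw1' : (1:ℝ) ≤ w := by exact_mod_cast hw1
  have hR : (w:ℝ) ^ (4 * (b+1) + 10) * (1 + (#Q:ℝ)) ^ (2 * b + 1) ≤ (z:ℝ) ^ (4 * b + 8) := by
    calc _ = ((w:ℝ) ^ 2) ^ (2 * b + 7) * (1 + (#Q:ℝ)) ^ (2 * b + 1) := by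
          rw [← pow_mul]; ring_nf
      _ ≤ (z:ℝ) ^ (2 * b + 7) * (z:ℝ) ^ (2 * b + 1) := by gcongr
      _ = _ := by rw [← pow_add]; ring_nf
  have hR3 : (z:ℝ) ^ (4 * b + 8) + (z:ℝ) ^ (4 * b + 8) + (z:ℝ) ^ (4 * b + 8) ≤
      (z:ℝ) ^ (4 * b + 10) := by
    rw [show 4 * b + 10 = 4 * b + 8 + 2 by ring, pow_add _ (4 * b + 8) 2]
    have : 0 < (z:ℝ) ^ (4 * b + 8) := by positivity
    have h4 : (4:ℝ) ≤ (z:ℝ) ^ 2 := by nlinarith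
    linarith [mul_le_mul_of_nonneg_left h4 this.le]
  have hprodsplit : ∀ a : ℕ → ℝ, ∏ p ∈ Nat.primesLE z, (1 - a p) =
      (∏ p ∈ Nat.primesLE w, (1 - a p)) * ∏ p ∈ Q, (1 - a p) := by
    intro a; rw [← hun, prod_union hdisj]
  have R1 := (ru1.mul ru2 hdisj).mono hun.subset hR
  have R2 := (rl1.mul ru2 hdisj).mono hun.subset hR
  have R3 := (ru1.mul rl2 hdisj).mono hun.subset hR
  refine ⟨fun a => u1 a * u2 a, fun a => l1 a * u2 a + u1 a * l2 a - u1 a * u2 a,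
    R1.mono subset_rfl (by have : 0 ≤ (z:ℝ) ^ (4 * b + 8) := by positivity
                           linarith),
    ((R2.add R3).sub R1).mono subset_rfl hR3, ?_, ?_⟩
  · intro a ha ha1
    obtain ⟨p1, p2⟩ := hb1 a ha ha1
    obtain ⟨q1, q2, -, -⟩ := hb2 a ha ha1
    have hP1 : 0 ≤ ∏ p ∈ Nat.primesLE w, (1 - a p) := prod_nonneg fun p _ => by linarith [ha1 p]
    have hP2 : 0 ≤ ∏ p ∈ Q, (1 - a p) := prod_nonneg fun p _ => by linarith [ha1 p]
    rw [hprodsplit]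
    set P1 := ∏ p ∈ Nat.primesLE w, (1 - a p)
    set P2 := ∏ p ∈ Q, (1 - a p)
    constructor
    · exact mul_le_mul p1 q1 hP2 (hP1.trans p1)
    · have e : P1 * P2 - (l1 a * u2 a + u1 a * l2 a - u1 a * u2 a) =
          (P1 - l1 a) * u2 a + u1 a * (P2 - l2 a) + (u1 a - P1) * (u2 a - P2) := by ring
      have : 0 ≤ (P1 - l1 a) * u2 a + u1 a * (P2 - l2 a) + (u1 a - P1) * (u2 a - P2) := by
        have t1 : 0 ≤ P1 - l1 a := by linarith
        have t2 : 0 ≤ P2 - l2 a := by linarith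
        have t3 : 0 ≤ u1 a - P1 := by linarith
        have t4 : 0 ≤ u2 a - P2 := by linarith
        have t5 : 0 ≤ u1 a := by linarith
        have t6 : 0 ≤ u2 a := by linarith
        positivity
      linarith
  · have ha : ∀ p : ℕ, 0 ≤ 1 / (p:ℝ) := fun p => by positivity
    have ha1 : ∀ p : ℕ, 1 / (p:ℝ) ≤ 1 := fun p => by
      rcases Nat.eq_zero_or_pos p with rfl | hp
      · simp
      · rw [div_le_one (by exact_mod_cast hp)]; exact_mod_cast hp
    obtain ⟨p1, p2⟩ := hb1 _ ha ha1
    obtain ⟨q1, q2, q3, q4⟩ := hb2 _ ha ha1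
    have hVs : V z = V w * ∏ p ∈ Q, (1 - 1 / (p:ℝ)) := hprodsplit _
    have hS := hsum z
    have hS0 : 0 ≤ ∑ p ∈ Q, 1 / (p:ℝ) := sum_nonneg fun p _ => ha p
    have hV2 : exp (-(2 * C)) ≤ ∏ p ∈ Q, (1 - 1 / (p:ℝ)) := by
      calc exp (-(2 * C)) ≤ exp (∑ p ∈ Q, -(2 * (1 / (p:ℝ)))) := by
            apply Real.exp_le_exp.mpr
            rw [sum_neg_distrib, ← mul_sum]
            linarith
        _ = ∏ p ∈ Q, exp (-(2 * (1 / (p:ℝ)))) := Real.exp_sum _ _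
        _ ≤ _ := by
            apply prod_le_prod (fun _ _ => (exp_pos _).le)
            intro p hp
            have hp2 : (2:ℝ) ≤ p := by
              exact_mod_cast (Nat.mem_primesLE.mp (mem_sdiff.mp hp).1).2.two_le
            exact exp_neg_two_mul_le (ha p) (by gcongr)
    have hV2pos : 0 < ∏ p ∈ Q, (1 - 1 / (p:ℝ)) := (exp_pos _).trans_le hV2
    have herr : ∀ n, b ≤ n → (∑ p ∈ Q, 1 / (p:ℝ)) ^ n / n.factorial ≤
        (1 / 100 * exp (-(b:ℝ))) * ∏ p ∈ Q, (1 - 1 / (p:ℝ)) := by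
      intro n hn
      calc _ ≤ C ^ n / n.factorial := by gcongr
        _ ≤ 1 / 100 * exp (-(2 * C)) * exp (-(b:ℝ)) := hb0 b (by omega) n hn
        _ = (1 / 100 * exp (-(b:ℝ))) * exp (-(2 * C)) := by ring
        _ ≤ _ := by gcongr
    have he1 := herr (2*b+1) (by omega)
    have he2 := herr (2*b+2) (by omega)
    have hexp : exp (-((b+1:ℕ):ℝ)) ≤ 0.4 * exp (-(b:ℝ)) := by
      push_cast
      rw [neg_add, Real.exp_add, mul_comm]
      gcongr
      have := Real.exp_one_gt_d9
      rw [Real.exp_neg, inv_le_comm₀ (by positivity) (by norm_num)]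
      norm_num at this ⊢
      linarith
    rw [hVs]
    exact sieve_arith (V_pos w) hV2pos p1 q1 q2 mu1 ml1 (by linarith) (by linarith) hexp
      (μ := 1 / 100 * exp (-(b:ℝ))) (by norm_num) (by simp) (by positivity) (by positivity)

end Hoh

namespace Hoh
open Finset Real

lemma card_multiples (X Y : ℝ) (hX : 0 ≤ X) (hY : 0 ≤ Y) (d : ℕ) (hd : 0 < d) :
    |(#{n ∈ Ioc ⌊X⌋₊ ⌊X + Y⌋₊ | d ∣ n} : ℝ) - Y / d| ≤ 1 := by
  have hXY : ⌊X⌋₊ ≤ ⌊X + Y⌋₊ := Nat.floor_mono (by linarith)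
  have h1 : #{n ∈ Ioc 0 ⌊X + Y⌋₊ | d ∣ n} =
      #{n ∈ Ioc 0 ⌊X⌋₊ | d ∣ n} + #{n ∈ Ioc ⌊X⌋₊ ⌊X + Y⌋₊ | d ∣ n} := by
    rw [← card_union_of_disjoint, ← filter_union, Ioc_union_Ioc_eq_Ioc (Nat.zero_le _) hXY]
    exact disjoint_filter_filter (Ioc_disjoint_Ioc_of_le le_rfl)
  rw [Nat.Ioc_filter_dvd_card_eq_div, Nat.Ioc_filter_dvd_card_eq_div] at h1
  have hd' : (0:ℝ) < d := by exact_mod_cast hd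
  rw [← Nat.floor_div_natCast, ← Nat.floor_div_natCast] at h1
  have h2 : (⌊(X+Y)/d⌋₊ : ℝ) = (⌊X/d⌋₊ : ℝ) + (#{n ∈ Ioc ⌊X⌋₊ ⌊X + Y⌋₊ | d ∣ n} : ℝ) := by
    exact_mod_cast h1
  have a1 := Nat.floor_le (show 0 ≤ (X+Y)/d by positivity)
  have a2 := Nat.lt_floor_add_one ((X+Y)/d)
  have a3 := Nat.floor_le (show 0 ≤ X/d by positivity)
  have a4 := Nat.lt_floor_add_one (X/d)
  have a5 : (X+Y)/d = X/d + Y/d := by ring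
  rw [abs_le]
  constructor <;> linarith

/-- The indicator of divisibility of `n`. -/
noncomputable def dvdI (n p : ℕ) : ℝ := if p ∣ n then 1 else 0

lemma dvdI_nonneg (n p : ℕ) : 0 ≤ dvdI n p := by unfold dvdI; split_ifs <;> norm_num
lemma dvdI_le_one (n p : ℕ) : dvdI n p ≤ 1 := by unfold dvdI; split_ifs <;> norm_num

lemma prod_dvdI (n : ℕ) (S : Finset ℕ) (hS : ∀ p ∈ S, p.Prime) :
    ∏ p ∈ S, dvdI n p = if (∏ p ∈ S, p) ∣ n then 1 else 0 := by
  split_ifs with h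
  · apply prod_eq_one
    intro p hp
    rw [dvdI, if_pos ((dvd_prod_of_mem _ hp).trans h)]
  · have : ∃ p ∈ S, ¬ p ∣ n := by
      by_contra hc
      push Not at hc
      exact h (Finset.prod_primes_dvd n (fun p hp => (hS p hp).prime) hc)
    obtain ⟨p, hp, hpn⟩ := this
    exact prod_eq_zero hp (by rw [dvdI, if_neg hpn])

lemma prod_one_sub_dvdI (z n : ℕ) : ∏ p ∈ Nat.primesLE z, (1 - dvdI n p) = rI z n := by
  rcases rI_eq_zero_or_one z n with h | h
  · have h2 : ¬ rI z n = 1 := by rw [h]; norm_num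
    rw [rI_eq_one_iff] at h2
    push Not at h2
    obtain ⟨p, hp, hpz, hpn⟩ := h2
    rw [h]
    exact prod_eq_zero (Nat.mem_primesLE.mpr ⟨hpz, hp⟩) (by rw [dvdI, if_pos hpn]; simp)
  · rw [h]
    apply prod_eq_one
    intro p hp
    have := Nat.mem_primesLE.mp hp
    rw [dvdI, if_neg (rI_eq_one_iff.mp h p this.2 this.1)]; simp

lemma Rep.sum_interval {z : ℕ} {f : (ℕ → ℝ) → ℝ} {R : ℝ} (h : Rep (Nat.primesLE z) f R)
    (X Y : ℝ) (hX : 0 ≤ X) (hY : 0 ≤ Y) :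
    |∑ n ∈ Ioc ⌊X⌋₊ ⌊X + Y⌋₊, f (dvdI n) - f (fun p => 1 / (p:ℝ)) * Y| ≤ R := by
  obtain ⟨ι, _, S, l, h1, h2, h3⟩ := h
  have hS : ∀ i, ∀ p ∈ S i, p.Prime := fun i p hp => (Nat.mem_primesLE.mp (h1 i hp)).2
  have e : ∑ n ∈ Ioc ⌊X⌋₊ ⌊X + Y⌋₊, f (dvdI n) - f (fun p => 1 / (p:ℝ)) * Y =
      ∑ i, l i * ((#{n ∈ Ioc ⌊X⌋₊ ⌊X + Y⌋₊ | (∏ p ∈ S i, p) ∣ n} : ℝ) -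
        Y / ((∏ p ∈ S i, p : ℕ) : ℝ)) := by
    simp only [h2, mul_sub, sum_sub_distrib, sum_mul]
    congr 1
    · rw [sum_comm]
      refine sum_congr rfl fun i _ => ?_
      rw [← mul_sum]
      congr 1
      rw [card_filter]
      push_cast
      exact sum_congr rfl fun n _ => prod_dvdI n _ (hS i)
    · refine sum_congr rfl fun i _ => ?_
      rw [prod_div_distrib]
      push_cast
      simp
      ring
  rw [e]
  refine (abs_sum_le_sum_abs _ _).trans (le_trans (sum_le_sum fun i _ => ?_) h3)
  rw [abs_mul]
  have hpos : 0 < ∏ p ∈ S i, p := prod_pos fun p hp => (hS i p hp).pos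
  calc _ ≤ |l i| * 1 := by
        gcongr
        exact card_multiples X Y hX hY _ hpos
    _ = _ := mul_one _

/-- Rough numbers in intervals. -/
lemma rough_count : ∃ b0 : ℕ, 1 ≤ b0 ∧ ∀ z : ℕ, 1 ≤ z → ∀ b : ℕ, b0 ≤ b →
    ∀ X Y : ℝ, 0 ≤ X → 0 ≤ Y →
    |∑ n ∈ Ioc ⌊X⌋₊ ⌊X + Y⌋₊, rI z n - V z * Y| ≤
      2 * exp (-(b:ℝ)) * V z * Y + (z:ℝ) ^ (4 * b + 10) := by
  obtain ⟨b0, hb0, h⟩ := sieve_fundamental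
  refine ⟨b0, hb0, fun z hz b hb X Y hX hY => ?_⟩
  obtain ⟨fu, fl, ru, rl, hp, mu, ml⟩ := h z hz b hb
  have h1 := abs_le.mp (ru.sum_interval X Y hX hY)
  have h2 := abs_le.mp (rl.sum_interval X Y hX hY)
  have h3 : ∑ n ∈ Ioc ⌊X⌋₊ ⌊X + Y⌋₊, rI z n ≤ ∑ n ∈ Ioc ⌊X⌋₊ ⌊X + Y⌋₊, fu (dvdI n) := by
    refine sum_le_sum fun n _ => ?_
    rw [← prod_one_sub_dvdI]
    exact (hp _ (dvdI_nonneg n) (dvdI_le_one n)).1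
  have h4 : ∑ n ∈ Ioc ⌊X⌋₊ ⌊X + Y⌋₊, fl (dvdI n) ≤ ∑ n ∈ Ioc ⌊X⌋₊ ⌊X + Y⌋₊, rI z n := by
    refine sum_le_sum fun n _ => ?_
    rw [← prod_one_sub_dvdI]
    exact (hp _ (dvdI_nonneg n) (dvdI_le_one n)).2
  have h5 := mul_le_mul_of_nonneg_right mu hY
  have h6 := mul_le_mul_of_nonneg_right ml hY
  rw [abs_le]
  constructor <;> linarith [h1.1, h1.2, h2.1, h2.2]

/-- Brun-Titchmarsh type upper bound. -/
lemma rough_count_le : ∃ g : ℕ, ∃ C : ℝ, 0 < C ∧ 1 ≤ g ∧ ∀ w : ℕ, 2 ≤ w →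
    ∀ X Y : ℝ, 0 ≤ X → (w:ℝ) ^ g ≤ Y →
    ∑ n ∈ Ioc ⌊X⌋₊ ⌊X + Y⌋₊, rI w n ≤ C * Y / log w := by
  obtain ⟨b0, hb0, h⟩ := rough_count
  refine ⟨4 * b0 + 11, 4, by norm_num, by omega, fun w hw X Y hX hY => ?_⟩
  have hw2 : (2:ℝ) ≤ w := by exact_mod_cast hw
  have hl : 0 < log (w:ℝ) := Real.log_pos (by linarith)
  have hY0 : 0 < Y := lt_of_lt_of_le (by positivity) hY
  have h1 := (abs_le.mp (h w (by omega) b0 le_rfl X Y hX hY0.le)).2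
  have h2 : (w:ℝ) ^ (4 * b0 + 10) ≤ Y / log w := by
    rw [le_div_iff₀ hl]
    refine le_trans ?_ hY
    rw [pow_succ (w:ℝ) (4 * b0 + 10)]
    gcongr
    exact (Real.log_le_sub_one_of_pos (by linarith)).trans (by linarith)
  have h3 : V w ≤ 1 / log w := by
    rw [le_div_iff₀ hl]; exact V_mul_log_le w (by omega)
  have h4 : exp (-(b0:ℝ)) ≤ 1 := by simp
  have h5 : V w * Y ≤ Y / log w := by
    calc V w * Y ≤ 1 / log w * Y := by gcongr
      _ = _ := by ring
  have hVY : 0 ≤ V w * Y := mul_nonneg (V_pos w).le hY0.le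
  have h6 : exp (-(b0:ℝ)) * (V w * Y) ≤ 1 * (V w * Y) := by gcongr
  have h7 : 4 * Y / log w = 4 * (Y / log w) := by ring
  rw [h7]
  linarith

end Hoh

namespace Hoh
open Finset Real MeasureTheory

/-- The number of `z`-rough integers in `(w / r, w]`. -/
noncomputable def roughC (z : ℕ) (r w : ℝ) : ℝ := ∑ n ∈ Ioc ⌊w / r⌋₊ ⌊w⌋₊, rI z n

lemma rI_zero {z : ℕ} (hz : 2 ≤ z) : rI z 0 = 0 := by
  rcases rI_eq_zero_or_one z 0 with h | h
  · exact h
  · exact absurd (dvd_zero 2) (rI_eq_one_iff.mp h 2 Nat.prime_two hz)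

lemma mem_Ioc_floor_iff {r w : ℝ} (hr : 1 < r) (n : ℕ) :
    n ∈ Ioc ⌊w / r⌋₊ ⌊w⌋₊ ↔ w ∈ Set.Ico (n:ℝ) (r * n) := by
  rcases Nat.eq_zero_or_pos n with rfl | hn
  · simp
  · rw [mem_Ioc, Nat.floor_lt' hn.ne', Nat.le_floor_iff' hn.ne', div_lt_iff₀ (by linarith),
      Set.mem_Ico, mul_comm]
    tauto

lemma tsum_indicator_rough {z : ℕ} {r w : ℝ} (hr : 1 < r) (f : ℝ → ℂ) :
    ∑' n : ℕ, (Set.Ico (n:ℝ) (r * n)).indicator (fun w => (rI z n : ℂ) * f w) w =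
      roughC z r w * f w := by
  rw [tsum_eq_sum (s := Ioc ⌊w / r⌋₊ ⌊w⌋₊)]
  · rw [roughC]
    push_cast
    rw [sum_mul]
    refine sum_congr rfl fun n hn => ?_
    rw [Set.indicator_of_mem ((mem_Ioc_floor_iff hr n).mp hn)]
  · intro n hn
    rw [Set.indicator_of_notMem (fun h => hn ((mem_Ioc_floor_iff hr n).mpr h))]

lemma Ico_inter {r : ℝ} (n : ℕ) :
    Set.Ico (n:ℝ) (r * n) ∩ Set.Ici 1 = Set.Ico (n:ℝ) (r * n) := by
  rw [Set.inter_eq_left]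
  intro w hw
  rcases Nat.eq_zero_or_pos n with rfl | hn
  · simp at hw
  · have : (1:ℝ) ≤ n := by exact_mod_cast hn
    exact this.trans hw.1

/-- Swapping the sum over rough numbers with the integral over multiplicative windows. -/
lemma hasSum_rough_integral {z : ℕ} {r τ B : ℝ} (hr : 1 < r) (hτ : 0 < τ)
    {f : ℝ → ℂ} (hf : ContinuousOn f (Set.Ici 1))
    (hfB : ∀ w, 1 ≤ w → ‖f w‖ ≤ B * w ^ (-1 - τ) / w) :
    HasSum (fun n : ℕ => (rI z n : ℂ) * ∫ w in Set.Ico (n:ℝ) (r * n), f w)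
      (∫ w in Set.Ici (1:ℝ), roughC z r w * f w) := by
  have hB : 0 ≤ B := by
    have := (norm_nonneg _).trans (hfB 1 le_rfl)
    simpa using this
  have hintg : ∀ n : ℕ, IntegrableOn f (Set.Ico (n:ℝ) (r * n)) := by
    intro n
    rcases Nat.eq_zero_or_pos n with rfl | hn
    · simp
    · have h1 : (1:ℝ) ≤ n := by exact_mod_cast hn
      have : IntegrableOn f (Set.Icc (n:ℝ) (r * n)) :=
        (hf.mono fun w hw => h1.trans hw.1).integrableOn_Icc
      exact this.mono_set Set.Ico_subset_Icc_self
  have key := hasSum_integral_of_summable_integral_norm (μ := volume.restrict (Set.Ici (1:ℝ)))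
    (F := fun (n : ℕ) => (Set.Ico (n:ℝ) (r * n)).indicator (fun w => (rI z n : ℂ) * f w)) ?_ ?_
  · have e1 : ∀ n : ℕ, ∫ w in Set.Ici (1:ℝ),
        (Set.Ico (n:ℝ) (r * n)).indicator (fun w => (rI z n : ℂ) * f w) w =
        (rI z n : ℂ) * ∫ w in Set.Ico (n:ℝ) (r * n), f w := by
      intro n
      rw [integral_indicator measurableSet_Ico, Measure.restrict_restrict measurableSet_Ico,
        Ico_inter, integral_const_mul]
    simp only [e1, tsum_indicator_rough hr] at key
    exact key
  · intro n
    rw [integrable_indicator_iff measurableSet_Ico, IntegrableOn,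
      Measure.restrict_restrict measurableSet_Ico, Ico_inter]
    exact (hintg n).const_mul _
  · have hs : Summable fun n : ℕ => (r - 1) * B * (1 / (n:ℝ) ^ (1 + τ)) :=
      (Real.summable_one_div_nat_rpow.mpr (by linarith)).mul_left _
    refine hs.of_nonneg_of_le (fun n => integral_nonneg fun _ => norm_nonneg _) fun n => ?_
    rcases Nat.eq_zero_or_pos n with rfl | hn
    · simp [Real.zero_rpow (show 1 + τ ≠ 0 by linarith)]
    have h1 : (1:ℝ) ≤ n := by exact_mod_cast hn
    simp only [norm_indicator_eq_indicator_norm]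
    rw [integral_indicator measurableSet_Ico, Measure.restrict_restrict measurableSet_Ico,
        Ico_inter]
    have hb : ∀ w ∈ Set.Ico (n:ℝ) (r*n), ‖‖(rI z n : ℂ) * f w‖‖ ≤ B * (n:ℝ) ^ (-1 - τ) / n := by
      intro w hw
      have hw1 : 1 ≤ w := h1.trans hw.1
      rw [norm_norm, norm_mul, Complex.norm_real, Real.norm_of_nonneg (rI_nonneg _ _)]
      calc rI z n * ‖f w‖ ≤ 1 * (B * w ^ (-1 - τ) / w) := by
            gcongr
            · exact rI_le_one _ _
            · exact hfB w hw1
        _ ≤ 1 * (B * (n:ℝ) ^ (-1 - τ) / n) := by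
            have : w ^ (-1 - τ) ≤ (n:ℝ) ^ (-1 - τ) :=
              Real.rpow_le_rpow_of_nonpos (by linarith) hw.1 (by linarith)
            gcongr
            exact hw.1
        _ = _ := one_mul _
    have hm := norm_setIntegral_le_of_norm_le_const (μ := volume)
      (s := Set.Ico (n:ℝ) (r * n)) (by simp) hb
    refine (le_abs_self _).trans (hm.trans (le_of_eq ?_))
    rw [Measure.real, Real.volume_Ico, ENNReal.toReal_ofReal (by nlinarith)]
    rw [show -1 - τ = -(1 + τ) by ring, Real.rpow_neg (by positivity)]
    field_simp

end Hoh

namespace Hoh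
open Finset Real MeasureTheory

lemma roughC_nonneg (z : ℕ) (r w : ℝ) : 0 ≤ roughC z r w := sum_nonneg fun n _ => rI_nonneg z n

lemma roughC_le (z : ℕ) {r w : ℝ} (hw : 0 ≤ w) : roughC z r w ≤ w := by
  calc roughC z r w ≤ ∑ n ∈ Ioc ⌊w / r⌋₊ ⌊w⌋₊, (1:ℝ) := sum_le_sum fun n _ => rI_le_one z n
    _ = ((⌊w⌋₊ - ⌊w / r⌋₊ : ℕ) : ℝ) := by simp
    _ ≤ (⌊w⌋₊ : ℝ) := by exact_mod_cast Nat.sub_le _ _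
    _ ≤ w := Nat.floor_le hw

lemma measurable_roughC (z : ℕ) {r : ℝ} : Measurable (roughC z r) := by
  have h : Measurable fun p : ℕ × ℕ => ∑ n ∈ Ioc p.1 p.2, rI z n := measurable_from_prod_countable_right fun _ => measurable_from_nat
  have h2 : Measurable fun w : ℝ => (⌊w / r⌋₊, ⌊w⌋₊) :=
    (Nat.measurable_floor.comp (measurable_id.div_const r)).prodMk Nat.measurable_floor
  exact h.comp h2

lemma integral_Ico_inv {r : ℝ} (hr : 1 < r) {n : ℕ} (hn : 1 ≤ n) :
    ∫ w in Set.Ico (n:ℝ) (r * n), w⁻¹ = log r := by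
  have h0 : (0:ℝ) < n := by exact_mod_cast hn
  rw [integral_Ico_eq_integral_Ioo, ← integral_Ioc_eq_integral_Ioo,
    ← intervalIntegral.integral_of_le (by nlinarith), integral_inv_of_pos h0 (by positivity)]
  congr 1
  field_simp

lemma local_average {r A : ℝ} (hr : 1 < r) {h : ℝ → ℂ} (hc : ContinuousOn h (Set.Ici 1)) {n : ℕ}
    (hn : 1 ≤ n) (hA : ∀ w ∈ Set.Ico (n:ℝ) (r * n), ‖h w - h n‖ ≤ A) :
    ‖h n - ((log r)⁻¹ : ℝ) * ∫ w in Set.Ico (n:ℝ) (r * n), h w / w‖ ≤ A := by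
  have h1 : (1:ℝ) ≤ n := by exact_mod_cast hn
  have hl : 0 < log r := Real.log_pos hr
  have hsub : Set.Icc (n:ℝ) (r*n) ⊆ Set.Ici 1 := fun w hw => h1.trans hw.1
  have hi : IntegrableOn (fun w : ℝ => h w / w) (Set.Ico (n:ℝ) (r * n)) := by
    have : ContinuousOn (fun w : ℝ => h w / w) (Set.Icc (n:ℝ) (r*n)) := by
      refine (hc.mono hsub).div (by fun_prop) fun w hw => ?_
      have := hsub hw
      simp only [Set.mem_Ici] at this
      exact_mod_cast (by linarith : w ≠ 0)
    exact this.integrableOn_Icc.mono_set Set.Ico_subset_Icc_self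
  have hir : IntegrableOn (fun w : ℝ => w⁻¹) (Set.Ico (n:ℝ) (r * n)) := by
    have : ContinuousOn (fun w : ℝ => w⁻¹) (Set.Icc (n:ℝ) (r*n)) := by
      refine continuousOn_id.inv₀ fun w hw => ?_
      have := hsub hw
      simp only [Set.mem_Ici] at this
      simp; linarith
    exact this.integrableOn_Icc.mono_set Set.Ico_subset_Icc_self
  have hir2 : IntegrableOn (fun w : ℝ => h n * ((w⁻¹ : ℝ) : ℂ)) (Set.Ico (n:ℝ) (r * n)) :=
    hir.ofReal.const_mul _
  have e : h n - ((log r)⁻¹ : ℝ) * ∫ w in Set.Ico (n:ℝ) (r * n), h w / w =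
      -(((log r)⁻¹ : ℝ) * ∫ w in Set.Ico (n:ℝ) (r * n), (h w - h n) * ((w⁻¹ : ℝ) : ℂ)) := by
    have e2 : ∫ w in Set.Ico (n:ℝ) (r * n), (h w - h n) * ((w⁻¹ : ℝ) : ℂ) =
        (∫ w in Set.Ico (n:ℝ) (r * n), h w / w) - h n * (log r : ℝ) := by
      rw [← integral_Ico_inv hr hn, ← integral_complex_ofReal, ← integral_const_mul,
        ← integral_sub hi hir2]
      refine setIntegral_congr_fun measurableSet_Ico fun w _ => ?_
      push_cast; ring
    rw [e2]
    have : ((log r : ℝ) : ℂ) ≠ 0 := by exact_mod_cast hl.ne'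
    push_cast
    field_simp
    ring
  rw [e, norm_neg, norm_mul, Complex.norm_real, Real.norm_of_nonneg (by positivity)]
  have : ‖∫ w in Set.Ico (n:ℝ) (r * n), (h w - h n) * ((w⁻¹ : ℝ) : ℂ)‖ ≤ A * log r := by
    rw [← integral_Ico_inv hr hn, ← integral_const_mul]
    refine norm_integral_le_of_norm_le (hir.const_mul A) ?_
    refine (ae_restrict_iff' measurableSet_Ico).mpr (Filter.Eventually.of_forall fun w hw => ?_)
    have hw0 : 0 < w := by linarith [hw.1]
    rw [norm_mul, Complex.norm_real, Real.norm_of_nonneg (by positivity)]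
    gcongr
    exact hA w hw
  calc _ ≤ (log r)⁻¹ * (A * log r) := by gcongr
    _ = A := by field_simp

lemma integral_roughC_le {z : ℕ} {r N0 : ℝ} (hr : 1 < r)  :
    ∫ w in Set.Ioc (1:ℝ) N0, roughC z r w / w ^ 2 ≤
      (r - 1) * ∑ n ∈ Ioc 0 ⌊N0⌋₊, rI z n / n := by
  set F : ℕ → ℝ → ℝ := fun n => (Set.Ico (n:ℝ) (r * n)).indicator (fun w => rI z n / w ^ 2)
  have e : ∀ w ∈ Set.Ioc (1:ℝ) N0, roughC z r w / w ^ 2 = ∑ n ∈ Ioc 0 ⌊N0⌋₊, F n w := by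
    intro w hw
    have hs : Ioc ⌊w / r⌋₊ ⌊w⌋₊ ⊆ Ioc 0 ⌊N0⌋₊ :=
      Ioc_subset_Ioc (Nat.zero_le _) (Nat.floor_mono hw.2)
    rw [← sum_subset hs, roughC, sum_div]
    · refine sum_congr rfl fun n hn => ?_
      simp only [F]
      rw [Set.indicator_of_mem ((mem_Ioc_floor_iff hr n).mp hn)]
    · intro n _ hn
      simp only [F]
      rw [Set.indicator_of_notMem (fun h => hn ((mem_Ioc_floor_iff hr n).mpr h))]
  have hb : ∀ n : ℕ, 1 ≤ n → ∀ w ∈ Set.Ico (n:ℝ) (r * n), ‖rI z n / w ^ 2‖ ≤ rI z n / (n:ℝ)^2 := by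
    intro n hn w hw
    have h1 : (1:ℝ) ≤ n := by exact_mod_cast hn
    have h2 := rI_nonneg z n
    rw [Real.norm_of_nonneg (by positivity)]
    gcongr
    exact hw.1
  have hi : ∀ n : ℕ, 1 ≤ n → IntegrableOn (fun w : ℝ => rI z n / w ^ 2) (Set.Ico (n:ℝ) (r * n)) := by
    intro n hn
    refine Measure.integrableOn_of_bounded (M := rI z n / (n:ℝ)^2) (by simp) (by
      refine Measurable.aestronglyMeasurable ?_
      fun_prop) ?_
    exact (ae_restrict_iff' measurableSet_Ico).mpr (Filter.Eventually.of_forall (hb n hn))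
  rw [setIntegral_congr_fun measurableSet_Ioc e, integral_finsetSum, mul_sum]
  · refine sum_le_sum fun n hn => ?_
    have hn1 : 1 ≤ n := (mem_Ioc.mp hn).1
    have h1 : (1:ℝ) ≤ n := by exact_mod_cast hn1
    have h2 := rI_nonneg z n
    have hF : Integrable (F n) := (integrable_indicator_iff measurableSet_Ico).mpr (hi n hn1)
    calc ∫ w in Set.Ioc (1:ℝ) N0, F n w ≤ ∫ w, F n w := by
          refine setIntegral_le_integral hF (Filter.Eventually.of_forall fun w => ?_)
          refine Set.indicator_nonneg (fun w _ => by positivity) w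
      _ = ∫ w in Set.Ico (n:ℝ) (r * n), rI z n / w ^ 2 := integral_indicator measurableSet_Ico
      _ ≤ rI z n / (n:ℝ)^2 * volume.real (Set.Ico (n:ℝ) (r * n)) :=
          (le_abs_self _).trans (norm_setIntegral_le_of_norm_le_const (by simp) (hb n hn1))
      _ = (r - 1) * (rI z n / n) := by
          rw [Measure.real, Real.volume_Ico, ENNReal.toReal_ofReal (by nlinarith)]
          field_simp
  · intro n hn
    have hn1 : 1 ≤ n := (mem_Ioc.mp hn).1
    exact ((integrable_indicator_iff measurableSet_Ico).mpr (hi n hn1)).integrableOn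
end Hoh

namespace Hoh
open Finset Real MeasureTheory

/-- Sums of smooth functions over rough numbers, compared with integrals. -/
lemma smooth_sum {z : ℕ} (hz : 2 ≤ z) {r τ B1 B2 N0 ε ω : ℝ} (hr : 1 < r) (hr2 : r ≤ 2)
    (hτ : 0 < τ) (hε : 0 ≤ ε) (hN0 : 1 ≤ N0) {h : ℝ → ℂ}
    (hc : ContinuousOn h (Set.Ici 1))
    (hB1 : ∀ w, 1 ≤ w → w ≤ N0 → ‖h w‖ ≤ B1 / w)
    (hB2 : ∀ w, 1 ≤ w → ‖h w‖ ≤ B2 * w ^ (-1 - τ))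
    (hω : ∀ n : ℕ, 1 ≤ n → ∀ w ∈ Set.Ico (n:ℝ) (r * n), ‖h w - h n‖ ≤ ω / (n:ℝ) ^ (1 + τ))
    (hC : ∀ w, N0 ≤ w → |roughC z r w - V z * (w - w / r)| ≤ ε * V z * (w - w / r)) :
    ‖∑' n : ℕ, (rI z n : ℂ) * h n - V z * ∫ w in Set.Ioi (1:ℝ), h w‖ ≤
      ω * Fr z (1 + τ) + B1 * (2 * ∑ n ∈ Ioc 0 ⌊N0⌋₊, rI z n / n + V z * log N0) +
        (ε + (r - 1)) * V z * B2 / τ := by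
  have hl : 0 < log r := Real.log_pos hr
  have hr0 : 0 < r := by linarith
  have hV := V_pos z
  have hl1 : log r ≤ r - 1 := Real.log_le_sub_one_of_pos hr0
  have hl2 : 1 - 1 / r ≤ log r := by
    have := Real.one_sub_inv_le_log_of_pos hr0
    simpa using this
  have hB2' : 0 ≤ B2 := by
    have := (norm_nonneg _).trans (hB2 1 le_rfl)
    simpa using this
  have hB1' : 0 ≤ B1 := by
    have := (norm_nonneg _).trans (hB1 1 le_rfl hN0)
    simpa using this
  have hf : ContinuousOn (fun w : ℝ => h w / w) (Set.Ici 1) := by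
    refine hc.div (by fun_prop) fun w hw => ?_
    simp only [Set.mem_Ici] at hw
    exact_mod_cast (by linarith : w ≠ 0)
  have hsum := hasSum_rough_integral (z := z) (r := r) (τ := τ) (B := B2) hr hτ hf (by
    intro w hw
    have : 0 < w := by linarith
    rw [norm_div, Complex.norm_real, Real.norm_of_nonneg this.le]
    gcongr
    exact hB2 w hw)
  have hsum2 := hsum.mul_left (((log r)⁻¹ : ℝ) : ℂ)
  have hrs := Fr_summable z (σ := 1 + τ) (by linarith)
  have hdiff : ∀ n : ℕ, ‖(rI z n : ℂ) * h n - (((log r)⁻¹ : ℝ) : ℂ) *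
      ((rI z n : ℂ) * ∫ w in Set.Ico (n:ℝ) (r * n), h w / w)‖ ≤ ω * (rI z n / (n:ℝ) ^ (1 + τ)) := by
    intro n
    rcases Nat.eq_zero_or_pos n with rfl | hn
    · simp [rI_zero hz]
    have e : (rI z n : ℂ) * h n - (((log r)⁻¹ : ℝ) : ℂ) *
      ((rI z n : ℂ) * ∫ w in Set.Ico (n:ℝ) (r * n), h w / w) = (rI z n : ℂ) *
      (h n - (((log r)⁻¹ : ℝ) : ℂ) * ∫ w in Set.Ico (n:ℝ) (r * n), h w / w) := by ring
    rw [e, norm_mul, Complex.norm_real, Real.norm_of_nonneg (rI_nonneg _ _)]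
    calc _ ≤ rI z n * (ω / (n:ℝ) ^ (1 + τ)) := by
          gcongr
          · exact rI_nonneg z n
          · exact local_average hr hc hn (hω n hn)
      _ = _ := by ring
  have hds : Summable fun n : ℕ => (rI z n : ℂ) * h n - (((log r)⁻¹ : ℝ) : ℂ) *
      ((rI z n : ℂ) * ∫ w in Set.Ico (n:ℝ) (r * n), h w / w) :=
    Summable.of_norm_bounded (hrs.mul_left ω) hdiff
  have hhs : Summable fun n : ℕ => (rI z n : ℂ) * h n := by
    simpa using hds.add hsum2.summable
  have hfirst : ‖∑' n : ℕ, (rI z n : ℂ) * h n - (((log r)⁻¹ : ℝ) : ℂ) *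
      ∫ w in Set.Ici (1:ℝ), roughC z r w * (h w / w)‖ ≤ ω * Fr z (1 + τ) := by
    rw [← hsum2.tsum_eq, ← hhs.tsum_sub hsum2.summable, Fr, ← tsum_mul_left]
    exact tsum_of_norm_bounded (hrs.mul_left ω).hasSum hdiff
  rw [integral_Ici_eq_integral_Ioi] at hfirst
  have hhm : AEStronglyMeasurable h (volume.restrict (Set.Ioi (1:ℝ))) :=
    (hc.mono Set.Ioi_subset_Ici_self).aestronglyMeasurable measurableSet_Ioi
  have hfm : AEStronglyMeasurable (fun w : ℝ => h w / w) (volume.restrict (Set.Ioi (1:ℝ))) :=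
    (hf.mono Set.Ioi_subset_Ici_self).aestronglyMeasurable measurableSet_Ioi
  have hpow : IntegrableOn (fun w : ℝ => w ^ (-1 - τ)) (Set.Ioi 1) :=
    integrableOn_Ioi_rpow_of_lt (by linarith) (by norm_num)
  have hhi : IntegrableOn h (Set.Ioi 1) := by
    refine Integrable.mono' (hpow.const_mul B2) hhm ?_
    exact (ae_restrict_iff' measurableSet_Ioi).mpr
      (Filter.Eventually.of_forall fun w hw => hB2 w (le_of_lt hw))
  have hCi : IntegrableOn (fun w : ℝ => (roughC z r w : ℂ) * (h w / w)) (Set.Ioi 1) := by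
    refine Integrable.mono' (hpow.const_mul B2) ?_ ?_
    · exact ((Complex.measurable_ofReal.comp (measurable_roughC z)).aestronglyMeasurable).mul hfm
    · refine (ae_restrict_iff' measurableSet_Ioi).mpr
        (Filter.Eventually.of_forall fun w hw => ?_)
      have hw0 : (0:ℝ) < w := lt_trans one_pos hw
      rw [norm_mul, Complex.norm_real, Real.norm_of_nonneg (roughC_nonneg _ _ _), norm_div,
        Complex.norm_real, Real.norm_of_nonneg hw0.le]
      calc _ ≤ w * (‖h w‖ / w) := by gcongr; exact roughC_le z hw0.le
        _ = ‖h w‖ := by field_simp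
        _ ≤ _ := hB2 w (le_of_lt hw)
  set G : ℝ → ℂ := fun w => (((log r)⁻¹ : ℝ) : ℂ) * ((roughC z r w : ℂ) * (h w / w)) - V z * h w
    with hG
  have hGi : IntegrableOn G (Set.Ioi 1) := (hCi.const_mul _).sub (hhi.const_mul _)
  have hGint : ∫ w in Set.Ioi (1:ℝ), G w = (((log r)⁻¹ : ℝ) : ℂ) *
      (∫ w in Set.Ioi (1:ℝ), roughC z r w * (h w / w)) - V z * ∫ w in Set.Ioi (1:ℝ), h w := by
    rw [hG, integral_sub (hCi.const_mul _) (hhi.const_mul _), integral_const_mul,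
      integral_const_mul]
  have hGe : ∀ w : ℝ, 1 ≤ w → G w = (((log r)⁻¹ * roughC z r w - V z * w : ℝ) : ℂ) * (h w / w) := by
    intro w hw
    have : (w:ℂ) ≠ 0 := by exact_mod_cast (by linarith : w ≠ 0)
    simp only [hG]; push_cast; field_simp
  have hsplit : ∫ w in Set.Ioi (1:ℝ), G w =
      (∫ w in Set.Ioc (1:ℝ) N0, G w) + ∫ w in Set.Ioi N0, G w := by
    rw [← Set.Ioc_union_Ioi_eq_Ioi hN0, setIntegral_union
      (Set.Ioc_disjoint_Ioi le_rfl) measurableSet_Ioi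
      (hGi.mono_set Set.Ioc_subset_Ioi_self) (hGi.mono_set (Set.Ioi_subset_Ioi hN0))]
  have hlow : ‖∫ w in Set.Ioc (1:ℝ) N0, G w‖ ≤
      B1 * (2 * ∑ n ∈ Ioc 0 ⌊N0⌋₊, rI z n / n + V z * log N0) := by
    have hCm : Measurable fun w : ℝ => roughC z r w / w ^ 2 :=
      (measurable_roughC z).div (by fun_prop)
    have hfin : volume (Set.Ioc (1:ℝ) N0) ≠ ⊤ := by simp
    have i1 : IntegrableOn (fun w : ℝ => roughC z r w / w ^ 2) (Set.Ioc 1 N0) := by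
      refine Measure.integrableOn_of_bounded (M := 1) hfin hCm.aestronglyMeasurable ?_
      refine (ae_restrict_iff' measurableSet_Ioc).mpr (Filter.Eventually.of_forall fun w hw => ?_)
      have hw1 : 1 < w := hw.1
      have := roughC_nonneg z r w
      rw [Real.norm_of_nonneg (by positivity), div_le_one (by positivity)]
      exact (roughC_le z (by linarith)).trans (by nlinarith)
    have i2 : IntegrableOn (fun w : ℝ => w⁻¹) (Set.Ioc 1 N0) := by
      refine Measure.integrableOn_of_bounded (M := 1) hfin (by
        exact measurable_inv.aestronglyMeasurable) ?_
      refine (ae_restrict_iff' measurableSet_Ioc).mpr (Filter.Eventually.of_forall fun w hw => ?_)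
      have hw1 : 1 < w := hw.1
      rw [Real.norm_of_nonneg (by positivity)]
      exact inv_le_one_of_one_le₀ hw1.le
    have hb : ∀ w ∈ Set.Ioc (1:ℝ) N0, ‖G w‖ ≤
        B1 * ((log r)⁻¹ * (roughC z r w / w ^ 2)) + B1 * (V z * w⁻¹) := by
      intro w hw
      have hw0 : 0 < w := by linarith [hw.1]
      rw [hGe w hw.1.le, norm_mul, Complex.norm_real, norm_div, Complex.norm_real,
        Real.norm_of_nonneg hw0.le]
      have h1 : ‖(log r)⁻¹ * roughC z r w - V z * w‖ ≤ (log r)⁻¹ * roughC z r w + V z * w := by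
        have := roughC_nonneg z r w
        refine (norm_sub_le _ _).trans (le_of_eq ?_)
        rw [Real.norm_of_nonneg (by positivity), Real.norm_of_nonneg (by positivity)]
      have h0 : 0 ≤ (log r)⁻¹ * roughC z r w + V z * w := (norm_nonneg _).trans h1
      calc _ ≤ ((log r)⁻¹ * roughC z r w + V z * w) * (B1 / w / w) := by
            gcongr
            exact hB1 w hw.1.le hw.2
        _ = _ := by field_simp
    have hle : ‖∫ w in Set.Ioc (1:ℝ) N0, G w‖ ≤ ∫ w in Set.Ioc (1:ℝ) N0,
        (B1 * ((log r)⁻¹ * (roughC z r w / w ^ 2)) + B1 * (V z * w⁻¹)) := by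
      refine norm_integral_le_of_norm_le
        (((i1.const_mul _).const_mul _).add ((i2.const_mul _).const_mul _)) ?_
      exact (ae_restrict_iff' measurableSet_Ioc).mpr (Filter.Eventually.of_forall hb)
    rw [integral_add ((i1.const_mul _).const_mul _) ((i2.const_mul _).const_mul _),
      integral_const_mul, integral_const_mul, integral_const_mul, integral_const_mul] at hle
    have hinv : ∫ w in Set.Ioc (1:ℝ) N0, w⁻¹ = log N0 := by
      rw [← intervalIntegral.integral_of_le hN0, integral_inv_of_pos one_pos (by linarith), div_one]
    rw [hinv] at hle
    refine hle.trans ?_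
    rw [mul_add]
    refine add_le_add (mul_le_mul_of_nonneg_left ?_ hB1') le_rfl
    have hS : 0 ≤ ∑ n ∈ Ioc 0 ⌊N0⌋₊, rI z n / n :=
      sum_nonneg fun n _ => div_nonneg (rI_nonneg _ _) (Nat.cast_nonneg _)
    have h3 : (log r)⁻¹ * (r - 1) ≤ 2 := by
      rw [inv_mul_le_iff₀ hl]
      have : r - 1 = (1 - 1 / r) * r := by field_simp
      rw [this]
      have h4 : 0 ≤ 1 - 1 / r := by
        rw [sub_nonneg, div_le_one hr0]; exact hr.le
      nlinarith
    calc _ ≤ (log r)⁻¹ * ((r - 1) * ∑ n ∈ Ioc 0 ⌊N0⌋₊, rI z n / n) := by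
          gcongr
          exact integral_roughC_le hr
      _ = ((log r)⁻¹ * (r - 1)) * ∑ n ∈ Ioc 0 ⌊N0⌋₊, rI z n / n := by ring
      _ ≤ _ := by gcongr
  have hhigh : ‖∫ w in Set.Ioi N0, G w‖ ≤ (ε + (r - 1)) * V z * B2 / τ := by
    have hb : ∀ w ∈ Set.Ioi N0, ‖G w‖ ≤ (ε + (r - 1)) * V z * B2 * w ^ (-1 - τ) := by
      intro w hw
      have hw1 : 1 ≤ w := hN0.trans (le_of_lt hw)
      have hw0 : 0 < w := by linarith
      rw [hGe w hw1, norm_mul, Complex.norm_real, norm_div, Complex.norm_real,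
        Real.norm_of_nonneg hw0.le]
      have h1 : ‖(log r)⁻¹ * roughC z r w - V z * w‖ ≤ (ε + (r - 1)) * V z * w := by
        have hcc := hC w (le_of_lt hw)
        have e1 : (log r)⁻¹ * roughC z r w - V z * w =
            (log r)⁻¹ * (roughC z r w - V z * (w - w / r)) -
              V z * w * (1 - (log r)⁻¹ * (1 - 1 / r)) := by ring
        have e2 : 0 ≤ 1 - (log r)⁻¹ * (1 - 1 / r) := by
          rw [sub_nonneg, inv_mul_le_iff₀ hl]; linarith
        have e3 : 1 - (log r)⁻¹ * (1 - 1 / r) ≤ r - 1 := by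
          have : (2 - r) * log r ≤ 1 - 1 / r := by
            calc (2 - r) * log r ≤ (2 - r) * (r - 1) := by
                  gcongr
              _ ≤ 1 - 1 / r := by
                  have : 1 - 1 / r - (2 - r) * (r - 1) = (r-1)^3/r := by field_simp; ring
                  have h5 : 0 ≤ (r-1)^3/r := by
                    have : 0 < r - 1 := by linarith
                    positivity
                  linarith
          have h6 : 2 - r ≤ (log r)⁻¹ * (1 - 1 / r) := by
            rw [le_inv_mul_iff₀ hl]; linarith
          linarith
        rw [e1]
        refine (norm_sub_le _ _).trans ?_
        rw [norm_mul, norm_mul, Real.norm_of_nonneg (by positivity : 0 ≤ (log r)⁻¹),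
          Real.norm_of_nonneg (by positivity : 0 ≤ V z * w), Real.norm_of_nonneg e2,
          Real.norm_eq_abs]
        calc _ ≤ (log r)⁻¹ * (ε * V z * (w - w / r)) + V z * w * (r - 1) := by gcongr
          _ = ε * V z * w * ((log r)⁻¹ * (1 - 1 / r)) + V z * w * (r - 1) := by ring
          _ ≤ ε * V z * w * 1 + V z * w * (r - 1) := by
              gcongr; linarith
          _ = _ := by ring
      have hr1 : 0 ≤ r - 1 := by linarith
      calc _ ≤ ((ε + (r - 1)) * V z * w) * (B2 * w ^ (-1 - τ) / w) := by
            gcongr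
            exact hB2 w hw1
        _ = _ := by field_simp
    have hle : ‖∫ w in Set.Ioi N0, G w‖ ≤
        ∫ w in Set.Ioi N0, (ε + (r - 1)) * V z * B2 * w ^ (-1 - τ) := by
      refine norm_integral_le_of_norm_le
        ((hpow.mono_set (Set.Ioi_subset_Ioi hN0)).const_mul _) ?_
      exact (ae_restrict_iff' measurableSet_Ioi).mpr (Filter.Eventually.of_forall hb)
    refine hle.trans ?_
    rw [integral_const_mul, integral_Ioi_rpow_of_lt (by linarith) (by linarith)]
    have h7 : -N0 ^ (-1 - τ + 1) / (-1 - τ + 1) ≤ 1 / τ := by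
      rw [show -1 - τ + 1 = -τ by ring, neg_div_neg_eq]
      gcongr
      exact Real.rpow_le_one_of_one_le_of_nonpos hN0 (by linarith)
    have hr1 : 0 ≤ r - 1 := by linarith
    calc _ ≤ (ε + (r - 1)) * V z * B2 * (1 / τ) := by gcongr
      _ = _ := by ring
  calc _ = ‖(∑' n : ℕ, (rI z n : ℂ) * h n - (((log r)⁻¹ : ℝ) : ℂ) *
      ∫ w in Set.Ioi (1:ℝ), roughC z r w * (h w / w)) + ((∫ w in Set.Ioc (1:ℝ) N0, G w) +
        ∫ w in Set.Ioi N0, G w)‖ := by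
        rw [← hsplit, hGint]; congr 1; ring
    _ ≤ _ := by
        refine (norm_add_le _ _).trans ?_
        rw [add_assoc]
        exact add_le_add hfirst ((norm_add_le _ _).trans (add_le_add hlow hhigh))
end Hoh

namespace Hoh
open Finset Real MeasureTheory

lemma exists_nat_ge_exp (A : ℝ) : ∃ K1 : ℕ, ∀ K : ℕ, K1 ≤ K → A ≤ exp K := by
  obtain ⟨n, hn⟩ := exists_nat_ge A
  refine ⟨n, fun K hK => hn.trans ?_⟩
  have h1 : (n:ℝ) ≤ K := by exact_mod_cast hK
  linarith [Real.add_one_le_exp (K:ℝ)]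

/-- Rough numbers in the windows `(w/(1+1/z), w]`. -/
lemma roughC_window : ∃ K1 : ℕ, 1 ≤ K1 ∧ ∀ K : ℕ, K1 ≤ K → ∀ z : ℕ, exp K ≤ z → ∀ w : ℝ,
    (z:ℝ) ^ (7 * K) ≤ w → |roughC z (1 + 1 / z) w - V z * (w - w / (1 + 1 / z))| ≤
      3 * exp (-(K:ℝ)) * V z * (w - w / (1 + 1 / z)) := by
  obtain ⟨b0, hb0, h⟩ := rough_count
  obtain ⟨c, hc, hV⟩ := V_ge
  obtain ⟨K2, hK2⟩ := exists_nat_ge_exp (max (1/c) 3)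
  refine ⟨max (max b0 K2) 5, by omega, fun K hK z hz w hw => ?_⟩
  have hK5 : 5 ≤ K := by omega
  have hzc : max (1/c) 3 ≤ (z:ℝ) := (hK2 K (by omega)).trans hz
  have hz3 : (3:ℝ) ≤ z := (le_max_right _ _).trans hzc
  have hz0 : (0:ℝ) < z := by linarith
  have hcz : 1 ≤ c * z := by
    have := (le_max_left _ _).trans hzc
    rwa [div_le_iff₀ hc, mul_comm] at this
  have hw0 : 0 < w := lt_of_lt_of_le (by positivity) hw
  set Y := w - w / (1 + 1 / (z:ℝ)) with hY
  have hYe : Y = w / (z + 1) := by rw [hY]; field_simp; ring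
  have hY0 : 0 ≤ Y := by rw [hYe]; positivity
  have hmain := h z (by exact_mod_cast (by linarith : (1:ℝ) ≤ z)) K (by omega) (w / (1 + 1 / z)) Y
    (by positivity) hY0
  rw [hY, add_sub_cancel, ← hY] at hmain
  refine hmain.trans ?_
  have hlz : 0 < log (z:ℝ) := Real.log_pos (by linarith)
  have hV1 : c / z ≤ V z := by
    have h1 := hV z (by exact_mod_cast (by linarith : (2:ℝ) ≤ z))
    have h2 : log (z:ℝ) ≤ z := (Real.log_le_sub_one_of_pos hz0).trans (by linarith)
    rw [div_le_iff₀ hz0]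
    exact h1.trans (mul_le_mul_of_nonneg_left h2 (V_pos z).le)
  have hV2 : 1 / (z:ℝ)^2 ≤ V z := by
    refine le_trans ?_ hV1
    rw [div_le_div_iff₀ (by positivity) hz0]
    nlinarith
  have he : 1 / (z:ℝ) ≤ exp (-(K:ℝ)) := by
    rw [Real.exp_neg, ← one_div]
    exact one_div_le_one_div_of_le (exp_pos _) hz
  have hY2 : (z:ℝ) ^ (7 * K - 2) ≤ Y := by
    rw [hYe, le_div_iff₀ (by positivity)]
    calc (z:ℝ) ^ (7 * K - 2) * (z + 1) ≤ (z:ℝ) ^ (7 * K - 2) * z ^ 2 := by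
          gcongr; nlinarith
      _ = (z:ℝ) ^ (7 * K) := by rw [← pow_add]; congr 1; omega
      _ ≤ w := hw
  have hVp := V_pos z
  have hfin : (z:ℝ) ^ (4 * K + 10) ≤ exp (-(K:ℝ)) * V z * Y := by
    calc (z:ℝ) ^ (4 * K + 10) ≤ (z:ℝ) ^ (7 * K - 5) := by
          apply pow_le_pow_right₀ (by linarith); omega
      _ = 1 / (z:ℝ) * (1 / (z:ℝ)^2) * (z:ℝ) ^ (7 * K - 2) := by
          rw [show 7 * K - 2 = (7 * K - 5) + 3 by omega, pow_add]; field_simp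
      _ ≤ _ := by gcongr
  nlinarith

/-- The Dirichlet series of the rough numbers. -/
noncomputable def Fs (z : ℕ) (s : ℂ) : ℂ := LSeries (fun n => chi z n) s

lemma Fs_eq_tsum {z : ℕ} (hz : 2 ≤ z) (s : ℂ) :
    Fs z s = ∑' n : ℕ, (rI z n : ℂ) * (n : ℂ) ^ (-s) := by
  rw [Fs, LSeries]
  refine tsum_congr fun n => ?_
  rcases Nat.eq_zero_or_pos n with rfl | hn
  · simp [rI_zero hz]
  · rw [LSeries.term_of_ne_zero hn.ne', chi_apply, Complex.cpow_neg, div_eq_mul_inv]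

lemma cpow_osc {s : ℂ} {τ r : ℝ} (hτ : 0 < τ) (hs : s.re = 1 + τ) {n : ℕ}
    (hn : 1 ≤ n) {w : ℝ} (hw : w ∈ Set.Ico (n:ℝ) (r * n)) :
    ‖(w:ℂ) ^ (-s) - ((n:ℝ):ℂ) ^ (-s)‖ ≤ ‖s‖ * (r - 1) / (n:ℝ) ^ (1 + τ) := by
  have h1 : (1:ℝ) ≤ n := by exact_mod_cast hn
  have hn0 : (0:ℝ) < n := by linarith
  have hs0 : s ≠ 0 := by
    rintro rfl
    simp at hs
    linarith
  have hd : ∀ x ∈ Set.Icc (n:ℝ) w, HasDerivWithinAt (fun y : ℝ => (y:ℂ) ^ (-s))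
      (-s * (x:ℂ) ^ (-s - 1)) (Set.Icc (n:ℝ) w) x := by
    intro x hx
    have hx0 : x ≠ 0 := by linarith [hx.1]
    exact (hasDerivAt_ofReal_cpow_const hx0 (neg_ne_zero.mpr hs0)).hasDerivWithinAt
  have hb : ∀ x ∈ Set.Icc (n:ℝ) w, ‖-s * (x:ℂ) ^ (-s - 1)‖ ≤ ‖s‖ * (n:ℝ) ^ (-(1 + τ) - 1) := by
    intro x hx
    have hx0 : 0 < x := by linarith [hx.1]
    rw [norm_mul, norm_neg, Complex.norm_cpow_eq_rpow_re_of_pos hx0]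
    gcongr
    simp only [Complex.sub_re, Complex.neg_re, Complex.one_re, hs]
    exact Real.rpow_le_rpow_of_nonpos hn0 hx.1 (by linarith)
  have := (convex_Icc (n:ℝ) w).norm_image_sub_le_of_norm_hasDerivWithin_le hd hb
    (Set.left_mem_Icc.mpr hw.1) (Set.right_mem_Icc.mpr hw.1)
  refine this.trans ?_
  rw [Real.norm_of_nonneg (by linarith [hw.1]), Real.rpow_sub hn0, Real.rpow_neg hn0.le,
    Real.rpow_one]
  calc _ ≤ ‖s‖ * (((n:ℝ) ^ (1 + τ))⁻¹ / n) * ((r - 1) * n) := by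
        gcongr
        linarith [hw.2]
    _ = _ := by field_simp

lemma norm_cpow_neg {s : ℂ} {τ w : ℝ} (hs : s.re = 1 + τ) (hw : 0 < w) :
    ‖(w:ℂ) ^ (-s)‖ = w ^ (-1 - τ) := by
  rw [Complex.norm_cpow_eq_rpow_re_of_pos hw]
  simp only [Complex.neg_re, hs]
  congr 1; ring

lemma integral_cpow_neg {s : ℂ} (hs : 1 < s.re) :
    ∫ w in Set.Ioi (1:ℝ), (w:ℂ) ^ (-s) = 1 / (s - 1) := by
  rw [integral_Ioi_cpow_of_lt (by simpa using hs) one_pos]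
  have : s - 1 ≠ 0 := by
    intro h
    have := congrArg Complex.re h
    simp at this; linarith
  have h2 : -s + 1 ≠ 0 := by
    intro h; apply this; linear_combination -h
  simp
  rw [show -s + 1 = -(s - 1) by ring, neg_div_neg_eq, one_div]

lemma continuousOn_cpow_neg (s : ℂ) : ContinuousOn (fun w : ℝ => (w:ℂ) ^ (-s)) (Set.Ici 1) := by
  intro w hw
  simp only [Set.mem_Ici] at hw
  refine ContinuousAt.continuousWithinAt ?_
  refine ContinuousAt.cpow (by fun_prop) (by fun_prop) ?_
  left; simp; linarith

end Hoh

namespace Hoh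
open Finset Real MeasureTheory

set_option maxHeartbeats 2000000 in
/-- Approximations to the Dirichlet series of rough numbers near the 1-line. -/
lemma Fs_approx : ∃ C : ℝ, 1 ≤ C ∧ ∃ K1 : ℕ, 1 ≤ K1 ∧ ∀ K : ℕ, K1 ≤ K → ∀ z : ℕ, exp K ≤ z →
    ∀ τ : ℝ, exp (-(K:ℝ)/2) / log z ≤ τ → τ ≤ 1 / log z → ∀ t : ℝ, |t| ≤ 2 * (z:ℝ) ^ (1/4:ℝ) →
    ‖Fs z (1 + τ + t * Complex.I) - V z / (τ + t * Complex.I)‖ ≤ C * K ∧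
    ∀ τ0 : ℝ, τ < τ0 → τ0 ≤ 1 / log z →
      ‖(Fs z (1 + τ + t * Complex.I) - Fs z (1 + τ0 + t * Complex.I)) -
        (V z / (τ + t * Complex.I) - V z / (τ0 + t * Complex.I))‖ ≤
      C * (exp (-(K:ℝ)/4) + (τ0 - τ) * K ^ 2 * log z) := by
  obtain ⟨K1, hK1, hrough⟩ := roughC_window
  obtain ⟨C1, hC1, hFr⟩ := Fr_le
  obtain ⟨C2, hC2, hsum⟩ := sum_rI_div_le
  set C := 16 * C1 + 7 * (2 * C2 * 7 + 7) + 16 + 1 with hCdef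
  refine ⟨C, by rw [hCdef]; linarith, max K1 2, by omega, fun K hK z hz τ hτ1 hτ2 t ht => ?_⟩
  have hK2 : (2:ℝ) ≤ K := by exact_mod_cast (le_max_right _ _).trans hK
  have hz3 : (3:ℝ) ≤ z := by
    have := Real.add_one_le_exp (K:ℝ); linarith
  have hz2 : 2 ≤ z := by exact_mod_cast (by linarith : (2:ℝ) ≤ z)
  have hz0 : (0:ℝ) < z := by linarith
  have hlz : 1 ≤ log (z:ℝ) := by
    rw [Real.le_log_iff_exp_le hz0]
    exact (Real.exp_le_exp.mpr (by linarith)).trans hz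
  have hlz0 : 0 < log (z:ℝ) := by linarith
  have hVp := V_pos z
  have hVl : V z * log z ≤ 1 := V_mul_log_le z (by omega)
  set e2 := exp (-(K:ℝ)/2) with he2
  have he2p : 0 < e2 := exp_pos _
  have hτ : 0 < τ := lt_of_lt_of_le (by positivity) hτ1
  have hτl : e2 ≤ τ * log z := by rwa [div_le_iff₀ hlz0] at hτ1
  have hVτ : V z / τ ≤ 1 / e2 := by
    rw [div_le_div_iff₀ hτ he2p]
    calc V z * e2 ≤ V z * (τ * log z) := by gcongr
      _ = τ * (V z * log z) := by ring
      _ ≤ 1 * τ := by rw [one_mul]; exact mul_le_of_le_one_right hτ.le hVl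
  have hτ1' : τ ≤ 1 := hτ2.trans (by rw [div_le_one hlz0]; exact hlz)
  set r : ℝ := 1 + 1 / z with hr
  have hr1 : 1 < r := by rw [hr]; have : 0 < 1 / (z:ℝ) := by positivity
                         linarith
  have hrz : r - 1 = 1 / z := by rw [hr]; ring
  have hr2 : r ≤ 2 := by
    have : 1 / (z:ℝ) ≤ 1 := by rw [div_le_one hz0]; linarith
    linarith
  have heK : exp (-(K:ℝ)) = e2 * e2 := by rw [he2, ← Real.exp_add]; congr 1; ring
  have hze : 1 / (z:ℝ) ≤ exp (-(K:ℝ)) := by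
    rw [Real.exp_neg, ← one_div]
    exact one_div_le_one_div_of_le (exp_pos _) hz
  set N0 : ℝ := (z:ℝ) ^ (7 * K) with hN0def
  have hN0 : 1 ≤ N0 := one_le_pow₀ (by linarith)
  have hzN0 : (z:ℝ) ≤ N0 := by
    calc (z:ℝ) = (z:ℝ) ^ 1 := (pow_one _).symm
      _ ≤ N0 := pow_le_pow_right₀ (by linarith) (by
          have : K1 ≤ K := (le_max_left _ _).trans hK
          omega)
  have hlN0 : log N0 = 7 * K * log z := by rw [hN0def, Real.log_pow]; push_cast; ring
  have hC := hrough K ((le_max_left _ _).trans hK) z hz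
  have hB1part : 2 * ∑ n ∈ Ioc 0 ⌊N0⌋₊, rI z n / n + V z * log N0 ≤ (2 * C2 * 7 + 7) * K := by
    have h1 := hsum z hz2 N0 hzN0
    rw [hlN0] at h1 ⊢
    have h3 : V z * (7 * K * log z) ≤ 7 * K := by
      calc _ = 7 * K * (V z * log z) := by ring
        _ ≤ 7 * K * 1 := by gcongr
        _ = _ := by ring
    have h4 : C2 * V z * (7 * K * log z) ≤ C2 * (7 * K) := by
      calc _ = C2 * (V z * (7 * K * log z)) := by ring
        _ ≤ _ := by gcongr
    linarith
  have hre : ∀ τ' : ℝ, (1 + τ' + t * Complex.I : ℂ).re = 1 + τ' := by intro τ'; simp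
  have hnorm : ∀ τ' : ℝ, 0 < τ' → τ' ≤ 1 → ‖(1 + τ' + t * Complex.I : ℂ)‖ ≤ 4 * (z:ℝ) ^ (1/4:ℝ) := by
    intro τ' h1 h2
    have h3 : 1 ≤ (z:ℝ) ^ (1/4:ℝ) := Real.one_le_rpow (by linarith) (by norm_num)
    calc ‖(1 + τ' + t * Complex.I : ℂ)‖ ≤ ‖(1 + τ' : ℂ)‖ + ‖(t * Complex.I : ℂ)‖ := norm_add_le _ _
      _ = (1 + τ') + |t| := by
          congr 1
          · rw [show (1 + τ' : ℂ) = ((1 + τ' : ℝ) : ℂ) by push_cast; ring, Complex.norm_real,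
              Real.norm_of_nonneg (by linarith)]
          · simp
      _ ≤ _ := by linarith
  have hz4 : (z:ℝ) ^ (1/4:ℝ) / z * (1 / e2) ≤ exp (-(K:ℝ)/4) := by
    have h1 : (z:ℝ) ^ (1/4:ℝ) / z = (z:ℝ) ^ (-(3/4):ℝ) := by
      rw [show (-(3/4):ℝ) = 1/4 - 1 by norm_num, Real.rpow_sub hz0, Real.rpow_one]
    have h2 : (z:ℝ) ^ (-(3/4):ℝ) ≤ (exp K) ^ (-(3/4):ℝ) :=
      Real.rpow_le_rpow_of_nonpos (exp_pos _) hz (by norm_num)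
    have h3 : (exp (K:ℝ)) ^ (-(3/4):ℝ) = exp (-(K:ℝ)/4) * e2 := by
      rw [← Real.exp_mul, he2, ← Real.exp_add]; congr 1; ring
    rw [h1, mul_one_div, div_le_iff₀ he2p]
    linarith
  have he4 : exp (-(K:ℝ)/4) ≤ 1 := by
    rw [Real.exp_le_one_iff]; linarith
  have hes : e2 ≤ 1 := by rw [he2, Real.exp_le_one_iff]; linarith
  have hden : ∀ τ' : ℝ, (1 + τ' + t * Complex.I : ℂ) - 1 = τ' + t * Complex.I := by
    intro τ'; ring
  have heps : 3 * exp (-(K:ℝ)) + (r - 1) ≤ 4 * (e2 * e2) := by rw [hrz, ← heK]; linarith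
  constructor
  · have key := smooth_sum (B1 := 1) (B2 := 1) (N0 := N0)
      (ω := ‖(1 + τ + t * Complex.I : ℂ)‖ * (r - 1)) hz2 hr1 hr2 hτ (by positivity) hN0
      (continuousOn_cpow_neg (1 + τ + t * Complex.I)) (fun w hw _ => by
        rw [norm_cpow_neg (hre τ) (by linarith), show -1 - τ = -(1 + τ) by ring,
          Real.rpow_neg (by linarith), ← one_div]
        gcongr
        calc w = w ^ (1:ℝ) := (Real.rpow_one w).symm
          _ ≤ w ^ (1 + τ) := Real.rpow_le_rpow_of_exponent_le hw (by linarith)) (fun w hw => by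
        rw [norm_cpow_neg (hre τ) (by linarith), one_mul]) (fun n hn w hw =>
        cpow_osc hτ (hre τ) hn hw) hC
    rw [integral_cpow_neg (by rw [hre]; linarith), hden, mul_one_div] at key
    simp only [Complex.ofReal_natCast] at key
    rw [← Fs_eq_tsum hz2] at key
    refine key.trans ?_
    have t1 : ‖(1 + τ + t * Complex.I : ℂ)‖ * (r - 1) * Fr z (1 + τ) ≤ 4 * C1 := by
      have h1 := hFr z hz2 (1 + τ) (by linarith) (by linarith)
      rw [add_sub_cancel_left] at h1
      calc _ ≤ (4 * (z:ℝ) ^ (1/4:ℝ)) * (1 / z) * (C1 * (1 / e2)) := by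
            rw [hrz]
            have h2 : Fr z (1 + τ) ≤ C1 * (1 / e2) := by
              refine h1.trans ?_
              rw [mul_div_assoc]; gcongr
            have h3 := hnorm τ hτ hτ1'
            have h4 := one_le_Fr z (σ := 1 + τ) (by linarith)
            gcongr
        _ = 4 * C1 * ((z:ℝ) ^ (1/4:ℝ) / z * (1 / e2)) := by ring
        _ ≤ 4 * C1 * 1 := by gcongr; exact hz4.trans he4
        _ = _ := by ring
    have t3 : (3 * exp (-(K:ℝ)) + (r - 1)) * V z * 1 / τ ≤ 4 := by
      calc _ = (3 * exp (-(K:ℝ)) + (r - 1)) * (V z / τ) := by ring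
        _ ≤ 4 * (e2 * e2) * (1 / e2) := by gcongr
        _ = 4 * e2 := by field_simp
        _ ≤ 4 := by linarith
    have t4 : 4 * C1 + 4 ≤ (4 * C1 + 4) * K := le_mul_of_one_le_right (by linarith) (by linarith)
    rw [hCdef]
    have q1 : 0 ≤ C1 * K := by positivity
    have q2 : 0 ≤ C2 * K := by positivity
    linarith
  · intro τ0 h0 h01
    have hτ0 : 0 < τ0 := by linarith
    have hτ01 : τ0 ≤ 1 := h01.trans (by rw [div_le_one hlz0]; exact hlz)
    have hd : 0 < τ0 - τ := by linarith
    have hnle : ∀ w : ℝ, 1 ≤ w → ‖(w:ℂ) ^ (-(1 + τ + t * Complex.I)) -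
        (w:ℂ) ^ (-(1 + τ0 + t * Complex.I))‖ ≤ (τ0 - τ) * log w * w ^ (-1 - τ) := by
      intro w hw
      have hw0 : 0 < w := by linarith
      have hwc : (w:ℂ) ≠ 0 := by exact_mod_cast hw0.ne'
      have e1 : (w:ℂ) ^ (-(1 + τ0 + t * Complex.I)) = (w:ℂ) ^ (-(1 + τ + t * Complex.I)) *
          ((w ^ (-(τ0 - τ)) : ℝ) : ℂ) := by
        rw [Complex.ofReal_cpow hw0.le, ← Complex.cpow_add _ _ hwc]
        congr 1; push_cast; ring
      rw [e1, show ∀ a b : ℂ, a - a * b = a * (1 - b) by intros; ring, norm_mul,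
        norm_cpow_neg (hre τ) hw0, mul_comm]
      gcongr
      rw [← Complex.ofReal_one, ← Complex.ofReal_sub, Complex.norm_real, Real.norm_of_nonneg
        (by rw [sub_nonneg]; exact Real.rpow_le_one_of_one_le_of_nonpos hw (by linarith)),
        Real.rpow_def_of_pos hw0]
      linarith [Real.add_one_le_exp (log w * -(τ0 - τ))]
    have hrpow : ∀ w : ℝ, 1 ≤ w → w ^ (-1 - τ) ≤ 1 / w := by
      intro w hw
      rw [show -1 - τ = -(1 + τ) by ring, Real.rpow_neg (by linarith), ← one_div]
      gcongr
      calc w = w ^ (1:ℝ) := (Real.rpow_one w).symm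
          _ ≤ w ^ (1 + τ) := Real.rpow_le_rpow_of_exponent_le hw (by linarith)
    have key := smooth_sum (B1 := (τ0 - τ) * (7 * K * log z)) (B2 := 2 * (τ0 - τ) / τ) (N0 := N0)
      (τ := τ / 2)
      (ω := ‖(1 + τ + t * Complex.I : ℂ)‖ * (r - 1) + ‖(1 + τ0 + t * Complex.I : ℂ)‖ * (r - 1))
      (h := fun w : ℝ => (w:ℂ) ^ (-(1 + τ + t * Complex.I)) -
        (w:ℂ) ^ (-(1 + τ0 + t * Complex.I))) hz2 hr1 hr2 (by positivity) (by positivity) hN0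
      ((continuousOn_cpow_neg _).sub (continuousOn_cpow_neg _)) (fun w hw hwN => by
        refine (hnle w hw).trans ?_
        have h1 : log w ≤ 7 * K * log z := by
          rw [← hlN0]; exact Real.log_le_log (by linarith) hwN
        calc _ ≤ (τ0 - τ) * (7 * K * log z) * (1 / w) := by
              gcongr; exact hrpow w hw
          _ = _ := by ring) (fun w hw => by
        refine (hnle w hw).trans ?_
        have hw0 : 0 < w := by linarith
        have h1 : log w ≤ w ^ (τ / 2) / (τ / 2) := Real.log_le_rpow_div hw0.le (by positivity)
        calc _ ≤ (τ0 - τ) * (w ^ (τ / 2) / (τ / 2)) * w ^ (-1 - τ) := by gcongr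
          _ = 2 * (τ0 - τ) / τ * (w ^ (τ / 2) * w ^ (-1 - τ)) := by field_simp
          _ = _ := by rw [← Real.rpow_add hw0]; congr 2; ring) (fun n hn w hw => by
        have hn1 : (1:ℝ) ≤ n := by exact_mod_cast hn
        have o1 := cpow_osc hτ (hre τ) hn hw
        have o2 := cpow_osc hτ0 (hre τ0) hn hw
        have p1 : (n:ℝ) ^ (1 + τ / 2) ≤ (n:ℝ) ^ (1 + τ) :=
          Real.rpow_le_rpow_of_exponent_le hn1 (by linarith)
        have p2 : (n:ℝ) ^ (1 + τ / 2) ≤ (n:ℝ) ^ (1 + τ0) :=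
          Real.rpow_le_rpow_of_exponent_le hn1 (by linarith)
        have hr0 : 0 ≤ r - 1 := by linarith
        calc _ = ‖((w:ℂ) ^ (-(1 + τ + t * Complex.I)) - ((n:ℝ):ℂ) ^ (-(1 + τ + t * Complex.I))) -
              ((w:ℂ) ^ (-(1 + τ0 + t * Complex.I)) - ((n:ℝ):ℂ) ^ (-(1 + τ0 + t * Complex.I)))‖ := by
              congr 1; ring
          _ ≤ _ := (norm_sub_le _ _).trans (add_le_add o1 o2)
          _ ≤ _ := by rw [add_div]; gcongr) hC
    have hsummable : ∀ τ' : ℝ, 0 < τ' →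
        Summable fun n : ℕ => (rI z n : ℂ) * (n:ℂ) ^ (-(1 + τ' + t * Complex.I)) := by
      intro τ' hτ'
      refine Summable.of_norm_bounded (Fr_summable z (σ := 1 + τ') (by linarith)) fun n => ?_
      rcases Nat.eq_zero_or_pos n with rfl | hn
      · simp [rI_zero hz2]
      · have := norm_cpow_neg (hre τ') (w := n) (by exact_mod_cast hn)
        rw [Complex.ofReal_natCast] at this
        rw [norm_mul, this, Complex.norm_real, Real.norm_of_nonneg (rI_nonneg _ _),
          show -1 - τ' = -(1 + τ') by ring, Real.rpow_neg (by positivity), div_eq_mul_inv]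
    have hintg : ∀ τ' : ℝ, 0 < τ' →
        IntegrableOn (fun w : ℝ => (w:ℂ) ^ (-(1 + τ' + t * Complex.I))) (Set.Ioi 1) := by
      intro τ' hτ'
      apply integrableOn_Ioi_cpow_of_lt
      · rw [Complex.neg_re, hre]; linarith
      · norm_num
    simp only [Complex.ofReal_natCast] at key
    have hts : ∑' n : ℕ, (rI z n : ℂ) * ((n:ℂ) ^ (-(1 + τ + t * Complex.I)) -
        (n:ℂ) ^ (-(1 + τ0 + t * Complex.I))) =
        Fs z (1 + τ + t * Complex.I) - Fs z (1 + τ0 + t * Complex.I) := by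
      rw [Fs_eq_tsum hz2, Fs_eq_tsum hz2, ← (hsummable τ hτ).tsum_sub (hsummable τ0 hτ0)]
      exact tsum_congr fun n => mul_sub _ _ _
    rw [hts, integral_sub (hintg τ hτ) (hintg τ0 hτ0), integral_cpow_neg (by rw [hre]; linarith),
      integral_cpow_neg (by rw [hre]; linarith), hden, hden, mul_sub (V z : ℂ), mul_one_div,
      mul_one_div] at key
    refine key.trans ?_
    have t1 : (‖(1 + τ + t * Complex.I : ℂ)‖ * (r - 1) + ‖(1 + τ0 + t * Complex.I : ℂ)‖ * (r - 1)) *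
        Fr z (1 + τ / 2) ≤ 16 * C1 * exp (-(K:ℝ)/4) := by
      have h1 := hFr z hz2 (1 + τ / 2) (by linarith) (by linarith)
      rw [add_sub_cancel_left] at h1
      calc _ ≤ (4 * (z:ℝ) ^ (1/4:ℝ) * (1 / z) + 4 * (z:ℝ) ^ (1/4:ℝ) * (1 / z)) *
              (2 * C1 * (1 / e2)) := by
            rw [hrz]
            have h2 : Fr z (1 + τ / 2) ≤ 2 * C1 * (1 / e2) := by
              refine h1.trans ?_
              calc _ = 2 * C1 * (V z / τ) := by field_simp
                _ ≤ _ := by gcongr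
            have h3 := hnorm τ hτ hτ1'
            have h3' := hnorm τ0 hτ0 hτ01
            have h4 := one_le_Fr z (σ := 1 + τ / 2) (by linarith)
            gcongr
        _ = 16 * C1 * ((z:ℝ) ^ (1/4:ℝ) / z * (1 / e2)) := by ring
        _ ≤ _ := by gcongr
    have t2 : (τ0 - τ) * (7 * K * log z) * (2 * ∑ n ∈ Ioc 0 ⌊N0⌋₊, rI z n / n + V z * log N0) ≤
        7 * (2 * C2 * 7 + 7) * ((τ0 - τ) * K ^ 2 * log z) := by
      calc _ ≤ (τ0 - τ) * (7 * K * log z) * ((2 * C2 * 7 + 7) * K) := by gcongr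
        _ = _ := by ring
    have t3 : (3 * exp (-(K:ℝ)) + (r - 1)) * V z * (2 * (τ0 - τ) / τ) / (τ / 2) ≤
        16 * ((τ0 - τ) * K ^ 2 * log z) := by
      have h5 : e2 * (1 / τ) ≤ log z := by
        rw [mul_one_div, div_le_iff₀ hτ]; linarith
      calc _ = (3 * exp (-(K:ℝ)) + (r - 1)) * (V z / τ) * (4 * (τ0 - τ) * (1 / τ)) := by
            field_simp; ring
        _ ≤ 4 * (e2 * e2) * (1 / e2) * (4 * (τ0 - τ) * (1 / τ)) := by gcongr
        _ = 16 * (τ0 - τ) * (e2 * (1 / τ)) := by field_simp; ring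
        _ ≤ 16 * (τ0 - τ) * log z := by gcongr
        _ = 16 * ((τ0 - τ) * 1 * log z) := by ring
        _ ≤ _ := by gcongr; exact one_le_pow₀ (by linarith)
    have hX : 0 ≤ (τ0 - τ) * K ^ 2 * log z := by positivity
    have hE : 0 ≤ exp (-(K:ℝ)/4) := (exp_pos _).le
    rw [hCdef]
    have p1 : 0 ≤ C1 * ((τ0 - τ) * K ^ 2 * log z) := by positivity
    have p2 : 0 ≤ C2 * exp (-(K:ℝ)/4) := by positivity
    linarith

end Hoh

namespace Hoh
open Finset Real MeasureTheory

lemma exists_nat_pow_mul_exp_le (n : ℕ) {ε : ℝ} (hε : 0 < ε) :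
    ∃ K1 : ℕ, ∀ K : ℕ, K1 ≤ K → (K:ℝ) ^ n * exp (-(K:ℝ) / 4) ≤ ε := by
  have h := (Real.tendsto_pow_mul_exp_neg_atTop_nhds_zero n).comp
    (Filter.Tendsto.atTop_div_const (by norm_num : (0:ℝ) < 4) tendsto_natCast_atTop_atTop)
  have h2 := h.eventually (eventually_le_nhds (show (0:ℝ) < ε / 4 ^ n by positivity))
  obtain ⟨K1, hK1⟩ := Filter.eventually_atTop.mp h2
  refine ⟨K1, fun K hK => ?_⟩
  have := hK1 K hK
  simp only [Function.comp] at this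
  rw [le_div_iff₀ (by positivity), div_pow] at this
  rw [neg_div]
  calc _ = (K:ℝ) ^ n / 4 ^ n * exp (-((K:ℝ) / 4)) * 4 ^ n := by field_simp
    _ ≤ ε := this

/-- The Möbius Dirichlet series over rough numbers. -/
noncomputable def Ls (z : ℕ) (s : ℂ) : ℂ :=
  LSeries ((fun n : ℕ => chi z n) * fun n : ℕ => (ArithmeticFunction.moebius n : ℂ)) s

lemma Fs_mul_Ls (z : ℕ) {s : ℂ} (hs : 1 < s.re) : Fs z s * Ls z s = 1 :=
  DirichletCharacter.LSeries.mul_mu_eq_one (chi z) hs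

lemma norm_LSeries_le_Fr {z : ℕ} (hz : 2 ≤ z) {f : ℕ → ℂ} (hf : ∀ n, ‖f n‖ ≤ rI z n) {s : ℂ}
    (hs : 1 < s.re) : ‖LSeries f s‖ ≤ Fr z s.re := by
  rw [LSeries, Fr]
  refine tsum_of_norm_bounded (Fr_summable z hs).hasSum fun n => ?_
  rw [LSeries.norm_term_eq]
  split_ifs with h
  · subst h; simp [rI_zero hz]
  · gcongr
    exact hf n

lemma norm_chi (z n : ℕ) : ‖chi z n‖ = rI z n := by
  rw [chi_apply, Complex.norm_real, Real.norm_of_nonneg (rI_nonneg _ _)]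

lemma norm_moebius_le (n : ℕ) : ‖(ArithmeticFunction.moebius n : ℂ)‖ ≤ 1 := by
  have := ArithmeticFunction.abs_moebius_le_one (n := n)
  rw [Complex.norm_intCast]
  exact_mod_cast this

lemma norm_Ls_le {z : ℕ} (hz : 2 ≤ z) {s : ℂ} (hs : 1 < s.re) : ‖Ls z s‖ ≤ Fr z s.re := by
  refine norm_LSeries_le_Fr hz (fun n => ?_) hs
  simp only [Pi.mul_apply, norm_mul, norm_chi]
  exact mul_le_of_le_one_right (rI_nonneg _ _) (norm_moebius_le n)

lemma norm_Fs_le {z : ℕ} (hz : 2 ≤ z) {s : ℂ} (hs : 1 < s.re) : ‖Fs z s‖ ≤ Fr z s.re :=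
  norm_LSeries_le_Fr hz (fun n => (norm_chi z n).le) hs

lemma Fr_anti {z : ℕ} {σ σ' : ℝ} (hσ : 1 < σ) (h : σ ≤ σ') : Fr z σ' ≤ Fr z σ := by
  refine (Fr_summable z (by linarith)).tsum_le_tsum (fun n => ?_) (Fr_summable z hσ)
  rcases Nat.eq_zero_or_pos n with rfl | hn
  · simp [Real.zero_rpow (show σ ≠ 0 by linarith), Real.zero_rpow (show σ' ≠ 0 by linarith)]
  · have h1 : (1:ℝ) ≤ n := by exact_mod_cast hn
    have := rI_nonneg z n
    gcongr

lemma three_four_one (z : ℕ) {x : ℝ} (hx : 0 < x) (t : ℝ) :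
    1 ≤ ‖Fs z (1 + x)‖ ^ 3 * ‖Fs z (1 + x + t * Complex.I)‖ ^ 4 *
      ‖Fs z (1 + x + (2 * t : ℝ) * Complex.I)‖ := by
  have h := DirichletCharacter.norm_LSeries_product_ge_one (chi z) hx t
  rw [norm_mul, norm_mul, norm_pow, norm_pow, show (chi z) ^ 2 = chi z from one_pow 2,
    mul_comm Complex.I, show (2 * Complex.I * t : ℂ) = (2 * t : ℝ) * Complex.I by push_cast; ring] at h
  exact h

set_option maxHeartbeats 2000000 in
/-- Uniform bound for the Möbius series to the right of the 1-line. -/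
lemma Ls_bound : ∃ C : ℝ, 1 ≤ C ∧ ∃ K1 : ℕ, 1 ≤ K1 ∧ ∀ K : ℕ, K1 ≤ K → ∀ z : ℕ, exp K ≤ z →
    ∀ τ : ℝ, exp (-(K:ℝ)/2) / log z ≤ τ → ∀ t : ℝ, |t| ≤ (z:ℝ) ^ (1/4:ℝ) →
    ‖Ls z (1 + τ + t * Complex.I)‖ ≤ C * K ^ 9 := by
  obtain ⟨C0, hC0, K1, hK1, happ⟩ := Fs_approx
  obtain ⟨C1', hC1', hFr'⟩ := Fr_le
  obtain ⟨c, hc, hV⟩ := V_ge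
  obtain ⟨C1, hC1, hFr⟩ : ∃ C1 : ℝ, 1 ≤ C1 ∧ ∀ z : ℕ, 2 ≤ z → ∀ σ : ℝ, 1 < σ →
      σ ≤ 1 + 1 / log z → Fr z σ ≤ C1 * V z / (σ - 1) := by
    refine ⟨max 1 C1', le_max_left _ _, fun z hz σ h1 h2 => (hFr' z hz σ h1 h2).trans ?_⟩
    have := V_pos z
    have : 0 < σ - 1 := by linarith
    gcongr
    exact le_max_right _ _
  set a := c / (2 * C0) with ha
  have ha0 : 0 < a := by positivity
  set D := C1 ^ 3 * (C0 + 1 / a) with hD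
  set E := C0 + 1 / a ^ 2 with hE
  have hD1 : 1 ≤ D := by
    have h1 : 1 ≤ C1 ^ 3 := one_le_pow₀ hC1
    have h2 : 1 ≤ C0 + 1 / a := by have : 0 < 1 / a := by positivity
                                   linarith
    rw [hD]; exact one_le_mul_of_one_le_of_one_le h1 h2
  have hE1 : 1 ≤ E := by
    have : 0 < 1 / a ^ 2 := by positivity
    rw [hE]; linarith
  set ρ0 := 1 / (256 * D * E ^ 4) with hρ0
  have hρ0p : 0 < ρ0 := by positivity
  have hρ01 : ρ0 ≤ 1 := by
    rw [hρ0, div_le_one (by positivity)]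
    have : 1 ≤ E ^ 4 := one_le_pow₀ hE1
    have := one_le_mul_of_one_le_of_one_le hD1 this
    linarith
  set m := 4 * E * ρ0 with hm
  have hm0 : 0 < m := by positivity
  obtain ⟨K2, hK2⟩ := exists_nat_pow_mul_exp_le 7 (show 0 < m / (4 * C0) by positivity)
  refine ⟨C1 / ρ0 + 1 + 2 / m, by
    have : 0 < C1 / ρ0 := by positivity
    have : 0 < 2 / m := by positivity
    linarith, max K1 K2, by omega, fun K hK z hz τ hτ1 t ht => ?_⟩
  have hK1' : (1:ℝ) ≤ K := by exact_mod_cast hK1.trans ((le_max_left _ _).trans hK)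
  have hK0 : (0:ℝ) < K := by linarith
  have hz2' : (2:ℝ) ≤ z := by
    have := Real.add_one_le_exp (K:ℝ); linarith
  have hz2 : 2 ≤ z := by exact_mod_cast hz2'
  have hz0 : (0:ℝ) < z := by linarith
  have hlz : 1 ≤ log (z:ℝ) := by
    rw [Real.le_log_iff_exp_le hz0]
    exact (Real.exp_le_exp.mpr hK1').trans hz
  have hlz0 : 0 < log (z:ℝ) := by linarith
  have hVp := V_pos z
  have hVl : V z * log z ≤ 1 := V_mul_log_le z (by omega)
  have hVg := hV z hz2
  have hτ : 0 < τ := lt_of_lt_of_le (by positivity) hτ1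
  have hK7 : 1 ≤ (K:ℝ) ^ 7 := one_le_pow₀ hK1'
  have hK79 : (K:ℝ) ^ 7 ≤ (K:ℝ) ^ 9 := pow_le_pow_right₀ hK1' (by norm_num)
  have hK9 : 1 ≤ (K:ℝ) ^ 9 := hK7.trans hK79
  have hre : ∀ τ' t' : ℝ, (1 + τ' + t' * Complex.I : ℂ).re = 1 + τ' := by intro τ' t'; simp
  set ρ := ρ0 / K ^ 9 with hρ
  have hρp : 0 < ρ := by positivity
  have hρ1 : ρ ≤ 1 := by
    rw [hρ, div_le_one (by positivity)]; linarith
  set τ0 := ρ / log z with hτ0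
  have hτ0p : 0 < τ0 := by positivity
  have hτ0l : τ0 ≤ 1 / log z := by rw [hτ0]; gcongr
  have hFrτ0 : Fr z (1 + τ0) ≤ C1 / ρ := by
    have h1 := hFr z hz2 (1 + τ0) (by linarith) (by linarith)
    rw [add_sub_cancel_left, hτ0] at h1
    calc _ ≤ _ := h1
      _ = C1 * (V z * log z) / ρ := by field_simp
      _ ≤ C1 * 1 / ρ := by gcongr
      _ = _ := by ring
  have p1 : 0 ≤ C1 / ρ0 := by positivity
  have p2 : 0 ≤ 2 / m := by positivity
  rcases le_or_gt τ0 τ with hcase | hcase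
  · have h1 := norm_Ls_le hz2 (s := 1 + τ + t * Complex.I) (by rw [hre]; linarith)
    rw [hre] at h1
    calc _ ≤ _ := h1
      _ ≤ Fr z (1 + τ0) := Fr_anti (by linarith) (by linarith)
      _ ≤ C1 / ρ := hFrτ0
      _ = C1 / ρ0 * K ^ 9 := by rw [hρ]; field_simp
      _ ≤ _ := by gcongr; linarith
  have ht2 : |t| ≤ 2 * (z:ℝ) ^ (1/4:ℝ) := by
    have : 0 ≤ (z:ℝ) ^ (1/4:ℝ) := by positivity
    linarith
  obtain ⟨hA, hB⟩ := happ K ((le_max_left _ _).trans hK) z hz τ hτ1 (hcase.le.trans hτ0l) t ht2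
  have hFL := Fs_mul_Ls z (s := 1 + τ + t * Complex.I) (by rw [hre]; linarith)
  have hFLn : ‖Fs z (1 + τ + t * Complex.I)‖ * ‖Ls z (1 + τ + t * Complex.I)‖ = 1 := by
    rw [← norm_mul, hFL, norm_one]
  set LL := ‖Ls z (1 + τ + t * Complex.I)‖ with hLL
  have hLL0 : 0 ≤ LL := norm_nonneg _
  have hnpos : 0 < ‖(τ + t * Complex.I : ℂ)‖ := by
    rw [norm_pos_iff]
    intro h
    have := congrArg Complex.re h
    simp at this; linarith
  rcases le_or_gt ‖(τ + t * Complex.I : ℂ)‖ (a / (K * log z)) with hcase2 | hcase2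
  · have h1 : 2 * C0 * K ≤ ‖(V z / (τ + t * Complex.I) : ℂ)‖ := by
      rw [norm_div, Complex.norm_real, Real.norm_of_nonneg hVp.le, le_div_iff₀ hnpos]
      calc _ ≤ 2 * C0 * K * (a / (K * log z)) := by gcongr
        _ = c / log z := by rw [ha]; field_simp
        _ ≤ V z := by rwa [div_le_iff₀ hlz0]
    have h2 : C0 * K ≤ ‖Fs z (1 + τ + t * Complex.I)‖ := by
      have := norm_sub_norm_le (V z / (τ + t * Complex.I) : ℂ) (Fs z (1 + τ + t * Complex.I))
      rw [norm_sub_rev] at this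
      linarith
    have h3 : 1 ≤ C0 * K := one_le_mul_of_one_le_of_one_le hC0 hK1'
    have h4 : LL ≤ 1 := by
      rw [← hFLn]
      exact le_mul_of_one_le_left hLL0 (h3.trans h2)
    exact h4.trans (one_le_mul_of_one_le_of_one_le (by linarith) hK9)
  · have hKl : 0 < a / (K * log z) := by positivity
    have hVdiv : V z / (a / (K * log z)) ≤ K / a := by
      rw [div_div_eq_mul_div]
      gcongr
      calc V z * (K * log z) = K * (V z * log z) := by ring
        _ ≤ K := mul_le_of_le_one_right hK0.le hVl
    have hsq : ∀ x y : ℝ, ‖(x + y * Complex.I : ℂ)‖ ^ 2 = x ^ 2 + y ^ 2 := by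
      intro x y
      rw [← Complex.normSq_eq_norm_sq, Complex.normSq_add_mul_I]
    have hcmp : ∀ y : ℝ, |t| ≤ |y| → ‖(τ + t * Complex.I : ℂ)‖ ≤ ‖(τ0 + y * Complex.I : ℂ)‖ := by
      intro y hy
      refine (sq_le_sq₀ (norm_nonneg _) (norm_nonneg _)).mp ?_
      rw [hsq, hsq]
      have := sq_le_sq.mpr hy
      have := pow_le_pow_left₀ hτ.le hcase.le 2
      linarith
    have h2t : |t| ≤ |2 * t| := by rw [abs_mul, abs_two]; linarith [abs_nonneg t]
    have hτ0ge : exp (-(K:ℝ)/2) / log z ≤ τ0 := hτ1.trans hcase.le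
    have hA2 := (happ K ((le_max_left _ _).trans hK) z hz τ0 hτ0ge hτ0l (2 * t)
      (by rw [abs_mul, abs_two]; linarith)).1
    have hn2 : a / (K * log z) ≤ ‖(τ0 + (2 * t : ℝ) * Complex.I : ℂ)‖ :=
      hcase2.le.trans (hcmp _ h2t)
    have hn3 : a / (K * log z) ≤ ‖(τ0 + t * Complex.I : ℂ)‖ := hcase2.le.trans (hcmp _ le_rfl)
    have hF2 : ‖Fs z (1 + τ0 + (2 * t : ℝ) * Complex.I)‖ ≤ (C0 + 1 / a) * K := by
      have h1 : ‖(V z / (τ0 + (2 * t : ℝ) * Complex.I) : ℂ)‖ ≤ K / a := by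
        rw [norm_div, Complex.norm_real, Real.norm_of_nonneg hVp.le]
        refine le_trans ?_ hVdiv
        gcongr
      have := norm_sub_norm_le (Fs z (1 + τ0 + (2 * t : ℝ) * Complex.I))
        (V z / (τ0 + (2 * t : ℝ) * Complex.I) : ℂ)
      have e : (C0 + 1 / a) * K = C0 * K + K / a := by ring
      linarith
    have hF1 : ‖Fs z (1 + τ0)‖ ≤ C1 / ρ := by
      have h := norm_Fs_le hz2 (s := 1 + τ0) (by simpa using hτ0p)
      have : (1 + τ0 : ℂ).re = 1 + τ0 := by simp
      rw [this] at h
      exact h.trans hFrτ0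
    have h341 := three_four_one z hτ0p t
    set F0 := ‖Fs z (1 + τ0 + t * Complex.I)‖ with hF0
    have hF0g : m / K ^ 7 ≤ F0 := by
      have h1 : 1 ≤ (C1 / ρ) ^ 3 * F0 ^ 4 * ((C0 + 1 / a) * K) := by
        refine h341.trans ?_
        gcongr
      have h2 : (m / K ^ 7) ^ 4 ≤ F0 ^ 4 := by
        have e1 : (C1 / ρ) ^ 3 * F0 ^ 4 * ((C0 + 1 / a) * K) = D * K ^ 28 / ρ0 ^ 3 * F0 ^ 4 := by
          rw [hD, hρ]; field_simp
        rw [e1] at h1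
        have e2 : (m / K ^ 7) ^ 4 = ρ0 ^ 3 / (D * K ^ 28) := by
          rw [hm, div_pow]
          have : (4 * E * ρ0) ^ 4 = ρ0 ^ 3 / D := by
            have h3 : ρ0 * (256 * D * E ^ 4) = 1 := by rw [hρ0]; field_simp
            rw [eq_div_iff (by positivity)]
            linear_combination ρ0 ^ 3 * h3
          rw [this]; field_simp
        rw [e2, div_le_iff₀ (by positivity)]
        rw [div_mul_eq_mul_div, le_div_iff₀ (by positivity)] at h1
        linarith
      exact le_of_pow_le_pow_left₀ (by norm_num) (norm_nonneg _) h2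
    have hBB := hB τ0 hcase hτ0l
    have hVV : ‖(V z / (τ + t * Complex.I) - V z / (τ0 + t * Complex.I) : ℂ)‖ ≤
        1 / a ^ 2 * ρ0 / K ^ 7 := by
      have hne1 : (τ + t * Complex.I : ℂ) ≠ 0 := norm_pos_iff.mp hnpos
      have hn0 : 0 < ‖(τ0 + t * Complex.I : ℂ)‖ := hKl.trans_le hn3
      have hne2 : (τ0 + t * Complex.I : ℂ) ≠ 0 := norm_pos_iff.mp hn0
      have e : (V z / (τ + t * Complex.I) - V z / (τ0 + t * Complex.I) : ℂ) =
          (V z / (τ + t * Complex.I)) * (((τ0 - τ : ℝ) : ℂ) / (τ0 + t * Complex.I)) := by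
        push_cast
        field_simp
        ring
      rw [e, norm_mul, norm_div, norm_div, Complex.norm_real, Complex.norm_real,
        Real.norm_of_nonneg hVp.le, Real.norm_of_nonneg (by linarith)]
      calc _ ≤ K / a * (τ0 / (a / (K * log z))) := by
            have h1 : V z / ‖(τ + t * Complex.I : ℂ)‖ ≤ K / a := by
              refine le_trans ?_ hVdiv
              gcongr
            have h2 : (τ0 - τ) / ‖(τ0 + t * Complex.I : ℂ)‖ ≤ τ0 / (a / (K * log z)) := by
              gcongr
              linarith
            have : 0 ≤ τ0 - τ := by linarith
            gcongr
        _ = _ := by rw [hτ0, hρ]; field_simp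
    have hsmall : C0 * exp (-(K:ℝ)/4) ≤ m / 4 / K ^ 7 := by
      have := hK2 K ((le_max_right _ _).trans hK)
      rw [le_div_iff₀ (by positivity)] at this ⊢
      linarith
    have hterm : C0 * ((τ0 - τ) * K ^ 2 * log z) ≤ C0 * ρ0 / K ^ 7 := by
      calc _ ≤ C0 * (τ0 * K ^ 2 * log z) := by gcongr; linarith
        _ = _ := by rw [hτ0, hρ]; field_simp
    have hsum : C0 * ρ0 / K ^ 7 + 1 / a ^ 2 * ρ0 / K ^ 7 = m / 4 / K ^ 7 := by
      rw [hm, hE]; ring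
    have hdiff : ‖Fs z (1 + τ + t * Complex.I) - Fs z (1 + τ0 + t * Complex.I)‖ ≤
        m / 2 / K ^ 7 := by
      have h1 := norm_sub_norm_le (Fs z (1 + τ + t * Complex.I) - Fs z (1 + τ0 + t * Complex.I))
        (V z / (τ + t * Complex.I) - V z / (τ0 + t * Complex.I) : ℂ)
      have e : m / 2 / K ^ 7 = m / 4 / K ^ 7 + m / 4 / K ^ 7 := by ring
      rw [mul_add] at hBB
      linarith
    have hFg : m / 2 / K ^ 7 ≤ ‖Fs z (1 + τ + t * Complex.I)‖ := by
      have h1 := norm_sub_norm_le (Fs z (1 + τ0 + t * Complex.I)) (Fs z (1 + τ + t * Complex.I))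
      rw [norm_sub_rev] at h1
      have e : m / K ^ 7 = m / 2 / K ^ 7 + m / 2 / K ^ 7 := by ring
      linarith
    have hLb : LL ≤ 2 / m * K ^ 7 := by
      have h1 : m / 2 / K ^ 7 * LL ≤ 1 := by
        rw [← hFLn]; gcongr
      calc LL = (m / 2 / K ^ 7 * LL) * (2 / m * K ^ 7) := by field_simp
        _ ≤ 1 * (2 / m * K ^ 7) := by gcongr
        _ = _ := one_mul _
    calc LL ≤ 2 / m * K ^ 7 := hLb
      _ ≤ 2 / m * K ^ 9 := by gcongr
      _ ≤ _ := by gcongr; linarith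

end Hoh

namespace Hoh
open Finset Real MeasureTheory
open scoped FourierTransform

/-- The triangle function. -/
noncomputable def tri (v : ℝ) : ℝ := max 0 (1 - |v|)

/-- The Fejér kernel. -/
noncomputable def fejer (x : ℝ) : ℝ := sinc (π * x) ^ 2

lemma tri_nonneg (v : ℝ) : 0 ≤ tri v := le_max_left _ _

lemma tri_le_one (v : ℝ) : tri v ≤ 1 := max_le zero_le_one (by linarith [abs_nonneg v])

lemma tri_eq_zero {v : ℝ} (h : 1 ≤ |v|) : tri v = 0 := max_eq_left (by linarith)

lemma continuous_tri : Continuous tri := by unfold tri; fun_prop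

lemma fejer_nonneg (x : ℝ) : 0 ≤ fejer x := sq_nonneg _

lemma fejer_le_one (x : ℝ) : fejer x ≤ 1 := by
  rw [fejer, sq_le_one_iff_abs_le_one]; exact abs_sinc_le_one _

lemma continuous_fejer : Continuous fejer := by
  unfold fejer; exact (continuous_sinc.comp (by fun_prop)).pow 2

lemma fejer_le {x : ℝ} (hx : x ≠ 0) : fejer x ≤ 1 / x ^ 2 := by
  have hp := pi_gt_three
  have h : π * x ≠ 0 := mul_ne_zero pi_ne_zero hx
  rw [fejer, sinc_of_ne_zero h, div_pow]
  have h1 : sin (π * x) ^ 2 ≤ 1 := sin_sq_le_one _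
  have h2 : 0 < x ^ 2 := by positivity
  have h3 : x ^ 2 ≤ (π * x) ^ 2 := by
    rw [mul_pow]; nlinarith [mul_le_mul_of_nonneg_right (show (1:ℝ) ≤ π ^ 2 by nlinarith) h2.le]
  gcongr

lemma fejer_ge {x : ℝ} (hx : |x| ≤ 1 / 2) : 2 / 5 ≤ fejer x := by
  have key : ∀ y : ℝ, 0 < y → y ≤ 1 / 2 → 2 / 5 ≤ fejer y := by
    intro y hy hy2
    have hp := pi_pos
    have h0 : π * y ≠ 0 := by positivity
    rw [fejer, sinc_of_ne_zero h0]
    have h1 : 2 / π * (π * y) ≤ sin (π * y) :=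
      Real.mul_le_sin (by positivity) (by nlinarith)
    have h2 : 2 / π ≤ sin (π * y) / (π * y) := by rwa [le_div_iff₀ (by positivity)]
    have h3 : (2 / π) ^ 2 ≤ (sin (π * y) / (π * y)) ^ 2 := by gcongr
    refine le_trans ?_ h3
    rw [div_pow, div_le_div_iff₀ (by norm_num) (by positivity)]
    have := pi_lt_d2
    nlinarith
  rcases lt_trichotomy x 0 with h | h | h
  · have h1 := key (-x) (by linarith) (by rw [abs_of_neg h] at hx; exact hx)
    rwa [fejer, mul_neg, sinc_neg] at h1
  · subst h; simp [fejer]; norm_num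
  · exact key x h (by rwa [abs_of_pos h] at hx)

lemma integrable_fejer : Integrable fejer := by
  refine (integrable_inv_one_add_sq.const_mul 2).mono'
    continuous_fejer.aestronglyMeasurable (Filter.Eventually.of_forall fun x => ?_)
  rw [Real.norm_of_nonneg (fejer_nonneg x), ← div_eq_mul_inv, le_div_iff₀ (by positivity)]
  have h1 := fejer_le_one x
  rcases eq_or_ne x 0 with rfl | h
  · linarith
  · have h2 := fejer_le h
    rw [le_div_iff₀ (by positivity)] at h2
    linarith

lemma integral_tri_eq (g : ℝ → ℂ) (hg : Continuous g) :
    ∫ v, (tri v : ℂ) * g v = (∫ v in (-1:ℝ)..0, ((1 + v : ℝ) : ℂ) * g v) +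
      ∫ v in (0:ℝ)..1, ((1 - v : ℝ) : ℂ) * g v := by
  have hc : Continuous fun v => (tri v : ℂ) * g v :=
    (Complex.continuous_ofReal.comp continuous_tri).mul hg
  have h1 : ∫ v, (tri v : ℂ) * g v = ∫ v in (-1:ℝ)..1, (tri v : ℂ) * g v := by
    rw [intervalIntegral.integral_of_le (by norm_num)]
    refine (setIntegral_eq_integral_of_forall_compl_eq_zero fun v hv => ?_).symm
    rw [tri_eq_zero, Complex.ofReal_zero, zero_mul]
    rw [Set.mem_Ioc, not_and_or] at hv
    rcases hv with h | h
    · rw [abs_of_nonpos (by linarith)]; linarith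
    · rw [abs_of_nonneg (by linarith)]; linarith
  rw [h1, ← intervalIntegral.integral_add_adjacent_intervals (b := 0)
    (hc.intervalIntegrable _ _) (hc.intervalIntegrable _ _)]
  congr 1
  · refine intervalIntegral.integral_congr fun v hv => ?_
    rw [Set.uIcc_of_le (by norm_num)] at hv
    have : tri v = 1 + v := by
      rw [tri, abs_of_nonpos hv.2, max_eq_right (by linarith [hv.1])]; ring
    simp only [this]
  · refine intervalIntegral.integral_congr fun v hv => ?_
    rw [Set.uIcc_of_le (by norm_num)] at hv
    have : tri v = 1 - v := by
      rw [tri, abs_of_nonneg hv.1, max_eq_right (by linarith [hv.2])]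
    simp only [this]

lemma integrable_tri : Integrable tri := by
  refine continuous_tri.integrable_of_hasCompactSupport ?_
  refine HasCompactSupport.of_support_subset_isCompact (isCompact_Icc (a := (-1:ℝ)) (b := 1)) ?_
  intro v hv
  by_contra h
  refine hv (tri_eq_zero ?_)
  rw [Set.mem_Icc, ← abs_le, not_le] at h
  exact h.le

lemma integral_tri_exp {c : ℂ} (hc : c ≠ 0) :
    ∫ v, (tri v : ℂ) * Complex.exp (c * v) =
      (Complex.exp c + Complex.exp (-c) - 2) / c ^ 2 := by
  rw [integral_tri_eq _ (by fun_prop)]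
  have hexp : ∀ v : ℝ, HasDerivAt (fun v : ℝ => Complex.exp (c * v)) (Complex.exp (c * v) * c) v := by
    intro v
    have := ((hasDerivAt_id v).ofReal_comp.const_mul c).cexp
    simpa using this
  have hid : ∀ v : ℝ, HasDerivAt (fun v : ℝ => (v : ℂ)) 1 v := fun v => by
    simpa using (hasDerivAt_id v).ofReal_comp
  have h1 := intervalIntegral.integral_eq_sub_of_hasDerivAt (a := (-1:ℝ)) (b := 0)
    (f := fun v : ℝ => (1 + (v:ℂ)) * Complex.exp (c * v) / c - Complex.exp (c * v) / c ^ 2)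
    (f' := fun v : ℝ => ((1 + v : ℝ) : ℂ) * Complex.exp (c * v)) (fun v _ => by
      have := ((((hid v).const_add 1).mul (hexp v)).div_const c).sub ((hexp v).div_const (c ^ 2))
      refine HasDerivAt.congr_deriv this ?_
      push_cast
      field_simp
      ring) (Continuous.intervalIntegrable (by fun_prop) _ _)
  have h2 := intervalIntegral.integral_eq_sub_of_hasDerivAt (a := (0:ℝ)) (b := 1)
    (f := fun v : ℝ => (1 - (v:ℂ)) * Complex.exp (c * v) / c + Complex.exp (c * v) / c ^ 2)
    (f' := fun v : ℝ => ((1 - v : ℝ) : ℂ) * Complex.exp (c * v)) (fun v _ => by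
      have := ((((hid v).const_sub 1).mul (hexp v)).div_const c).add ((hexp v).div_const (c ^ 2))
      refine HasDerivAt.congr_deriv this ?_
      push_cast
      field_simp
      ring) (Continuous.intervalIntegrable (by fun_prop) _ _)
  rw [h1, h2]
  simp
  field_simp
  ring

lemma integral_tri_zero : ∫ v, (tri v : ℂ) = 1 := by
  have h := integral_tri_eq (fun _ => 1) continuous_const
  simp only [mul_one] at h
  rw [h, intervalIntegral.integral_ofReal, intervalIntegral.integral_ofReal,
    intervalIntegral.integral_comp_add_left (fun x : ℝ => x) 1,
    intervalIntegral.integral_comp_sub_left (fun x : ℝ => x) 1, integral_id, integral_id]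
  norm_num

lemma integral_tri_fourier (x : ℝ) :
    ∫ v, (tri v : ℂ) * Complex.exp (-2 * π * x * v * Complex.I) = fejer x := by
  rcases eq_or_ne x 0 with rfl | hx
  · simp [fejer, integral_tri_zero]
  · have hpx : π * x ≠ 0 := mul_ne_zero pi_ne_zero hx
    have hpx' : (π * x : ℂ) ≠ 0 := by exact_mod_cast hpx
    have hc : (-2 * (π * x) * Complex.I : ℂ) ≠ 0 := by simp [hx, pi_ne_zero]
    have h := integral_tri_exp hc
    have e : ∀ v : ℝ, (-2 * π * x * v * Complex.I : ℂ) = (-2 * (π * x) * Complex.I : ℂ) * v := by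
      intro v; ring
    simp_rw [e]
    rw [h, fejer, sinc_of_ne_zero hpx]
    push_cast
    have h2 : Complex.exp (-2 * (π * x) * Complex.I) + Complex.exp (-(-2 * (π * x) * Complex.I)) =
        2 * Complex.cos (2 * (π * x)) := by
      rw [Complex.two_cos]; ring_nf
    rw [h2, Complex.cos_two_mul', Complex.cos_sq', div_pow]
    have hI : (-2 * (π * x) * Complex.I : ℂ) ^ 2 = -4 * (π * x) ^ 2 := by
      rw [mul_pow, Complex.I_sq]; ring
    rw [hI]
    field_simp
    ring

lemma fourier_tri : 𝓕 (fun v => (tri v : ℂ)) = fun x => (fejer x : ℂ) := by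
  ext x
  rw [Real.fourier_real_eq_integral_exp_smul, ← integral_tri_fourier]
  congr 1
  ext v
  rw [smul_eq_mul, mul_comm]
  congr 2
  push_cast
  ring

lemma integral_fejer_fourier (v : ℝ) :
    ∫ x, (fejer x : ℂ) * Complex.exp (2 * π * x * v * Complex.I) = tri v := by
  have h := Continuous.fourierInv_fourier_eq (f := fun v => (tri v : ℂ))
    (Complex.continuous_ofReal.comp continuous_tri) integrable_tri.ofReal
    (by rw [fourier_tri]; exact integrable_fejer.ofReal)
  have h2 := congrFun h v
  rw [fourier_tri, Real.fourierInv_eq'] at h2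
  rw [← h2]
  congr 1
  ext x
  rw [smul_eq_mul, mul_comm]
  congr 2
  simp
  ring

lemma integral_fejer : ∫ x, fejer x = 1 := by
  have h := integral_fejer_fourier 0
  simp only [Complex.ofReal_zero, mul_zero, zero_mul, Complex.exp_zero, mul_one,
    integral_complex_ofReal] at h
  have : tri 0 = 1 := by simp [tri]
  rw [this] at h
  exact_mod_cast h

end Hoh

namespace Hoh
open Finset Real MeasureTheory

lemma hasSum_fejer_sq (b l : ℕ → ℝ) (hb : ∀ n, 0 ≤ b n) (hs : Summable b) (T : ℝ) :
    HasSum (fun p : ℕ × ℕ => b p.1 * b p.2 * tri (T / π * (l p.2 - l p.1)))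
      (∫ x, fejer x * ‖∑' n, (b n : ℂ) * Complex.exp (-(l n * (2 * T * x) : ℝ) * Complex.I)‖ ^ 2) := by
  set e : ℕ → ℝ → ℂ := fun n x => (b n : ℂ) * Complex.exp (-(l n * (2 * T * x) : ℝ) * Complex.I)
    with he
  have hne : ∀ n x, ‖e n x‖ = b n := by
    intro n x
    rw [he]
    simp only [norm_mul, Complex.norm_real, Real.norm_of_nonneg (hb n)]
    rw [show (-((l n * (2 * T * x) : ℝ) : ℂ)) = ((-(l n * (2 * T * x)) : ℝ) : ℂ) by push_cast; ring,
      Complex.norm_exp_ofReal_mul_I, mul_one]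
  have hsq : ∀ x, ((‖∑' n, e n x‖ ^ 2 : ℝ) : ℂ) =
      ∑' p : ℕ × ℕ, e p.1 x * (starRingEnd ℂ) (e p.2 x) := by
    intro x
    have h1 : Summable fun n => ‖e n x‖ := by simp only [hne]; exact hs
    have h2 : Summable fun n => ‖(starRingEnd ℂ) (e n x)‖ := by simpa using h1
    rw [← tsum_mul_tsum_of_summable_norm h1 h2, ← Complex.conj_tsum, Complex.mul_conj,
      Complex.normSq_eq_norm_sq]
  have hintg : ∀ p : ℕ × ℕ, Integrable
      (fun x => (fejer x : ℂ) * (e p.1 x * (starRingEnd ℂ) (e p.2 x))) := by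
    intro p
    refine integrable_fejer.ofReal.mul_bdd (c := b p.1 * b p.2) ?_ ?_
    · refine Continuous.aestronglyMeasurable ?_
      refine Continuous.mul ?_ (Complex.continuous_conj.comp ?_) <;> simp only [he] <;> fun_prop
    · refine Filter.Eventually.of_forall fun x => ?_
      rw [norm_mul, RCLike.norm_conj, hne, hne]
  have hval : ∀ p : ℕ × ℕ, ∫ x, (fejer x : ℂ) * (e p.1 x * (starRingEnd ℂ) (e p.2 x)) =
      ((b p.1 * b p.2 * tri (T / π * (l p.2 - l p.1)) : ℝ) : ℂ) := by
    intro p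
    rw [Complex.ofReal_mul, ← integral_fejer_fourier, ← integral_const_mul]
    congr 1
    ext x
    simp only [he, map_mul, Complex.conj_ofReal, ← Complex.exp_conj]
    have : (b p.1 * Complex.exp (-(l p.1 * (2 * T * x) : ℝ) * Complex.I) *
        (b p.2 * Complex.exp ((starRingEnd ℂ) (-(l p.2 * (2 * T * x) : ℝ)) *
          (starRingEnd ℂ) Complex.I)) : ℂ) = b p.1 * b p.2 *
        Complex.exp (2 * π * x * (T / π * (l p.2 - l p.1) : ℝ) * Complex.I) := by
      rw [show ∀ u v w y : ℂ, u * v * (w * y) = u * w * (v * y) by intros; ring,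
        ← Complex.exp_add]
      congr 2
      have hp : (π : ℂ) ≠ 0 := by exact_mod_cast pi_ne_zero
      simp only [map_neg, Complex.conj_ofReal, Complex.conj_I]
      push_cast
      field_simp
      ring
    rw [this]
    push_cast
    ring
  have hnorm : ∀ p : ℕ × ℕ, ∫ x, ‖(fejer x : ℂ) * (e p.1 x * (starRingEnd ℂ) (e p.2 x))‖ =
      b p.1 * b p.2 := by
    intro p
    simp only [norm_mul, RCLike.norm_conj, hne, Complex.norm_real,
      Real.norm_of_nonneg (fejer_nonneg _)]
    rw [integral_mul_const, integral_fejer, one_mul]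
  have hmain := hasSum_integral_of_summable_integral_norm hintg (by
    simp only [hnorm]
    exact hs.mul_of_nonneg hs hb hb)
  simp only [hval, tsum_mul_left, ← hsq] at hmain
  have e2 : ∫ x, (fejer x : ℂ) * ((‖∑' n, e n x‖ ^ 2 : ℝ) : ℂ) =
      ((∫ x, fejer x * ‖∑' n, e n x‖ ^ 2 : ℝ) : ℂ) := by
    rw [← integral_complex_ofReal]
    congr 1
    ext x
    push_cast
    rfl
  rw [e2] at hmain
  exact Complex.hasSum_ofReal.mp hmain

/-- Mean value estimate for generalized Dirichlet series with nonnegative coefficients. -/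
lemma mean_value (b l B : ℕ → ℝ) (hb : ∀ n, 0 ≤ b n) (hs : Summable b) {T : ℝ} (hT : 0 < T)
    (hB : ∀ n, b n ≠ 0 → ∀ N : ℕ, ∑ m ∈ range N with |l m - l n| ≤ π / T, b m ≤ B n)
    (hsB : Summable fun n => b n * B n) :
    ∫ t in (-T)..T, ‖∑' n, (b n : ℂ) * Complex.exp (-(l n * t : ℝ) * Complex.I)‖ ^ 2 ≤
      5 * T * ∑' n, b n * B n := by
  have hH := hasSum_fejer_sq b l hb hs T
  set D : ℝ → ℂ := fun t => ∑' n, (b n : ℂ) * Complex.exp (-(l n * t : ℝ) * Complex.I) with hD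
  have hDc : Continuous D := by
    refine continuous_tsum (u := b) (fun n => by fun_prop) hs fun n x => ?_
    rw [norm_mul, Complex.norm_real, Real.norm_of_nonneg (hb n),
      show (-((l n * x : ℝ) : ℂ)) = ((-(l n * x) : ℝ) : ℂ) by push_cast; ring,
      Complex.norm_exp_ofReal_mul_I, mul_one]
  have hDb : ∀ t, ‖D t‖ ≤ ∑' n, b n := by
    intro t
    refine tsum_of_norm_bounded hs.hasSum fun n => ?_
    rw [norm_mul, Complex.norm_real, Real.norm_of_nonneg (hb n),
      show (-((l n * t : ℝ) : ℂ)) = ((-(l n * t) : ℝ) : ℂ) by push_cast; ring,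
      Complex.norm_exp_ofReal_mul_I, mul_one]
  have h1 : ∫ t in (-T)..T, ‖D t‖ ^ 2 = 2 * T * ∫ x in (-(1/2):ℝ)..(1/2), ‖D (2 * T * x)‖ ^ 2 := by
    rw [intervalIntegral.integral_comp_mul_left (fun t => ‖D t‖ ^ 2) (by positivity : 2 * T ≠ 0),
      smul_eq_mul, ← mul_assoc, mul_inv_cancel₀ (by positivity), one_mul]
    congr 1 <;> ring
  have hfi : Integrable fun x => fejer x * ‖D (2 * T * x)‖ ^ 2 := by
    refine integrable_fejer.mul_bdd (c := (∑' n, b n) ^ 2) ?_ ?_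
    · exact Continuous.aestronglyMeasurable (by fun_prop)
    · refine Filter.Eventually.of_forall fun x => ?_
      rw [Real.norm_of_nonneg (by positivity)]
      have := hDb (2 * T * x)
      gcongr
  have h2 : ∫ x in (-(1/2):ℝ)..(1/2), ‖D (2 * T * x)‖ ^ 2 ≤
      5 / 2 * ∫ x, fejer x * ‖D (2 * T * x)‖ ^ 2 := by
    calc _ ≤ ∫ x in (-(1/2):ℝ)..(1/2), 5 / 2 * (fejer x * ‖D (2 * T * x)‖ ^ 2) := by
          refine intervalIntegral.integral_mono_on (by norm_num)
            (Continuous.intervalIntegrable (by fun_prop) _ _)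
            (Continuous.intervalIntegrable (continuous_const.mul
              (continuous_fejer.mul (by fun_prop))) _ _) fun x hx => ?_
          have := fejer_ge (x := x) (abs_le.mpr hx)
          have h0 : 0 ≤ ‖D (2 * T * x)‖ ^ 2 := by positivity
          nlinarith
      _ = 5 / 2 * ∫ x in (-(1/2):ℝ)..(1/2), fejer x * ‖D (2 * T * x)‖ ^ 2 := by
          rw [intervalIntegral.integral_const_mul]
      _ ≤ _ := by
          rw [intervalIntegral.integral_of_le (by norm_num)]
          refine mul_le_mul_of_nonneg_left (setIntegral_le_integral hfi
            (Filter.Eventually.of_forall fun x => ?_)) (by norm_num)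
          exact mul_nonneg (fejer_nonneg x) (by positivity)
  have h3 : ∫ x, fejer x * ‖D (2 * T * x)‖ ^ 2 ≤ ∑' n, b n * B n := by
    have hH2 : HasSum (fun p : ℕ × ℕ => b p.1 * b p.2 * tri (T / π * (l p.2 - l p.1)))
      (∫ x, fejer x * ‖D (2 * T * x)‖ ^ 2) := hH
    rw [← hH2.tsum_eq, hH2.summable.tsum_prod]
    refine Summable.tsum_le_tsum (fun n => ?_) hH2.summable.prod hsB
    rcases eq_or_ne (b n) 0 with h | h
    · simp [h]
    simp_rw [mul_assoc]
    rw [tsum_mul_left]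
    gcongr
    · exact hb n
    refine Real.tsum_le_of_sum_range_le (fun m => mul_nonneg (hb m) (tri_nonneg _)) fun N => ?_
    refine le_trans ?_ (hB n h N)
    rw [sum_filter]
    refine sum_le_sum fun m _ => ?_
    split_ifs with hm
    · exact mul_le_of_le_one_right (hb m) (tri_le_one _)
    · rw [tri_eq_zero, mul_zero]
      rw [not_le, div_lt_iff₀ hT] at hm
      rw [abs_mul, abs_of_pos (by positivity), div_mul_eq_mul_div, le_div_iff₀ pi_pos]
      linarith
  rw [h1]
  have hT2 : 0 < 2 * T := by positivity
  calc _ ≤ 2 * T * (5 / 2 * ∑' n, b n * B n) := by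
        gcongr
        exact h2.trans (by gcongr)
    _ = _ := by ring

end Hoh

namespace Hoh
open Finset Real MeasureTheory
open ArithmeticFunction (vonMangoldt vonMangoldt_nonneg vonMangoldt_le_log)

lemma sum_vonMangoldt_nonrough (w N : ℕ) :
    ∑ n ∈ Ioc 0 N, vonMangoldt n * (1 - rI w n) ≤ w * log N := by
  rcases Nat.eq_zero_or_pos N with rfl | hN
  · simp
  set S := (Ioc 0 N).filter fun n => IsPrimePow n ∧ n.minFac ≤ w with hS
  have h1 : ∑ n ∈ Ioc 0 N, vonMangoldt n * (1 - rI w n) ≤ ∑ n ∈ S, vonMangoldt n := by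
    rw [hS, sum_filter]
    refine sum_le_sum fun n hn => ?_
    split_ifs with h
    · exact mul_le_of_le_one_right vonMangoldt_nonneg (by linarith [rI_nonneg w n])
    · by_cases hp : IsPrimePow n
      · have h2 : w < n.minFac := by
          by_contra hc; exact h ⟨hp, by omega⟩
        have : rI w n = 1 := by
          rw [rI_eq_one_iff]
          intro p hpp hpw hd
          have := Nat.minFac_le_of_dvd hpp.two_le hd
          omega
        rw [this]; simp
      · rw [ArithmeticFunction.vonMangoldt_apply, if_neg hp, zero_mul]
  refine h1.trans ?_
  have h2 : ∑ n ∈ S, vonMangoldt n =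
      ∑ p ∈ Ioc 0 w, ∑ n ∈ S with n.minFac = p, vonMangoldt n :=
    (sum_fiberwise_of_maps_to (fun n hn => by
      rw [hS, mem_filter] at hn
      exact mem_Ioc.mpr ⟨Nat.minFac_pos n, hn.2.2⟩) _).symm
  rw [h2]
  calc _ ≤ ∑ p ∈ Ioc 0 w, log N := by
        refine sum_le_sum fun p hp => ?_
        by_cases hpp : p.Prime
        swap
        · rw [sum_eq_zero]
          · exact Real.log_natCast_nonneg N
          · intro n hn
            rw [mem_filter, hS, mem_filter] at hn
            exact absurd (hn.2 ▸ Nat.minFac_prime hn.1.2.1.ne_one) hpp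
        · have hsub : (S.filter fun n => n.minFac = p) ⊆ (Icc 1 (Nat.log p N)).image (p ^ ·) := by
            intro n hn
            rw [mem_filter, hS, mem_filter, mem_Ioc] at hn
            obtain ⟨⟨⟨hn0, hnN⟩, ⟨q, k, hq, hk, hqk⟩, _⟩, hmin⟩ := hn
            have hqp : q = p := by
              rw [← hmin, ← hqk, hq.nat_prime.pow_minFac hk.ne']
            subst hqp
            rw [mem_image]
            refine ⟨k, mem_Icc.mpr ⟨hk, ?_⟩, hqk⟩
            exact Nat.le_log_of_pow_le hpp.one_lt (hqk ▸ hnN)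
          have hle : ∑ n ∈ S with n.minFac = p, vonMangoldt n ≤
              ∑ n ∈ (Icc 1 (Nat.log p N)).image (p ^ ·), vonMangoldt n :=
            sum_le_sum_of_subset_of_nonneg hsub fun _ _ _ => vonMangoldt_nonneg
          refine hle.trans ?_
          rw [sum_image (fun a _ b _ h => Nat.pow_right_injective hpp.two_le h)]
          calc _ = ∑ k ∈ Icc 1 (Nat.log p N), log p := by
                refine sum_congr rfl fun k hk => ?_
                rw [mem_Icc] at hk
                rw [ArithmeticFunction.vonMangoldt_apply_pow (by omega),
                  ArithmeticFunction.vonMangoldt_apply_prime hpp]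
            _ = log ((p ^ Nat.log p N : ℕ) : ℝ) := by
                rw [sum_const, Nat.card_Icc, nsmul_eq_mul]; push_cast
                rw [Real.log_pow]
            _ ≤ log N := by
                have h0 : 0 < p ^ Nat.log p N := Nat.pow_pos hpp.pos
                have := Nat.pow_log_le_self p hN.ne'
                apply Real.log_le_log (by exact_mod_cast h0)
                exact_mod_cast this
    _ = w * log N := by rw [sum_const, Nat.card_Ioc]; simp

lemma floor_level {x : ℝ} (hx : 2 ≤ x) : 2 ≤ ⌊x⌋₊ ∧ (⌊x⌋₊ : ℝ) ≤ x ∧ log x ≤ 2 * log ⌊x⌋₊ := by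
  have h2 : 2 ≤ ⌊x⌋₊ := Nat.le_floor (by exact_mod_cast hx)
  refine ⟨h2, Nat.floor_le (by linarith), ?_⟩
  have h2' : (2:ℝ) ≤ ⌊x⌋₊ := by exact_mod_cast h2
  have h3 := Nat.lt_floor_add_one x
  rw [show 2 * log (⌊x⌋₊:ℝ) = log ((⌊x⌋₊:ℝ) ^ 2) by rw [Real.log_pow]; norm_num]
  exact Real.log_le_log (by linarith) (by nlinarith)

lemma card_Ioc_floor_le {X Y : ℝ} (hX : 0 ≤ X) (hY : 0 ≤ Y) :
    ((Ioc ⌊X⌋₊ ⌊X + Y⌋₊).card : ℝ) ≤ Y + 1 := by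
  rw [Nat.card_Ioc]
  have h1 := Nat.floor_le (show 0 ≤ X + Y by linarith)
  have h2 := Nat.lt_floor_add_one X
  rw [Nat.cast_sub (Nat.floor_le_floor (by linarith))]
  linarith

set_option maxHeartbeats 1000000 in
lemma brun_titchmarsh : ∃ C : ℝ, 1 ≤ C ∧ ∀ X Y : ℝ, 1 ≤ X → √X ≤ Y → Y ≤ X →
    ∑ n ∈ Ioc ⌊X⌋₊ ⌊X + Y⌋₊, vonMangoldt n ≤ C * Y := by
  obtain ⟨g, C, hC, hg, h⟩ := rough_count_le
  have hl2 : 0 < log 2 := Real.log_pos (by norm_num)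
  refine ⟨1 + 2 * ((4 * g + 1) * log 2) + (16 * g * C + 8), by
    have : 0 ≤ 2 * ((4 * (g:ℝ) + 1) * log 2) := by positivity
    have : 0 ≤ 16 * (g:ℝ) * C := by positivity
    linarith, fun X Y hX hY hYX => ?_⟩
  have hX0 : 0 < X := by linarith
  have hsX : 1 ≤ √X := Real.one_le_sqrt.mpr hX
  have hY1 : 1 ≤ Y := hsX.trans hY
  have hg1 : (1:ℝ) ≤ g := by exact_mod_cast hg
  set Q := X ^ (1 / (4 * g : ℝ)) with hQ
  have hlogle : ∀ n ∈ Ioc ⌊X⌋₊ ⌊X + Y⌋₊, log n ≤ log (2 * X) := by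
    intro n hn
    rw [mem_Ioc] at hn
    have h1 : (n:ℝ) ≤ X + Y := by
      refine le_trans ?_ (Nat.floor_le (by linarith)); exact_mod_cast hn.2
    have : 0 < n := by omega
    exact Real.log_le_log (by exact_mod_cast this) (by linarith)
  have hl2X : 0 ≤ log (2 * X) := Real.log_nonneg (by linarith)
  rcases lt_or_ge Q 2 with hQ2 | hQ2
  · have hX2 : log X ≤ 4 * g * log 2 := by
      have h1 : log Q ≤ log 2 := Real.log_le_log (by positivity) hQ2.le
      rw [hQ, Real.log_rpow hX0, div_mul_eq_mul_div, div_le_iff₀ (by positivity)] at h1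
      linarith
    calc _ ≤ ∑ n ∈ Ioc ⌊X⌋₊ ⌊X + Y⌋₊, log (2 * X) :=
          sum_le_sum fun n hn => vonMangoldt_le_log.trans (hlogle n hn)
      _ = (Ioc ⌊X⌋₊ ⌊X + Y⌋₊).card * log (2 * X) := by rw [sum_const, nsmul_eq_mul]
      _ ≤ (Y + 1) * ((4 * g + 1) * log 2) := by
          gcongr
          · exact card_Ioc_floor_le hX0.le (by linarith)
          · rw [Real.log_mul (by norm_num) hX0.ne']; linarith
      _ ≤ (2 * Y) * ((4 * g + 1) * log 2) := by gcongr; linarith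
      _ ≤ _ := by
          have : 0 ≤ (1 + (16 * g * C + 8)) * Y := by positivity
          linarith
  · obtain ⟨hw2, hwQ, hlw⟩ := floor_level hQ2
    set w := ⌊Q⌋₊ with hw
    have hQg : Q ^ g ≤ √X := by
      rw [hQ, ← Real.rpow_natCast, ← Real.rpow_mul hX0.le, Real.sqrt_eq_rpow]
      apply Real.rpow_le_rpow_of_exponent_le hX
      rw [div_mul_eq_mul_div, one_mul]
      rw [div_le_div_iff₀ (by positivity) (by norm_num)]
      linarith
    have hwg : (w:ℝ) ^ g ≤ Y := (pow_le_pow_left₀ (by positivity) hwQ g).trans (hQg.trans hY)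
    have hcount := h w hw2 X Y hX0.le hwg
    have hw2' : (2:ℝ) ≤ w := by exact_mod_cast hw2
    have hlw0 : 0 < log (w:ℝ) := Real.log_pos (by linarith)
    have hlX : log X ≤ 8 * g * log w := by
      rw [hQ, Real.log_rpow hX0, div_mul_eq_mul_div, div_le_iff₀ (by positivity)] at hlw
      linarith
    have hl2w : log (2 * X) ≤ 16 * g * log w := by
      rw [Real.log_mul (by norm_num) hX0.ne']
      have h1 : log 2 ≤ log (w:ℝ) := Real.log_le_log (by norm_num) hw2'
      nlinarith
    have hsplit : ∑ n ∈ Ioc ⌊X⌋₊ ⌊X + Y⌋₊, vonMangoldt n =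
        ∑ n ∈ Ioc ⌊X⌋₊ ⌊X + Y⌋₊, vonMangoldt n * rI w n +
        ∑ n ∈ Ioc ⌊X⌋₊ ⌊X + Y⌋₊, vonMangoldt n * (1 - rI w n) := by
      rw [← sum_add_distrib]; refine sum_congr rfl fun n _ => by ring
    have p1 : ∑ n ∈ Ioc ⌊X⌋₊ ⌊X + Y⌋₊, vonMangoldt n * rI w n ≤ 16 * g * C * Y := by
      calc _ ≤ ∑ n ∈ Ioc ⌊X⌋₊ ⌊X + Y⌋₊, log (2 * X) * rI w n := by
            refine sum_le_sum fun n hn => ?_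
            have := rI_nonneg w n
            have := vonMangoldt_le_log.trans (hlogle n hn)
            gcongr
        _ = log (2 * X) * ∑ n ∈ Ioc ⌊X⌋₊ ⌊X + Y⌋₊, rI w n := by rw [mul_sum]
        _ ≤ (16 * g * log w) * (C * Y / log w) := by
            have := sum_nonneg fun n (_ : n ∈ Ioc ⌊X⌋₊ ⌊X + Y⌋₊) => rI_nonneg w n
            gcongr
        _ = _ := by field_simp
    have p2 : ∑ n ∈ Ioc ⌊X⌋₊ ⌊X + Y⌋₊, vonMangoldt n * (1 - rI w n) ≤ 8 * Y := by
      calc _ ≤ ∑ n ∈ Ioc 0 ⌊X + Y⌋₊, vonMangoldt n * (1 - rI w n) := by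
            refine sum_le_sum_of_subset_of_nonneg (Ioc_subset_Ioc_left (Nat.zero_le _)) ?_
            intro n _ _
            exact mul_nonneg vonMangoldt_nonneg (by linarith [rI_le_one w n])
        _ ≤ w * log ⌊X + Y⌋₊ := sum_vonMangoldt_nonrough _ _
        _ ≤ X ^ (1/4:ℝ) * (2 * X ^ (1/4:ℝ) * 4) := by
            have e1 : (w:ℝ) ≤ X ^ (1/4:ℝ) := by
              refine hwQ.trans ?_
              rw [hQ]
              apply Real.rpow_le_rpow_of_exponent_le hX
              gcongr
              linarith
            have hXY : 0 < ⌊X + Y⌋₊ := Nat.floor_pos.mpr (by linarith)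
            have e2 : log ⌊X + Y⌋₊ ≤ log (2 * X) :=
              Real.log_le_log (by exact_mod_cast hXY) ((Nat.floor_le (by linarith)).trans (by linarith))
            have e3 : log (2 * X) ≤ (2 * X) ^ (1/4:ℝ) / (1/4:ℝ) :=
              Real.log_le_rpow_div (by positivity) (by norm_num)
            have e4 : (2 * X) ^ (1/4:ℝ) ≤ 2 * X ^ (1/4:ℝ) := by
              rw [Real.mul_rpow (by norm_num) hX0.le]
              gcongr
              calc (2:ℝ) ^ (1/4:ℝ) ≤ 2 ^ (1:ℝ) :=
                    Real.rpow_le_rpow_of_exponent_le (by norm_num) (by norm_num)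
                _ = 2 := by simp
            have : log ⌊X + Y⌋₊ ≤ 2 * X ^ (1/4:ℝ) * 4 := by linarith
            gcongr
        _ = 8 * √X := by
            rw [Real.sqrt_eq_rpow, show (1/2:ℝ) = 1/4 + 1/4 by norm_num, Real.rpow_add hX0]; ring
        _ ≤ 8 * Y := by gcongr
    rw [hsplit]
    have : 0 ≤ (1 + 2 * ((4 * g + 1) * log 2)) * Y := by positivity
    linarith

lemma sum_vonMangoldt_le : ∃ C : ℝ, 1 ≤ C ∧ ∀ N : ℕ, ∑ n ∈ Ioc 0 N, vonMangoldt n ≤ C * N := by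
  refine ⟨log 4 + 4, by linarith [Real.log_nonneg (show (1:ℝ) ≤ 4 by norm_num)], fun N => ?_⟩
  have := Chebyshev.psi_le_const_mul_self (x := (N:ℝ)) (by positivity)
  rwa [Chebyshev.psi, Nat.floor_natCast] at this

/-- Sums of `Λ(n) n^{-1-β}`. -/
lemma sum_vonMangoldt_rpow_le : ∃ C : ℝ, 1 ≤ C ∧ ∀ β : ℝ, 0 < β →
    Summable (fun n : ℕ => vonMangoldt n / (n:ℝ) ^ (1 + β)) ∧
    ∑' n : ℕ, vonMangoldt n / (n:ℝ) ^ (1 + β) ≤ C * (1 + 1 / β) := by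
  obtain ⟨C, hC, hpsi⟩ := sum_vonMangoldt_le
  refine ⟨4 * C, by linarith, fun β hβ => ?_⟩
  have hl2 := Real.log_two_gt_d9
  set r := (2:ℝ) ^ (-β) with hr
  have hr0 : 0 < r := by positivity
  have hr1 : r < 1 := Real.rpow_lt_one_of_one_lt_of_neg (by norm_num) (by linarith)
  have hgeo : 1 / (1 - r) ≤ 2 * (1 + 1 / β) := by
    have h1 : r ≤ 1 / (1 + β * log 2) := by
      rw [hr, Real.rpow_def_of_pos (by norm_num), le_div_iff₀ (by positivity)]
      have h2 := Real.add_one_le_exp (β * log 2)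
      calc _ ≤ exp (log 2 * -β) * exp (β * log 2) := by gcongr; linarith
        _ = 1 := by rw [← Real.exp_add]; ring_nf; exact Real.exp_zero
    have h3 : β * log 2 / (1 + β * log 2) ≤ 1 - r := by
      have : β * log 2 / (1 + β * log 2) = 1 - 1 / (1 + β * log 2) := by field_simp; ring
      linarith
    calc 1 / (1 - r) ≤ 1 / (β * log 2 / (1 + β * log 2)) := by gcongr
      _ = 1 + 1 / (β * log 2) := by field_simp; ring
      _ ≤ 2 * (1 + 1 / β) := by
          have : 1 / (β * log 2) ≤ 2 / β := by
            rw [div_le_div_iff₀ (by positivity) hβ]; nlinarith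
          have e : 2 * (1 + 1 / β) = 2 + 2 / β := by ring
          linarith
  have hterm : ∀ n : ℕ, 0 ≤ vonMangoldt n / (n:ℝ) ^ (1 + β) := fun n =>
    div_nonneg vonMangoldt_nonneg (by positivity)
  have hdy : ∀ k : ℕ, ∑ n ∈ Ioc (2 ^ k) (2 ^ (k + 1)), vonMangoldt n / (n:ℝ) ^ (1 + β) ≤
      2 * C * r ^ k := by
    intro k
    have h2k : (0:ℝ) < 2 ^ k := by positivity
    calc _ ≤ ∑ n ∈ Ioc (2 ^ k) (2 ^ (k + 1)), vonMangoldt n / ((2:ℝ) ^ k) ^ (1 + β) := by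
          refine sum_le_sum fun n hn => ?_
          rw [mem_Ioc] at hn
          have h1 : (2:ℝ) ^ k ≤ n := by exact_mod_cast hn.1.le
          have := vonMangoldt_nonneg (n := n)
          gcongr
      _ = (∑ n ∈ Ioc (2 ^ k) (2 ^ (k + 1)), vonMangoldt n) / ((2:ℝ) ^ k) ^ (1 + β) := by
          rw [sum_div]
      _ ≤ (C * (2 ^ (k + 1) : ℕ)) / ((2:ℝ) ^ k) ^ (1 + β) := by
          gcongr
          refine le_trans ?_ (hpsi _)
          exact sum_le_sum_of_subset_of_nonneg (Ioc_subset_Ioc_left (Nat.zero_le _))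
            fun _ _ _ => vonMangoldt_nonneg
      _ = 2 * C * r ^ k := by
          rw [Real.rpow_add h2k, Real.rpow_one, hr, ← Real.rpow_natCast, ← Real.rpow_natCast,
            ← Real.rpow_mul (by norm_num), ← Real.rpow_mul (by norm_num)]
          rw [show -β * (k:ℝ) = -((k:ℝ) * β) by ring, Real.rpow_neg (by norm_num)]
          push_cast
          rw [pow_succ, ← Real.rpow_natCast]
          field_simp
  have hsum : ∀ k : ℕ, ∑ n ∈ range (2 ^ k + 1), vonMangoldt n / (n:ℝ) ^ (1 + β) ≤
      2 * C * ∑ j ∈ range k, r ^ j := by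
    intro k
    induction k with
    | zero => simp [sum_range_succ]
    | succ k ih =>
      rw [sum_range_succ _ k, mul_add, range_eq_Ico,
        ← sum_Ico_consecutive _ (Nat.zero_le _)
          (show 2 ^ k + 1 ≤ 2 ^ (k + 1) + 1 by rw [pow_succ]; omega), ← range_eq_Ico]
      have e : Ico (2 ^ k + 1) (2 ^ (k + 1) + 1) = Ioc (2 ^ k) (2 ^ (k + 1)) := by
        ext n; simp only [mem_Ico, mem_Ioc]; omega
      rw [e]
      exact add_le_add ih (hdy k)
  have hall : ∀ N : ℕ, ∑ n ∈ range N, vonMangoldt n / (n:ℝ) ^ (1 + β) ≤ 4 * C * (1 + 1 / β) := by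
    intro N
    have h1 : N < 2 ^ N := Nat.lt_two_pow_self
    calc _ ≤ ∑ n ∈ range (2 ^ N + 1), vonMangoldt n / (n:ℝ) ^ (1 + β) :=
          sum_le_sum_of_subset_of_nonneg (range_subset_range.mpr (by omega)) fun n _ _ => hterm n
      _ ≤ _ := hsum N
      _ ≤ 2 * C * (1 / (1 - r)) := by
          gcongr
          have := (summable_geometric_of_lt_one hr0.le hr1).sum_le_tsum (range N)
            (fun j _ => by positivity)
          rw [tsum_geometric_of_lt_one hr0.le hr1] at this
          simpa using this
      _ ≤ 2 * C * (2 * (1 + 1 / β)) := by gcongr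
      _ = _ := by ring
  exact ⟨summable_of_sum_range_le hterm hall, Real.tsum_le_of_sum_range_le hterm hall⟩

end Hoh

namespace Hoh
open Finset Real MeasureTheory
open ArithmeticFunction (vonMangoldt vonMangoldt_nonneg vonMangoldt_le_log)

/-- The von Mangoldt Dirichlet series over rough numbers. -/
noncomputable def Zs (z : ℕ) (s : ℂ) : ℂ :=
  LSeries ((fun n : ℕ => chi z n) * fun n : ℕ => (vonMangoldt n : ℂ)) s

lemma natCast_cpow_line {n : ℕ} (hn : n ≠ 0) (β t : ℝ) :
    (n : ℂ) ^ (1 + β + t * Complex.I : ℂ) =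
      (((n:ℝ) ^ (1 + β) : ℝ) : ℂ) * Complex.exp ((log n * t : ℝ) * Complex.I) := by
  have h0 : (n:ℂ) ≠ 0 := by exact_mod_cast hn
  rw [Complex.cpow_add _ _ h0, Complex.ofReal_cpow (Nat.cast_nonneg n)]
  congr 1
  · push_cast; rfl
  · rw [Complex.cpow_def_of_ne_zero h0, ← Complex.natCast_log]
    push_cast; ring_nf

lemma Zs_eq_tsum (z : ℕ) (β t : ℝ) : Zs z (1 + β + t * Complex.I) =
    ∑' n : ℕ, ((rI z n * vonMangoldt n / (n:ℝ) ^ (1 + β) : ℝ) : ℂ) *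
      Complex.exp (-(log n * t : ℝ) * Complex.I) := by
  rw [Zs, LSeries]
  congr 1
  ext n
  rcases eq_or_ne n 0 with rfl | hn
  · simp
  · rw [LSeries.term_of_ne_zero hn, natCast_cpow_line hn, Pi.mul_apply, chi_apply,
      neg_mul, Complex.exp_neg]
    push_cast
    field_simp

lemma sum_vonMangoldt_near : ∃ C : ℝ, 1 ≤ C ∧ ∀ n : ℕ, 2 ≤ n → ∀ T : ℝ, 16 ≤ T →
    T ≤ (n:ℝ) ^ (1/4:ℝ) → ∀ N : ℕ,
    ∑ m ∈ range N with |log ((m:ℕ):ℝ) - log n| ≤ π / T, vonMangoldt m ≤ C * (n / T) := by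
  obtain ⟨C, hC, hbt⟩ := brun_titchmarsh
  refine ⟨10 * C, by linarith, fun n hn T hT hTn N => ?_⟩
  have hpi := pi_lt_d2
  have hpi3 := pi_gt_three
  have hT0 : 0 < T := by linarith
  set u := π / T with hu
  have hu0 : 0 < u := by positivity
  have hu4 : u ≤ 1 / 4 := by rw [hu, div_le_iff₀ hT0]; linarith
  have hn2 : (2:ℝ) ≤ n := by exact_mod_cast hn
  have hn0 : (0:ℝ) < n := by linarith
  have hX : 1 ≤ (n:ℝ) * (1 - u) := by nlinarith
  have hnT : (n:ℝ) ^ (3/4:ℝ) ≤ n / T := by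
    rw [le_div_iff₀ hT0]
    calc (n:ℝ) ^ (3/4:ℝ) * T ≤ (n:ℝ) ^ (3/4:ℝ) * (n:ℝ) ^ (1/4:ℝ) := by gcongr
      _ = n := by rw [← Real.rpow_add hn0]; norm_num
  have hY1 : √((n:ℝ) * (1 - u)) ≤ 3 * u * n := by
    calc √((n:ℝ) * (1 - u)) ≤ √(n:ℝ) := Real.sqrt_le_sqrt (by nlinarith)
      _ ≤ (n:ℝ) ^ (3/4:ℝ) := by
          rw [Real.sqrt_eq_rpow]
          exact Real.rpow_le_rpow_of_exponent_le (by linarith) (by norm_num)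
      _ ≤ n / T := hnT
      _ ≤ 3 * u * n := by
          rw [hu, show 3 * (π / T) * n = 3 * π * (n / T) by ring]
          have : 0 < n / T := by positivity
          nlinarith
  have h := hbt ((n:ℝ) * (1 - u)) (3 * u * n) hX hY1 (by nlinarith)
  have e : C * (3 * u * n) ≤ 10 * C * (n / T) := by
    rw [hu, show C * (3 * (π / T) * n) = 3 * π * C * (n / T) by ring]
    gcongr
    linarith
  refine (sum_le_sum_of_subset_of_nonneg (fun m hm => ?_)
    fun _ _ _ => vonMangoldt_nonneg).trans (h.trans e)
  rw [mem_filter] at hm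
  have hm2 := abs_le.mp hm.2
  have hm0 : m ≠ 0 := by
    rintro rfl
    have h1 : log 2 ≤ log (n:ℝ) := Real.log_le_log (by norm_num) hn2
    have := Real.log_two_gt_d9
    simp at hm2
    linarith
  have hm0' : (0:ℝ) < m := by positivity
  rw [mem_Ioc]
  constructor
  · rw [Nat.floor_lt (by linarith)]
    have h1 : exp (log n - u) ≤ m := by
      rw [← Real.le_log_iff_exp_le hm0']; linarith
    rw [Real.exp_sub, Real.exp_log hn0] at h1
    refine lt_of_lt_of_le ?_ h1
    have h2 := Real.add_one_lt_exp (show -u ≠ 0 by linarith)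
    rw [div_eq_mul_inv, ← Real.exp_neg]
    gcongr
    linarith
  · refine Nat.le_floor ?_
    have h1 : (m:ℝ) ≤ exp (log n + u) := by
      rw [← Real.log_le_iff_le_exp hm0']; linarith
    rw [Real.exp_add, Real.exp_log hn0] at h1
    have h2 : exp u ≤ 1 + 2 * u := by
      have := Real.abs_exp_sub_one_le (x := u) (by rw [abs_of_pos hu0]; linarith)
      rw [abs_of_pos hu0] at this
      linarith [le_abs_self (exp u - 1)]
    nlinarith

set_option maxHeartbeats 1000000 in
lemma Zs_mean_value : ∃ C : ℝ, 1 ≤ C ∧ ∀ z : ℕ, 2 ≤ z → ∀ T : ℝ, 16 ≤ T → T ≤ (z:ℝ) ^ (1/4:ℝ) →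
    ∀ β : ℝ, 0 < β → ∫ t in (-T)..T, ‖Zs z (1 + β + t * Complex.I)‖ ^ 2 ≤
      C * (1 + 1 / β) * (z:ℝ) ^ (-(β / 2)) := by
  obtain ⟨C1, hC1, hnear⟩ := sum_vonMangoldt_near
  obtain ⟨C2, hC2, hser⟩ := sum_vonMangoldt_rpow_le
  refine ⟨5 * C1 * C2 * exp (1/4), ?_, fun z hz T hT hTz β hβ => ?_⟩
  · have := Real.one_le_exp (show (0:ℝ) ≤ 1/4 by norm_num)
    have h1 : 1 ≤ C1 * C2 := one_le_mul_of_one_le_of_one_le hC1 hC2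
    have h2 : 1 ≤ C1 * C2 * exp (1/4) := one_le_mul_of_one_le_of_one_le h1 this
    linarith
  obtain ⟨hs1, hs2⟩ := hser β hβ
  have hpi := pi_lt_d2
  have hpi0 := pi_pos
  have hT0 : 0 < T := by linarith
  have hz2 : (2:ℝ) ≤ z := by exact_mod_cast hz
  set b : ℕ → ℝ := fun n => rI z n * vonMangoldt n / (n:ℝ) ^ (1 + β) with hb
  set B : ℕ → ℝ := fun n => C1 * (n / T) * (exp ((1 + β) / 4) / (n:ℝ) ^ (1 + β)) with hBdef
  have hb0 : ∀ n, 0 ≤ b n := fun n =>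
    div_nonneg (mul_nonneg (rI_nonneg _ _) vonMangoldt_nonneg) (by positivity)
  have hble : ∀ n : ℕ, b n ≤ vonMangoldt n / (n:ℝ) ^ (1 + β) := fun n => by
    simp only [hb]
    gcongr
    exact mul_le_of_le_one_left vonMangoldt_nonneg (rI_le_one _ _)
  have hbs : Summable b := Summable.of_nonneg_of_le hb0 hble hs1
  have hbn : ∀ n, b n ≠ 0 → z < n := by
    intro n hn
    refine lt_of_rI_ne_zero (z := z) (fun h => hn (by simp [hb, h])) ?_
    by_contra hc
    apply hn
    have : n = 0 ∨ n = 1 := by omega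
    rcases this with rfl | rfl <;> simp [hb]
  have hu4 : π / T ≤ 1 / 4 := by rw [div_le_iff₀ hT0]; linarith
  have hB : ∀ n, b n ≠ 0 → ∀ N : ℕ,
      ∑ m ∈ range N with |log ((m:ℕ):ℝ) - log n| ≤ π / T, b m ≤ B n := by
    intro n hn N
    have hzn := hbn n hn
    have hzn' : (z:ℝ) ≤ n := by exact_mod_cast hzn.le
    have hn0 : (0:ℝ) < n := by linarith
    have h1 := hnear n (by omega) T hT (hTz.trans (by gcongr)) N
    calc _ ≤ ∑ m ∈ range N with |log ((m:ℕ):ℝ) - log n| ≤ π / T,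
          vonMangoldt m * (exp ((1 + β) / 4) / (n:ℝ) ^ (1 + β)) := by
          refine sum_le_sum fun m hm => (hble m).trans ?_
          rw [mem_filter] at hm
          have hm2 := abs_le.mp hm.2
          have hv := vonMangoldt_nonneg (n := m)
          rcases Nat.eq_zero_or_pos m with rfl | hm0
          · simp
          have hm0' : (0:ℝ) < m := by exact_mod_cast hm0
          rw [div_eq_mul_inv]
          gcongr
          rw [← one_div, div_le_div_iff₀ (by positivity) (by positivity), one_mul,
            Real.rpow_def_of_pos hn0, Real.rpow_def_of_pos hm0', ← Real.exp_add, Real.exp_le_exp]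
          nlinarith
      _ = (∑ m ∈ range N with |log ((m:ℕ):ℝ) - log n| ≤ π / T, vonMangoldt m) *
          (exp ((1 + β) / 4) / (n:ℝ) ^ (1 + β)) := by rw [sum_mul]
      _ ≤ _ := by
          simp only [hBdef]
          gcongr
  set E := C1 / T * exp (1/4) * (z:ℝ) ^ (-(β / 2)) with hE
  have hE0 : 0 ≤ E := by positivity
  have hbB : ∀ n, b n * B n ≤ E * (vonMangoldt n / (n:ℝ) ^ (1 + β)) := by
    intro n
    rcases eq_or_ne (b n) 0 with h | h
    · rw [h, zero_mul]
      exact mul_nonneg hE0 (div_nonneg vonMangoldt_nonneg (by positivity))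
    have hzn := hbn n h
    have hzn' : (z:ℝ) ≤ n := by exact_mod_cast hzn.le
    have hn0 : (0:ℝ) < n := by linarith
    have hz0 : (0:ℝ) < z := by linarith
    have hB2 : B n ≤ E := by
      have e1 : B n = C1 / T * (exp (1/4) * (exp (β / 4) * (n:ℝ) ^ (-β))) := by
        simp only [hBdef]
        rw [show (1 + β) / 4 = 1 / 4 + β / 4 by ring, Real.exp_add, Real.rpow_add hn0,
          Real.rpow_one, Real.rpow_neg hn0.le]
        field_simp
      rw [e1, hE, mul_assoc]
      gcongr
      have hl : 1 / 2 ≤ log (z:ℝ) := by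
        have := Real.log_two_gt_d9
        have := Real.log_le_log (by norm_num) hz2
        linarith
      calc exp (β / 4) * (n:ℝ) ^ (-β) ≤ exp (β / 4) * (z:ℝ) ^ (-β) := by
            gcongr ?_ * ?_
            exact Real.rpow_le_rpow_of_nonpos hz0 hzn' (by linarith)
        _ ≤ _ := by
            rw [Real.rpow_def_of_pos hz0, Real.rpow_def_of_pos hz0, ← Real.exp_add,
              Real.exp_le_exp]
            nlinarith
    rw [mul_comm E]
    exact mul_le_mul (hble n) hB2 (by simp only [hBdef]; positivity)
      (div_nonneg vonMangoldt_nonneg (by positivity))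
  have hbBs : Summable fun n => b n * B n :=
    Summable.of_nonneg_of_le (fun n => mul_nonneg (hb0 n) (by simp only [hBdef]; positivity)) hbB
      (hs1.mul_left E)
  have hmv := mean_value b (fun n : ℕ => log n) B hb0 hbs hT0 hB hbBs
  simp only [Zs_eq_tsum]
  calc _ ≤ _ := hmv
    _ ≤ 5 * T * (E * (C2 * (1 + 1 / β))) := by
        gcongr
        calc _ ≤ ∑' n : ℕ, E * (vonMangoldt n / (n:ℝ) ^ (1 + β)) :=
              hbBs.tsum_le_tsum hbB (hs1.mul_left E)
          _ = E * ∑' n : ℕ, vonMangoldt n / (n:ℝ) ^ (1 + β) := tsum_mul_left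
          _ ≤ _ := by gcongr
    _ = _ := by rw [hE]; field_simp

end Hoh

namespace Hoh
open Finset Real MeasureTheory
open ArithmeticFunction (vonMangoldt vonMangoldt_nonneg vonMangoldt_le_log)

lemma abscissa_lt_of_summable {f : ℕ → ℂ} (hf : ∀ s : ℂ, 1 < s.re → LSeriesSummable f s) {s : ℂ}
    (hs : 1 < s.re) : LSeries.abscissaOfAbsConv f < s.re := by
  have h := (hf (((1 + s.re) / 2 : ℝ) : ℂ) (by rw [Complex.ofReal_re]; linarith)).abscissaOfAbsConv_le
  rw [Complex.ofReal_re] at h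
  exact h.trans_lt (by exact_mod_cast (by linarith : (1 + s.re) / 2 < s.re))

lemma hasDerivAt_Fs (z : ℕ) {s : ℂ} (hs : 1 < s.re) : HasDerivAt (Fs z) (deriv (Fs z) s) s :=
  (LSeries_hasDerivAt (abscissa_lt_of_summable
    (fun _ hs => DirichletCharacter.LSeriesSummable_of_one_lt_re (chi z) hs)
    hs)).differentiableAt.hasDerivAt

lemma continuousOn_Zs (z : ℕ) : ContinuousOn (Zs z) {s | 1 < s.re} := by
  intro s hs
  exact (LSeries_hasDerivAt (abscissa_lt_of_summable
    (fun s hs => DirichletCharacter.LSeriesSummable_twist_vonMangoldt (chi z) hs)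
    hs)).continuousAt.continuousWithinAt

lemma Zs_eq (z : ℕ) {s : ℂ} (hs : 1 < s.re) : Zs z s = -deriv (Fs z) s / Fs z s :=
  DirichletCharacter.LSeries_twist_vonMangoldt_eq (chi z) hs

lemma hasDerivAt_Ls (z : ℕ) {s : ℂ} (hs : 1 < s.re) : HasDerivAt (Ls z) (Zs z s * Ls z s) s := by
  have hne : Fs z s ≠ 0 := left_ne_zero_of_mul_eq_one (Fs_mul_Ls z hs)
  have h1 := (hasDerivAt_Fs z hs).inv hne
  have hL : Ls z s = (Fs z s)⁻¹ := (inv_eq_of_mul_eq_one_right (Fs_mul_Ls z hs)).symm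
  have h2 : HasDerivAt (Fs z)⁻¹ (Zs z s * Ls z s) s := by
    refine h1.congr_deriv ?_
    rw [Zs_eq z hs, hL]
    field_simp
  refine h2.congr_of_eventuallyEq ?_
  filter_upwards [(isOpen_lt continuous_const Complex.continuous_re).mem_nhds hs] with w hw
  exact (inv_eq_of_mul_eq_one_right (Fs_mul_Ls z hw)).symm

lemma continuousOn_Ls (z : ℕ) : ContinuousOn (Ls z) {s | 1 < s.re} := fun _ hs =>
  (hasDerivAt_Ls z hs).continuousAt.continuousWithinAt

lemma tendsto_Ls (z : ℕ) (t : ℝ) :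
    Filter.Tendsto (fun x : ℝ => Ls z (x + t * Complex.I)) Filter.atTop (nhds 1) := by
  set f : ℕ → ℂ := fun n => chi z n * (ArithmeticFunction.moebius n : ℂ) *
    (n:ℂ) ^ (-(t * Complex.I)) with hf
  have hfb : ∀ n : ℕ, n ≠ 0 → ‖f n‖ ≤ 1 := by
    intro n hn
    have hn' : (n:ℂ) ≠ 0 := by exact_mod_cast hn
    have h0 : ‖(n:ℂ) ^ (-(t * Complex.I))‖ = 1 := by
      rw [Complex.norm_natCast_cpow_of_pos (Nat.pos_of_ne_zero hn)]
      simp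
    simp only [hf]
    rw [norm_mul, h0, norm_mul, norm_chi, mul_one]
    exact mul_le_one₀ (rI_le_one _ _) (norm_nonneg _) (norm_moebius_le n)
  have h1 : f 1 = 1 := by simp [hf]
  have h2 := LSeries.tendsto_atTop (f := f) (by
    have := (LSeriesSummable_of_bounded_of_one_lt_re hfb (s := 2) (by norm_num)).abscissaOfAbsConv_le
    exact this.trans_lt (EReal.coe_lt_top _))
  rw [h1] at h2
  refine h2.congr fun x => ?_
  rw [Ls, LSeries, LSeries]
  congr 1
  ext n
  rcases eq_or_ne n 0 with rfl | hn
  · simp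
  · have hn' : (n:ℂ) ≠ 0 := by exact_mod_cast hn
    rw [LSeries.term_of_ne_zero hn, LSeries.term_of_ne_zero hn, Complex.cpow_add _ _ hn']
    simp only [hf, Pi.mul_apply]
    rw [Complex.cpow_neg]
    field_simp

lemma one_sub_Ls_le (z : ℕ) {β M : ℝ} (hβ : 0 < β) (t : ℝ)
    (hM : ∀ τ, β ≤ τ → ‖Ls z (1 + τ + t * Complex.I)‖ ≤ M) :
    ‖1 - Ls z (1 + β + t * Complex.I)‖ₑ ≤
      ENNReal.ofReal M * ∫⁻ a in Set.Ioi (0:ℝ), ‖Zs z (1 + (β + a : ℝ) + t * Complex.I)‖ₑ := by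
  have hre : ∀ a : ℝ, 0 ≤ a → 1 < (1 + (β + a : ℝ) + t * Complex.I : ℂ).re := by
    intro a ha
    simp
    linarith
  have hline : ∀ a : ℝ, HasDerivAt (fun a : ℝ => (1 + (β + a : ℝ) + t * Complex.I : ℂ)) 1 a := by
    intro a
    have := (((hasDerivAt_id a).const_add β).ofReal_comp.const_add (1:ℂ)).add_const (t * Complex.I)
    simpa using this
  have hlc : Continuous fun a : ℝ => (1 + (β + a : ℝ) + t * Complex.I : ℂ) := by fun_prop
  have hbd : ∀ A : ℝ, 0 ≤ A → ‖Ls z (1 + (β + A : ℝ) + t * Complex.I) -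
      Ls z (1 + β + t * Complex.I)‖ₑ ≤ ENNReal.ofReal M *
        ∫⁻ a in Set.Ioi (0:ℝ), ‖Zs z (1 + (β + a : ℝ) + t * Complex.I)‖ₑ := by
    intro A hA
    have h1 := intervalIntegral.integral_eq_sub_of_hasDerivAt (a := 0) (b := A)
      (f := fun a : ℝ => Ls z (1 + (β + a : ℝ) + t * Complex.I))
      (f' := fun a : ℝ => Zs z (1 + (β + a : ℝ) + t * Complex.I) *
        Ls z (1 + (β + a : ℝ) + t * Complex.I)) (fun a ha => by
        rw [Set.uIcc_of_le hA] at ha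
        have := (hasDerivAt_Ls z (hre a ha.1)).comp a (hline a)
        rw [mul_one] at this
        exact this) (by
        refine ContinuousOn.intervalIntegrable ?_
        rw [Set.uIcc_of_le hA]
        exact ((continuousOn_Zs z).comp hlc.continuousOn fun a ha => hre a ha.1).mul
          ((continuousOn_Ls z).comp hlc.continuousOn fun a ha => hre a ha.1))
    simp only [add_zero] at h1
    rw [← h1, intervalIntegral.integral_of_le hA]
    refine (enorm_integral_le_lintegral_enorm _).trans ?_
    rw [← lintegral_const_mul' _ _ ENNReal.ofReal_ne_top]
    refine (lintegral_mono_set (Set.Ioc_subset_Ioi_self)).trans ?_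
    refine setLIntegral_mono' measurableSet_Ioi fun a ha => ?_
    rw [enorm_mul, mul_comm]
    gcongr
    rw [← ofReal_norm]
    exact ENNReal.ofReal_le_ofReal (hM _ (by linarith [Set.mem_Ioi.mp ha]))
  have hlim : Filter.Tendsto (fun A : ℝ => ‖Ls z (1 + (β + A : ℝ) + t * Complex.I) -
      Ls z (1 + β + t * Complex.I)‖ₑ) Filter.atTop
      (nhds ‖1 - Ls z (1 + β + t * Complex.I)‖ₑ) := by
    have h1 := (tendsto_Ls z t).comp (Filter.tendsto_atTop_add_const_left _ (1 + β) Filter.tendsto_id)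
    have h2 : Filter.Tendsto (fun A : ℝ => Ls z (1 + (β + A : ℝ) + t * Complex.I)) Filter.atTop
        (nhds 1) := by
      refine h1.congr fun A => ?_
      simp only [Function.comp, id]
      congr 1
      push_cast
      ring
    exact (h2.sub_const _).enorm
  refine le_of_tendsto hlim ?_
  filter_upwards [Filter.eventually_ge_atTop 0] with A hA using hbd A hA

lemma lintegral_rpow_exp {r : ℝ} (hr : 0 < r) :
    ∫⁻ a in Set.Ioi (0:ℝ), ENNReal.ofReal ((1 + a ^ (-(1/2):ℝ)) * exp (-(r * a))) =
      ENNReal.ofReal (1 / r + √π / √r) := by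
  have i1 : IntegrableOn (fun a : ℝ => exp (-(r * a))) (Set.Ioi 0) := by
    simpa using integrableOn_rpow_mul_exp_neg_mul_rpow (p := 1) (s := 0) (b := r)
      (by norm_num) (by norm_num) hr
  have i2 : IntegrableOn (fun a : ℝ => a ^ (-(1/2):ℝ) * exp (-(r * a))) (Set.Ioi 0) := by
    simpa using integrableOn_rpow_mul_exp_neg_mul_rpow (p := 1) (s := -(1/2)) (b := r)
      (by norm_num) (by norm_num) hr
  have e1 : ∫ a in Set.Ioi (0:ℝ), exp (-(r * a)) = 1 / r := by
    have := Real.integral_rpow_mul_exp_neg_mul_Ioi (a := 1) (r := r) one_pos hr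
    simpa using this
  have e2 : ∫ a in Set.Ioi (0:ℝ), a ^ (-(1/2):ℝ) * exp (-(r * a)) = √π / √r := by
    have := Real.integral_rpow_mul_exp_neg_mul_Ioi (a := 1/2) (r := r) (by norm_num) hr
    rw [Real.Gamma_one_half_eq, ← Real.sqrt_eq_rpow, Real.sqrt_div zero_le_one, Real.sqrt_one] at this
    rw [show (-(1/2):ℝ) = 1/2 - 1 by norm_num, this]
    ring
  rw [← ofReal_integral_eq_lintegral_ofReal]
  · congr 1
    simp only [add_mul, one_mul]
    rw [integral_add i1 i2, e1, e2]
  · simp only [add_mul, one_mul]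
    exact i1.add i2
  · rw [Filter.EventuallyLE, ae_restrict_iff' measurableSet_Ioi]
    refine Filter.Eventually.of_forall fun a ha => ?_
    have : 0 < a := ha
    simp only [Pi.zero_apply]
    positivity

set_option maxHeartbeats 1000000 in
lemma halasz_integral : ∃ C : ℝ, 1 ≤ C ∧ ∀ z : ℕ, 2 ≤ z → ∀ T : ℝ, 16 ≤ T → T ≤ (z:ℝ) ^ (1/4:ℝ) →
    ∀ M β : ℝ, 0 ≤ M → 0 < β → β ≤ 1 →
    (∀ t, |t| ≤ T → ∀ τ, β ≤ τ → ‖Ls z (1 + τ + t * Complex.I)‖ ≤ M) →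
    ∫ t in (-T)..T, ‖Zs z (1 + β + t * Complex.I)‖ * ‖1 - Ls z (1 + β + t * Complex.I)‖ ≤
      C * M / (√β * √(log z)) := by
  obtain ⟨C0, hC0, hmv⟩ := Zs_mean_value
  refine ⟨40 * C0, by linarith, fun z hz T hT hTz M β hM hβ hβ1 hL => ?_⟩
  have hT0 : 0 < T := by linarith
  have hz2 : (2:ℝ) ≤ z := by exact_mod_cast hz
  have hz0 : (0:ℝ) < z := by linarith
  have hl : 1 / 2 ≤ log (z:ℝ) := by
    have := Real.log_two_gt_d9
    have := Real.log_le_log (by norm_num) hz2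
    linarith
  have hl0 : 0 < log (z:ℝ) := by linarith
  set P := (volume : Measure ℝ).restrict (Set.Ioc (-T) T) with hP
  set Q := (volume : Measure ℝ).restrict (Set.Ioi 0) with hQ
  set Ψ : ℝ → ℝ := fun b => C0 * (1 + 1 / b) * (z:ℝ) ^ (-(b / 2)) with hΨ
  have hΨ0 : ∀ b, 0 < b → 0 < Ψ b := fun b hb => by simp only [hΨ]; positivity
  have hlineZ : ∀ b : ℝ, 0 < b → Continuous fun t : ℝ => Zs z (1 + b + t * Complex.I) := by
    intro b hb
    exact (continuousOn_Zs z).comp_continuous (by fun_prop) fun t => by simpa using hb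
  have hlineL : ∀ b : ℝ, 0 < b → Continuous fun t : ℝ => Ls z (1 + b + t * Complex.I) := by
    intro b hb
    exact (continuousOn_Ls z).comp_continuous (by fun_prop) fun t => by simpa using hb
  have hcs : ∀ b : ℝ, 0 < b → ∫⁻ t, ‖Zs z (1 + β + t * Complex.I)‖ₑ * ‖Zs z (1 + b + t * Complex.I)‖ₑ ∂P
      ≤ ENNReal.ofReal (√(Ψ β) * √(Ψ b)) := by
    intro b hb
    have hc1 := hlineZ β hβ
    have hc2 := hlineZ b hb
    simp only [← enorm_mul]
    rw [← ofReal_integral_norm_eq_lintegral_enorm (by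
      rw [hP]
      exact ((hc1.mul hc2).intervalIntegrable (-T) T).1)]
    apply ENNReal.ofReal_le_ofReal
    rw [hP, ← intervalIntegral.integral_of_le (by linarith)]
    have p1 := hΨ0 β hβ
    have p2 := hΨ0 b hb
    have q1 : 0 < √(Ψ β) := Real.sqrt_pos.mpr p1
    have q2 : 0 < √(Ψ b) := Real.sqrt_pos.mpr p2
    set lam := √(Ψ b) / √(Ψ β) with hlam
    have hlam0 : 0 < lam := by positivity
    calc _ ≤ ∫ t in (-T)..T, (lam / 2 * ‖Zs z (1 + β + t * Complex.I)‖ ^ 2 +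
          1 / (2 * lam) * ‖Zs z (1 + b + t * Complex.I)‖ ^ 2) := by
          refine intervalIntegral.integral_mono_on (by linarith)
            (Continuous.intervalIntegrable (by fun_prop) _ _)
            (Continuous.intervalIntegrable (by fun_prop) _ _) fun t _ => ?_
          rw [norm_mul]
          set x := ‖Zs z (1 + β + t * Complex.I)‖
          set y := ‖Zs z (1 + b + t * Complex.I)‖
          have : lam / 2 * x ^ 2 + 1 / (2 * lam) * y ^ 2 - x * y = (lam * x - y) ^ 2 / (2 * lam) := by
            field_simp; ring
          have h2 : 0 ≤ (lam * x - y) ^ 2 / (2 * lam) := by positivity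
          linarith
      _ = lam / 2 * (∫ t in (-T)..T, ‖Zs z (1 + β + t * Complex.I)‖ ^ 2) +
          1 / (2 * lam) * ∫ t in (-T)..T, ‖Zs z (1 + b + t * Complex.I)‖ ^ 2 := by
          rw [intervalIntegral.integral_add (Continuous.intervalIntegrable (by fun_prop) _ _)
            (Continuous.intervalIntegrable (by fun_prop) _ _),
            intervalIntegral.integral_const_mul, intervalIntegral.integral_const_mul]
      _ ≤ lam / 2 * Ψ β + 1 / (2 * lam) * Ψ b := by
          gcongr
          · exact hmv z hz T hT hTz β hβ
          · exact hmv z hz T hT hTz b hb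
      _ = √(Ψ β) * √(Ψ b) := by
          have s1 : Ψ β = √(Ψ β) * √(Ψ β) := (Real.mul_self_sqrt p1.le).symm
          have s2 : Ψ b = √(Ψ b) * √(Ψ b) := (Real.mul_self_sqrt p2.le).symm
          rw [hlam]
          generalize √(Ψ β) = u at *
          generalize √(Ψ b) = v at *
          rw [s1, s2]
          field_simp
          ring
  set r := log z / 4 with hr
  have hr0 : 0 < r := by positivity
  have hsΨ : ∀ a, 0 < a → √(Ψ β) * √(Ψ (β + a)) ≤
      √(Ψ β) * √C0 * ((1 + a ^ (-(1/2):ℝ)) * exp (-(r * a))) := by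
    intro a ha
    rw [mul_assoc]
    gcongr
    refine Real.sqrt_le_iff.mpr ⟨by positivity, ?_⟩
    have e1 : (a ^ (-(1/2):ℝ)) ^ 2 = 1 / a := by
      rw [← Real.rpow_natCast, ← Real.rpow_mul ha.le]
      norm_num
      rw [Real.rpow_neg_one]
    have e2 : exp (-(r * a)) ^ 2 = (z:ℝ) ^ (-(a / 2)) := by
      rw [Real.rpow_def_of_pos hz0, ← Real.exp_nat_mul, hr]
      congr 1
      push_cast
      ring
    have e3 : 0 ≤ a ^ (-(1/2):ℝ) := by positivity
    rw [mul_pow, Real.sq_sqrt (by linarith), mul_pow, e2]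
    simp only [hΨ]
    rw [mul_assoc]
    have h1 : 1 + 1 / (β + a) ≤ (1 + a ^ (-(1/2):ℝ)) ^ 2 := by
      have : 1 / (β + a) ≤ 1 / a := by gcongr; linarith
      nlinarith
    have h2 : (z:ℝ) ^ (-((β + a) / 2)) ≤ (z:ℝ) ^ (-(a / 2)) :=
      Real.rpow_le_rpow_of_exponent_le (by linarith) (by linarith)
    gcongr
  have hmeas : AEMeasurable (Function.uncurry fun (t a : ℝ) => ‖Zs z (1 + β + t * Complex.I)‖ₑ *
      ‖Zs z (1 + (β + a : ℝ) + t * Complex.I)‖ₑ) (P.prod Q) := by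
    rw [hP, hQ, Measure.prod_restrict]
    have hms : MeasurableSet (Set.Ioc (-T) T ×ˢ Set.Ioi (0:ℝ)) := measurableSet_Ioc.prod measurableSet_Ioi
    refine AEMeasurable.mul (f := fun p : ℝ × ℝ => ‖Zs z (1 + β + p.1 * Complex.I)‖ₑ)
      (g := fun p : ℝ × ℝ => ‖Zs z (1 + (β + p.2 : ℝ) + p.1 * Complex.I)‖ₑ) ?_ ?_
    · refine (ContinuousOn.aemeasurable (f := fun p : ℝ × ℝ => Zs z (1 + β + p.1 * Complex.I))
        (Continuous.continuousOn ((hlineZ β hβ).comp continuous_fst)) hms).enorm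
    · refine (ContinuousOn.aemeasurable
        (f := fun p : ℝ × ℝ => Zs z (1 + (β + p.2 : ℝ) + p.1 * Complex.I)) ?_ hms).enorm
      refine (continuousOn_Zs z).comp (Continuous.continuousOn (by fun_prop)) fun p hp => ?_
      have : 0 < p.2 := hp.2
      simp
      linarith
  have key : ∫⁻ t, ‖Zs z (1 + β + t * Complex.I)‖ₑ * ‖1 - Ls z (1 + β + t * Complex.I)‖ₑ ∂P ≤
      ENNReal.ofReal (M * (√(Ψ β) * √C0 * (1 / r + √π / √r))) := by
    calc _ ≤ ∫⁻ t, ENNReal.ofReal M * ∫⁻ a, ‖Zs z (1 + β + t * Complex.I)‖ₑ *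
          ‖Zs z (1 + (β + a : ℝ) + t * Complex.I)‖ₑ ∂Q ∂P := by
          rw [hP]
          refine setLIntegral_mono' measurableSet_Ioc fun t ht => ?_
          rw [lintegral_const_mul' _ _ enorm_ne_top, mul_left_comm]
          gcongr
          exact one_sub_Ls_le z hβ t (hL t (abs_le.mpr ⟨ht.1.le, ht.2⟩))
      _ = ENNReal.ofReal M * ∫⁻ a, ∫⁻ t, ‖Zs z (1 + β + t * Complex.I)‖ₑ *
          ‖Zs z (1 + (β + a : ℝ) + t * Complex.I)‖ₑ ∂P ∂Q := by
          rw [lintegral_const_mul' _ _ ENNReal.ofReal_ne_top, lintegral_lintegral_swap hmeas]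
      _ ≤ ENNReal.ofReal M * ∫⁻ a, ENNReal.ofReal (√(Ψ β) * √C0) *
          ENNReal.ofReal ((1 + a ^ (-(1/2):ℝ)) * exp (-(r * a))) ∂Q := by
          gcongr ENNReal.ofReal M * ?_
          rw [hQ]
          refine setLIntegral_mono' measurableSet_Ioi fun a ha => ?_
          have ha0 : 0 < a := ha
          rw [← ENNReal.ofReal_mul (by positivity)]
          exact (hcs (β + a) (by linarith)).trans (ENNReal.ofReal_le_ofReal (hsΨ a ha0))
      _ = _ := by
          rw [lintegral_const_mul' _ _ ENNReal.ofReal_ne_top, hQ, lintegral_rpow_exp hr0,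
            ← ENNReal.ofReal_mul (by positivity), ← ENNReal.ofReal_mul hM]
  have hfin : ∫ t in (-T)..T, ‖Zs z (1 + β + t * Complex.I)‖ * ‖1 - Ls z (1 + β + t * Complex.I)‖ ≤
      M * (√(Ψ β) * √C0 * (1 / r + √π / √r)) := by
    rw [← ENNReal.ofReal_le_ofReal_iff (by positivity)]
    refine le_trans ?_ key
    have hc1 := hlineZ β hβ
    have hc2 := (continuous_const (y := (1:ℂ))).sub (hlineL β hβ)
    simp only [← enorm_mul, ← norm_mul]
    rw [← ofReal_integral_norm_eq_lintegral_enorm (by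
      rw [hP]
      exact ((hc1.mul hc2).intervalIntegrable (-T) T).1)]
    apply ENNReal.ofReal_le_ofReal
    rw [hP, ← intervalIntegral.integral_of_le (by linarith)]
  refine hfin.trans ?_
  have hsb : 0 < √β := Real.sqrt_pos.mpr hβ
  have hsl : 0 < √(log (z:ℝ)) := Real.sqrt_pos.mpr hl0
  have g1 : √(Ψ β) ≤ √C0 * (2 / √β) := by
    refine Real.sqrt_le_iff.mpr ⟨by positivity, ?_⟩
    rw [mul_pow, Real.sq_sqrt (by linarith), div_pow, Real.sq_sqrt hβ.le]
    simp only [hΨ]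
    have h1 : (z:ℝ) ^ (-(β / 2)) ≤ 1 := Real.rpow_le_one_of_one_le_of_nonpos (by linarith) (by linarith)
    have h2 : 1 + 1 / β ≤ 2 ^ 2 / β := by
      rw [le_div_iff₀ hβ, add_mul, one_div, inv_mul_cancel₀ hβ.ne']; linarith
    calc _ ≤ C0 * (2 ^ 2 / β) * 1 := by gcongr
      _ = _ := by ring
  have g2 : 1 / r + √π / √r ≤ 20 / √(log z) := by
    have h1 : √r = √(log z) / 2 := by
      rw [hr, Real.sqrt_div hl0.le, show (4:ℝ) = 2 ^ 2 by norm_num, Real.sqrt_sq (by norm_num)]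
    have h2 : √π ≤ 2 := Real.sqrt_le_iff.mpr ⟨by norm_num, by linarith [pi_lt_d2]⟩
    have h3 : 1 / r = 4 / √(log z) / √(log z) := by
      rw [hr, div_div, Real.mul_self_sqrt hl0.le]; field_simp
    have h4 : 1 / 2 ≤ √(log (z:ℝ)) := by
      rw [Real.le_sqrt (by norm_num) hl0.le]; linarith
    have h5 : 4 / √(log (z:ℝ)) ≤ 8 := by rw [div_le_iff₀ hsl]; linarith
    calc 1 / r + √π / √r ≤ 8 / √(log z) + 2 / (√(log z) / 2) := by
          rw [h3, h1]; gcongr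
      _ = 12 / √(log z) := by field_simp; norm_num
      _ ≤ 20 / √(log z) := by gcongr; norm_num
  calc _ ≤ M * (√C0 * (2 / √β) * √C0 * (20 / √(log z))) := by gcongr
    _ = 40 * (√C0 * √C0) * M / (√β * √(log z)) := by field_simp; ring
    _ = _ := by rw [Real.mul_self_sqrt (by linarith)]

end Hoh

namespace Hoh
open Finset Real MeasureTheory
open ArithmeticFunction (vonMangoldt vonMangoldt_nonneg vonMangoldt_le_log)

lemma fejer_sum_le {c lam : ℕ → ℝ} (hc : Summable fun n => |c n|) {T : ℝ} (hT : 0 < T) (v : ℝ) :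
    |∑' n, c n * (T * fejer (T * (lam n - v)))| ≤
      ∫ t in (-(2 * π * T))..(2 * π * T),
        ‖∑' n, (c n : ℂ) * Complex.exp (-(lam n * t : ℝ) * Complex.I)‖ := by
  set D : ℝ → ℂ := fun t => ∑' n, (c n : ℂ) * Complex.exp (-(lam n * t : ℝ) * Complex.I) with hD
  have hnorm : ∀ y : ℝ, ‖Complex.exp (-(y:ℂ) * Complex.I)‖ = 1 := by
    intro y
    have := Complex.norm_exp_ofReal_mul_I (-y)
    push_cast at this
    exact this
  have hDc : Continuous D := by
    refine continuous_tsum (fun n => by fun_prop) hc fun n t => ?_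
    rw [norm_mul, hnorm, mul_one, Complex.norm_real, Real.norm_eq_abs]
  set F : ℕ → ℝ → ℂ := fun n u => (c n * T : ℝ) * ((tri u : ℂ) *
    Complex.exp (-2 * π * (T * (lam n - v) : ℝ) * u * Complex.I)) with hF
  have hFn : ∀ n u, ‖F n u‖ = |c n| * T * tri u := by
    intro n u
    have h2 : Complex.exp (-2 * π * (T * (lam n - v) : ℝ) * u * Complex.I) =
        Complex.exp (-((2 * π * (T * (lam n - v)) * u : ℝ) : ℂ) * Complex.I) := by
      congr 1; push_cast; ring
    rw [hF]
    simp only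
    rw [h2, norm_mul, norm_mul, hnorm, mul_one, Complex.norm_real, Complex.norm_real,
      Real.norm_eq_abs, Real.norm_of_nonneg (tri_nonneg u), abs_mul, abs_of_pos hT]
  have hFc : ∀ n, Continuous (F n) := fun n =>
    continuous_const.mul ((Complex.continuous_ofReal.comp continuous_tri).mul (by fun_prop))
  have hFi : ∀ n, Integrable (F n) := fun n =>
    (integrable_tri.const_mul (|c n| * T)).mono' (hFc n).aestronglyMeasurable
      (Filter.Eventually.of_forall fun u => (hFn n u).le)
  have hsum := hasSum_integral_of_summable_integral_norm hFi (by
    simp only [hFn, integral_const_mul, mul_assoc]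
    exact hc.mul_right _)
  have e1 : ∀ n, ∫ u, F n u = ((c n * (T * fejer (T * (lam n - v))) : ℝ) : ℂ) := by
    intro n
    simp only [hF]
    rw [integral_const_mul, integral_tri_fourier]
    push_cast; ring
  have e2 : ∀ u : ℝ, ∑' n, F n u = T * tri u * Complex.exp ((2 * π * T * v * u : ℝ) * Complex.I) *
      D (2 * π * T * u) := by
    intro u
    simp only [hF, hD]
    rw [← tsum_mul_left]
    congr 1
    ext n
    have : Complex.exp (-2 * π * (T * (lam n - v) : ℝ) * u * Complex.I) =
        Complex.exp ((2 * π * T * v * u : ℝ) * Complex.I) *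
        Complex.exp (-(lam n * (2 * π * T * u) : ℝ) * Complex.I) := by
      rw [← Complex.exp_add]; congr 1; push_cast; ring
    rw [this]; push_cast; ring
  simp only [e1, e2] at hsum
  have h3 : ((∑' n, c n * (T * fejer (T * (lam n - v))) : ℝ) : ℂ) =
      ∫ u : ℝ, T * tri u * Complex.exp ((2 * π * T * v * u : ℝ) * Complex.I) *
        D (2 * π * T * u) := by
    rw [← hsum.tsum_eq, Complex.ofReal_tsum]
  rw [← Real.norm_eq_abs, ← Complex.norm_real, h3]
  have hT2 : 0 < 2 * π * T := by positivity
  have h4 : ∫ u : ℝ, (T * tri u * Complex.exp ((2 * π * T * v * u : ℝ) * Complex.I) *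
        D (2 * π * T * u)) = ∫ u in Set.Ioc (-1:ℝ) 1,
          (T * tri u * Complex.exp ((2 * π * T * v * u : ℝ) * Complex.I) * D (2 * π * T * u)) := by
    symm
    refine setIntegral_eq_integral_of_forall_compl_eq_zero fun u hu => ?_
    rw [tri_eq_zero]
    · simp
    · by_contra h
      push Not at h
      exact hu ⟨(abs_lt.mp h).1, (abs_lt.mp h).2.le⟩
  rw [h4, ← intervalIntegral.integral_of_le (by norm_num)]
  calc _ ≤ ∫ u in (-1:ℝ)..1, T * ‖D (2 * π * T * u)‖ := by
        refine intervalIntegral.norm_integral_le_of_norm_le (by norm_num)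
          (Filter.Eventually.of_forall fun u _ => ?_)
          (Continuous.intervalIntegrable (by fun_prop) _ _)
        rw [norm_mul, norm_mul, norm_mul, Complex.norm_exp_ofReal_mul_I, Complex.norm_real,
          Complex.norm_real, Real.norm_of_nonneg hT.le, Real.norm_of_nonneg (tri_nonneg u)]
        have := tri_le_one u
        gcongr
        nlinarith
    _ = T * ((2 * π * T)⁻¹ * ∫ t in (-(2 * π * T))..(2 * π * T), ‖D t‖) := by
        rw [intervalIntegral.integral_const_mul,
          intervalIntegral.integral_comp_mul_left (fun t => ‖D t‖) hT2.ne']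
        simp
    _ ≤ 1 * ∫ t in (-(2 * π * T))..(2 * π * T), ‖D t‖ := by
        rw [← mul_assoc]
        have hpi := pi_gt_three
        gcongr
        · exact intervalIntegral.integral_nonneg (by linarith) fun t _ => norm_nonneg _
        · rw [mul_inv_le_iff₀ hT2]; nlinarith
    _ = _ := one_mul _

/-- The distribution function of the Fejér kernel. -/
noncomputable def fejerG (a : ℝ) : ℝ := ∫ x in Set.Iic a, fejer x

lemma fejerG_mono : Monotone fejerG := fun _ _ hab =>
  setIntegral_mono_set integrable_fejer.integrableOn
    (Filter.Eventually.of_forall fejer_nonneg) (Set.Iic_subset_Iic.mpr hab).eventuallyLE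

lemma fejerG_nonneg (a : ℝ) : 0 ≤ fejerG a := integral_nonneg fejer_nonneg

lemma fejerG_add (a : ℝ) : fejerG a + ∫ x in Set.Ioi a, fejer x = 1 := by
  rw [fejerG, intervalIntegral.integral_Iic_add_Ioi integrable_fejer.integrableOn
    integrable_fejer.integrableOn, integral_fejer]

lemma fejerG_le_one (a : ℝ) : fejerG a ≤ 1 := by
  have h : 0 ≤ ∫ x in Set.Ioi a, fejer x := integral_nonneg fejer_nonneg
  linarith [fejerG_add a]

lemma integral_Ioi_fejer_le {a : ℝ} (ha : 0 < a) : ∫ x in Set.Ioi a, fejer x ≤ 1 / a := by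
  have h := integral_Ioi_rpow_of_lt (a := -2) (by norm_num) ha
  have hi := integrableOn_Ioi_rpow_of_lt (a := -2) (by norm_num) ha
  calc _ ≤ ∫ x in Set.Ioi a, x ^ (-2:ℝ) := by
        refine setIntegral_mono_on integrable_fejer.integrableOn hi measurableSet_Ioi fun x hx => ?_
        have hx0 : 0 < x := ha.trans hx
        refine (fejer_le hx0.ne').trans (le_of_eq ?_)
        rw [Real.rpow_neg hx0.le, Real.rpow_two, one_div]
    _ = 1 / a := by
        rw [h]
        norm_num
        rw [Real.rpow_neg_one]

lemma fejerG_neg_le {a : ℝ} (ha : 0 < a) : fejerG (-a) ≤ 1 / a := by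
  have h := integral_comp_neg_Ioi a fejer
  rw [fejerG, ← h]
  refine le_trans (le_of_eq ?_) (integral_Ioi_fejer_le ha)
  congr 1
  ext x
  simp [fejer, sinc_neg]

lemma le_fejerG {a : ℝ} (ha : 0 < a) : 1 - 1 / a ≤ fejerG a := by
  linarith [fejerG_add a, integral_Ioi_fejer_le ha]

lemma integral_fejer_shift {T : ℝ} (hT : 0 < T) (u V1 V2 : ℝ) :
    ∫ v in V1..V2, T * fejer (T * (u - v)) = fejerG (T * (u - V1)) - fejerG (T * (u - V2)) := by
  have h := intervalIntegral.integral_comp_sub_left (a := V1) (b := V2) (fun w => fejer (T * w)) u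
  rw [intervalIntegral.integral_const_mul, h, intervalIntegral.integral_comp_mul_left _ hT.ne',
    smul_eq_mul, ← mul_assoc, mul_inv_cancel₀ hT.ne', one_mul, fejerG, fejerG,
    intervalIntegral.integral_Iic_sub_Iic integrable_fejer.integrableOn integrable_fejer.integrableOn]

lemma abs_indicator_sub_fejerG_le {T V1 V2 d u : ℝ} (hT : 0 < T) (hd : 0 < d) (hV : V1 ≤ V2)
    (h1 : d ≤ |u - V1|) (h2 : d ≤ |u - V2|) :
    |(if V1 < u ∧ u ≤ V2 then 1 else 0) - (fejerG (T * (u - V1)) - fejerG (T * (u - V2)))| ≤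
      2 / (T * d) := by
  have hTd : 0 < T * d := by positivity
  have e : 2 / (T * d) = 1 / (T * d) + 1 / (T * d) := by ring
  have hp : 0 < 1 / (T * d) := by positivity
  have hm : fejerG (T * (u - V2)) ≤ fejerG (T * (u - V1)) :=
    fejerG_mono (by gcongr)
  have up : ∀ w, d ≤ w → 1 - 1 / (T * d) ≤ fejerG (T * w) := fun w hw =>
    (le_fejerG hTd).trans (fejerG_mono (by gcongr))
  have dn : ∀ w, w ≤ -d → fejerG (T * w) ≤ 1 / (T * d) := fun w hw =>
    (fejerG_mono (by nlinarith)).trans (fejerG_neg_le hTd)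
  have a1 := fejerG_le_one (T * (u - V1))
  have a2 := fejerG_nonneg (T * (u - V2))
  rcases le_abs.mp h1 with h1 | h1 <;> rcases le_abs.mp h2 with h2 | h2
  · rw [if_neg (fun h => by linarith [h.2])]
    have := up _ h2
    rw [abs_le]; constructor <;> linarith
  · rw [if_pos ⟨by linarith, by linarith⟩]
    have := up _ h1
    have := dn _ (show u - V2 ≤ -d by linarith)
    rw [abs_le]; constructor <;> linarith
  · exfalso; linarith
  · rw [if_neg (fun h => by linarith [h.1])]
    have := dn _ (show u - V1 ≤ -d by linarith)
    rw [abs_le]; constructor <;> linarith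

lemma abs_indicator_sub_fejerG_le_one {T V1 V2 u : ℝ} (hT : 0 < T) (hV : V1 ≤ V2) :
    |(if V1 < u ∧ u ≤ V2 then 1 else 0) - (fejerG (T * (u - V1)) - fejerG (T * (u - V2)))| ≤ 1 := by
  have hm : fejerG (T * (u - V2)) ≤ fejerG (T * (u - V1)) :=
    fejerG_mono (by gcongr)
  have a1 := fejerG_le_one (T * (u - V1))
  have a2 := fejerG_nonneg (T * (u - V2))
  split_ifs <;> rw [abs_le] <;> constructor <;> linarith

lemma fejerG_sum_le {c lam : ℕ → ℝ} (hc : Summable fun n => |c n|) {T V1 V2 J : ℝ} (hT : 0 < T)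
    (hV : V1 ≤ V2) (hJ : ∫ t in (-(2 * π * T))..(2 * π * T),
        ‖∑' n, (c n : ℂ) * Complex.exp (-(lam n * t : ℝ) * Complex.I)‖ ≤ J) :
    |∑' n, c n * (fejerG (T * (lam n - V1)) - fejerG (T * (lam n - V2)))| ≤ (V2 - V1) * J := by
  have hcont : ∀ n, Continuous fun v => c n * (T * fejer (T * (lam n - v))) := fun n =>
    continuous_const.mul (continuous_const.mul (continuous_fejer.comp (by fun_prop)))
  have hintg : ∀ n, IntegrableOn (fun v => c n * (T * fejer (T * (lam n - v)))) (Set.Ioc V1 V2) :=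
    fun n => ((hcont n).intervalIntegrable V1 V2).1
  have hval : ∀ n, ∫ v in Set.Ioc V1 V2, T * fejer (T * (lam n - v)) =
      fejerG (T * (lam n - V1)) - fejerG (T * (lam n - V2)) := by
    intro n
    rw [← integral_fejer_shift hT, intervalIntegral.integral_of_le hV]
  have hsum := hasSum_integral_of_summable_integral_norm hintg (by
    refine Summable.of_nonneg_of_le (fun n => integral_nonneg fun v => norm_nonneg _)
      (fun n => ?_) hc
    have : ∀ v, ‖c n * (T * fejer (T * (lam n - v)))‖ = |c n| * (T * fejer (T * (lam n - v))) := by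
      intro v
      rw [norm_mul, Real.norm_eq_abs,
        Real.norm_of_nonneg (mul_nonneg hT.le (fejer_nonneg _))]
    simp only [this]
    rw [integral_const_mul, hval]
    have := fejerG_le_one (T * (lam n - V1))
    have := fejerG_nonneg (T * (lam n - V2))
    have := abs_nonneg (c n)
    nlinarith)
  simp only [integral_const_mul, hval] at hsum
  rw [hsum.tsum_eq, ← intervalIntegral.integral_of_le hV, ← Real.norm_eq_abs, mul_comm]
  refine (intervalIntegral.norm_integral_le_of_norm_le_const (C := J) fun v _ => ?_).trans
    (le_of_eq ?_)
  · exact (fejer_sum_le hc hT v).trans hJ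
  · rw [abs_of_nonneg (by linarith)]

end Hoh

namespace Hoh
open Finset Real MeasureTheory
open ArithmeticFunction (vonMangoldt vonMangoldt_nonneg vonMangoldt_le_log)

/-- The coefficients of the Dirichlet series `Z(1 - L)` on the line `re s = 1 + β`. -/
noncomputable def hc (z : ℕ) (β : ℝ) (n : ℕ) : ℝ :=
  rI z n * (vonMangoldt n + ArithmeticFunction.moebius n * log n) / (n:ℝ) ^ (1 + β)

lemma abs_moebius_le (n : ℕ) : |(ArithmeticFunction.moebius n : ℝ)| ≤ 1 := by
  exact_mod_cast ArithmeticFunction.abs_moebius_le_one (n := n)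

lemma abs_hc_le (z : ℕ) (β : ℝ) (n : ℕ) : |hc z β n| ≤ 2 * (log n / (n:ℝ) ^ (1 + β)) := by
  have h0 : 0 ≤ log (n:ℝ) := Real.log_natCast_nonneg n
  have h1 : |vonMangoldt n + ArithmeticFunction.moebius n * log n| ≤ 2 * log n := by
    refine (abs_add_le _ _).trans ?_
    rw [abs_mul, abs_of_nonneg (vonMangoldt_nonneg (n := n)), abs_of_nonneg h0]
    have := vonMangoldt_le_log (n := n)
    have := abs_moebius_le n
    nlinarith
  have hp : 0 ≤ (n:ℝ) ^ (1 + β) := by positivity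
  rw [hc, abs_div, abs_mul, abs_of_nonneg (rI_nonneg z n), abs_of_nonneg hp, ← mul_div_assoc]
  refine div_le_div_of_nonneg_right ?_ hp
  calc _ ≤ 1 * (2 * log (n:ℝ)) := mul_le_mul (rI_le_one z n) h1 (abs_nonneg _) zero_le_one
    _ = _ := one_mul _

lemma log_div_rpow_summable {β : ℝ} (hβ : 0 < β) (hβ1 : β ≤ 1) :
    Summable (fun n : ℕ => log n / (n:ℝ) ^ (1 + β)) ∧
      ∑' n : ℕ, log n / (n:ℝ) ^ (1 + β) ≤ 6 / β ^ 2 := by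
  have hb2 : 0 < β / 2 := by positivity
  have hle : ∀ n : ℕ, log n / (n:ℝ) ^ (1 + β) ≤ 2 / β * (1 / (n:ℝ) ^ (1 + β / 2)) := by
    intro n
    rcases Nat.eq_zero_or_pos n with rfl | hn
    · simp; positivity
    have hn0 : (0:ℝ) < n := by exact_mod_cast hn
    have h1 : log n ≤ (n:ℝ) ^ (β / 2) / (β / 2) := Real.log_le_rpow_div hn0.le hb2
    have h2 : (n:ℝ) ^ (1 + β) = (n:ℝ) ^ (1 + β / 2) * (n:ℝ) ^ (β / 2) := by
      rw [← Real.rpow_add hn0]; congr 1; ring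
    rw [h2, div_le_iff₀ (by positivity)]
    refine h1.trans (le_of_eq ?_)
    field_simp
  have hs : Summable fun n : ℕ => 1 / (n:ℝ) ^ (1 + β / 2) :=
    Real.summable_one_div_nat_rpow.mpr (by linarith)
  have hnn : ∀ n : ℕ, 0 ≤ log n / (n:ℝ) ^ (1 + β) := fun n =>
    div_nonneg (Real.log_natCast_nonneg n) (by positivity)
  have hsum := Summable.of_nonneg_of_le hnn hle (hs.mul_left _)
  refine ⟨hsum, (hsum.tsum_le_tsum hle (hs.mul_left _)).trans ?_⟩
  rw [tsum_mul_left]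
  have hz : ∑' n : ℕ, 1 / (n:ℝ) ^ (1 + β / 2) ≤ 1 + 1 / (1 + β / 2 - 1) := by
    rw [hs.tsum_eq_zero_add]
    have h0 : 1 / ((0:ℕ):ℝ) ^ (1 + β / 2) = 0 := by
      rw [Nat.cast_zero, Real.zero_rpow (by positivity), div_zero]
    rw [h0, zero_add]
    push_cast
    exact zeta_le (by linarith)
  calc _ ≤ 2 / β * (3 / β) := by
        gcongr
        refine hz.trans ?_
        rw [show 1 + β / 2 - 1 = β / 2 by ring]
        have h1 : 1 ≤ 1 / β := by rw [le_div_iff₀ hβ]; linarith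
        have h2 : 1 / (β / 2) = 2 * (1 / β) := by field_simp
        have h3 : 3 / β = 3 * (1 / β) := by ring
        rw [h2, h3]
        linarith
    _ = _ := by field_simp; norm_num

lemma hc_summable (z : ℕ) {β : ℝ} (hβ : 0 < β) (hβ1 : β ≤ 1) : Summable fun n => |hc z β n| :=
  Summable.of_nonneg_of_le (fun _ => abs_nonneg _) (abs_hc_le z β)
    ((log_div_rpow_summable hβ hβ1).1.mul_left 2)

lemma hc_tsum (z : ℕ) {β : ℝ} (hβ : 0 < β) (t : ℝ) :
    ∑' n, (hc z β n : ℂ) * Complex.exp (-(log n * t : ℝ) * Complex.I) =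
      Zs z (1 + β + t * Complex.I) * (1 - Ls z (1 + β + t * Complex.I)) := by
  set s : ℂ := 1 + β + t * Complex.I with hs
  have hre : 1 < s.re := by simp [hs, hβ]
  set f : ℕ → ℂ := (fun n : ℕ => chi z n) * fun n : ℕ => (ArithmeticFunction.moebius n : ℂ) with hf
  set g : ℕ → ℂ := (fun n : ℕ => chi z n) * fun n : ℕ => (vonMangoldt n : ℂ) with hg
  have hfs : ∀ s : ℂ, 1 < s.re → LSeriesSummable f s := by
    intro s hs
    refine LSeriesSummable_of_bounded_of_one_lt_re (m := 1) (fun n _ => ?_) hs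
    simp only [hf, Pi.mul_apply]
    rw [norm_mul, norm_chi]
    exact mul_le_one₀ (rI_le_one _ _) (norm_nonneg _) (norm_moebius_le n)
  have hab := abscissa_lt_of_summable hfs hre
  have hd := LSeries_hasDerivAt hab
  have hd2 : HasDerivAt (LSeries f) (Zs z s * Ls z s) s := hasDerivAt_Ls z hre
  have e1 : Zs z s * Ls z s = -LSeries (LSeries.logMul f) s := hd2.unique hd
  have hs1 : LSeriesSummable (LSeries.logMul f) s := LSeriesSummable_logMul_of_lt_re hab
  have hs2 : LSeriesSummable g s := DirichletCharacter.LSeriesSummable_twist_vonMangoldt (chi z) hre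
  rw [mul_sub, mul_one, e1, sub_neg_eq_add]
  have : Zs z s + LSeries (LSeries.logMul f) s = LSeries (g + LSeries.logMul f) s :=
    (LSeries_add hs2 hs1).symm
  rw [this, LSeries]
  congr 1
  ext n
  rcases eq_or_ne n 0 with rfl | hn
  · simp [hc]
  · rw [LSeries.term_of_ne_zero hn, hs, natCast_cpow_line hn]
    have h1 : Complex.exp (-(log n * t : ℝ) * Complex.I) =
        (Complex.exp ((log n * t : ℝ) * Complex.I))⁻¹ := by
      rw [← Complex.exp_neg]; congr 1; ring
    rw [h1, hc]
    simp only [Pi.add_apply, hg, hf, LSeries.logMul, Pi.mul_apply, chi_apply]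
    rw [← Complex.natCast_log]
    push_cast
    field_simp

lemma near_mem {X d : ℝ} (hX : 1 ≤ X) (hd0 : 0 < d) (hd : d ≤ 1) {n : ℕ} (hn : 1 ≤ n)
    (h : |log n - log X| < d) :
    n ∈ Ioc ⌊X * (1 - d)⌋₊ ⌊X * (1 - d) + 3 * d * X⌋₊ ∧ log n ≤ log X + 1 ∧ X / 3 ≤ n := by
  have hX0 : 0 < X := by linarith
  have hn0 : (0:ℝ) < n := by exact_mod_cast hn
  obtain ⟨h1, h2⟩ := abs_lt.mp h
  have e1 : (n:ℝ) = X * exp (log n - log X) := by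
    rw [Real.exp_sub, Real.exp_log hn0, Real.exp_log hX0]; field_simp
  have l1 : X * (1 - d) < n := by
    rw [e1]
    have h3 : exp (-d) < exp (log n - log X) := Real.exp_lt_exp.mpr h1
    have := Real.add_one_le_exp (-d)
    gcongr
    linarith
  have l2 : (n:ℝ) ≤ X * (1 - d) + 3 * d * X := by
    have h3 : exp (log n - log X) ≤ exp d := Real.exp_le_exp.mpr h2.le
    have h4 : exp d ≤ 1 + 2 * d := by
      have h5 := Real.abs_exp_sub_one_le (x := d) (by rw [abs_of_pos hd0]; exact hd)
      rw [abs_of_pos hd0] at h5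
      linarith [le_abs_self (exp d - 1)]
    have h6 : X * exp (log n - log X) ≤ X * (1 + 2 * d) := by gcongr; linarith
    rw [← e1] at h6
    linarith
  refine ⟨?_, by linarith, ?_⟩
  · rw [mem_Ioc]
    refine ⟨?_, Nat.le_floor l2⟩
    rw [Nat.floor_lt (by nlinarith)]
    exact l1
  · have h3 : exp (-1) ≤ exp (log n - log X) := Real.exp_le_exp.mpr (by linarith)
    have h4 : 1 / 3 ≤ exp (-1:ℝ) := by
      rw [Real.exp_neg, one_div]
      exact inv_anti₀ (Real.exp_pos 1) (by linarith [Real.exp_one_lt_d9])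
    rw [e1, div_eq_mul_one_div]
    gcongr
    linarith

set_option maxHeartbeats 1000000 in
lemma hc_interval_le (z : ℕ) {X Y T J d : ℝ} (hX : exp 1 ≤ X) (hY0 : 0 < Y) (hYX : Y ≤ X)
    (hT : 0 < T) (hd0 : 0 < d) (hd : d ≤ 1)
    (hJ : ∫ t in (-(2 * π * T))..(2 * π * T), ‖Zs z (1 + (1 / log X : ℝ) + t * Complex.I) *
      (1 - Ls z (1 + (1 / log X : ℝ) + t * Complex.I))‖ ≤ J) :
    |∑ n ∈ Ioc ⌊X⌋₊ ⌊X + Y⌋₊, hc z (1 / log X) n| ≤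
      Y / X * J + 24 * log X ^ 2 / (T * d) + 6 * (log X + 2) / X * (9 * d * X + 2) := by
  have hX0 : 0 < X := (exp_pos 1).trans_le hX
  have hl1 : 1 ≤ log X := by rw [Real.le_log_iff_exp_le hX0]; exact hX
  have hX1 : 1 ≤ X := (Real.one_le_exp (by norm_num)).trans hX
  set β := 1 / log X with hβd
  have hβ : 0 < β := by positivity
  have hβ1 : β ≤ 1 := by rw [hβd, div_le_one (by linarith)]; exact hl1
  set V1 := log X with hV1
  set V2 := log (X + Y) with hV2
  have hV : V1 ≤ V2 := Real.log_le_log hX0 (by linarith)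
  have hV21 : V2 - V1 ≤ Y / X := by
    rw [hV1, hV2, ← Real.log_div (by positivity) (by positivity)]
    refine (Real.log_le_sub_one_of_pos (by positivity)).trans (le_of_eq ?_)
    field_simp; ring
  have hJ0 : 0 ≤ J := by
    refine le_trans ?_ hJ
    have := pi_pos
    exact intervalIntegral.integral_nonneg (by nlinarith) fun t _ => norm_nonneg _
  have hsm := hc_summable z hβ hβ1
  set Φ : ℕ → ℝ := fun n => fejerG (T * (log n - V1)) - fejerG (T * (log n - V2)) with hΦ
  set I : ℕ → ℝ := fun n => if V1 < log n ∧ log n ≤ V2 then 1 else 0 with hI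
  have hmain : |∑' n, hc z β n * Φ n| ≤ Y / X * J := by
    refine (fejerG_sum_le (lam := fun n => log n) hsm hT hV ?_).trans (by gcongr)
    refine le_trans (le_of_eq ?_) hJ
    congr 1
    ext t
    rw [hc_tsum z hβ t]
  have hIΦ : ∀ n, |I n - Φ n| ≤ 1 := fun n => abs_indicator_sub_fejerG_le_one hT hV
  have hI1 : ∀ n, |I n| ≤ 1 := fun n => by simp only [hI]; split_ifs <;> simp
  have hsI : Summable fun n => hc z β n * I n := by
    refine Summable.of_norm_bounded hsm fun n => ?_
    rw [norm_mul, Real.norm_eq_abs, Real.norm_eq_abs]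
    exact mul_le_of_le_one_right (abs_nonneg _) (hI1 n)
  have hsD : Summable fun n => |hc z β n * (I n - Φ n)| := by
    refine Summable.of_nonneg_of_le (fun n => abs_nonneg _) (fun n => ?_) hsm
    rw [abs_mul]
    exact mul_le_of_le_one_right (abs_nonneg _) (hIΦ n)
  have hsum : ∑ n ∈ Ioc ⌊X⌋₊ ⌊X + Y⌋₊, hc z β n = ∑' n, hc z β n * I n := by
    rw [tsum_eq_sum (s := Ioc ⌊X⌋₊ ⌊X + Y⌋₊)]
    · refine Finset.sum_congr rfl fun n hn => ?_
      rw [mem_Ioc, Nat.floor_lt hX0.le, Nat.le_floor_iff (by positivity)] at hn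
      simp only [hI]
      rw [if_pos ⟨Real.log_lt_log hX0 hn.1, Real.log_le_log (by linarith) hn.2⟩, mul_one]
    · intro n hn
      rcases Nat.eq_zero_or_pos n with rfl | hn0
      · simp [hc]
      have hn0 : (0:ℝ) < n := by exact_mod_cast hn0
      simp only [hI]
      rw [if_neg, mul_zero]
      rintro ⟨h1, h2⟩
      apply hn
      rw [mem_Ioc, Nat.floor_lt hX0.le, Nat.le_floor_iff (by positivity)]
      exact ⟨(Real.log_lt_log_iff hX0 hn0).mp h1, (Real.log_le_log_iff hn0 (by positivity)).mp h2⟩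
  set S : Finset ℕ := Ioc ⌊X * (1 - d)⌋₊ ⌊X * (1 - d) + 3 * d * X⌋₊ ∪
    Ioc ⌊(X + Y) * (1 - d)⌋₊ ⌊(X + Y) * (1 - d) + 3 * d * (X + Y)⌋₊ with hS
  have hScard : ((S.card : ℕ) : ℝ) ≤ 9 * d * X + 2 := by
    have h1 := card_Ioc_floor_le (X := X * (1 - d)) (Y := 3 * d * X) (by nlinarith) (by positivity)
    have h2 := card_Ioc_floor_le (X := (X + Y) * (1 - d)) (Y := 3 * d * (X + Y)) (by nlinarith)
      (by positivity)
    have h3 : ((S.card : ℕ) : ℝ) ≤ ((Ioc ⌊X * (1 - d)⌋₊ ⌊X * (1 - d) + 3 * d * X⌋₊).card : ℝ) +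
        ((Ioc ⌊(X + Y) * (1 - d)⌋₊ ⌊(X + Y) * (1 - d) + 3 * d * (X + Y)⌋₊).card : ℝ) := by
      exact_mod_cast Finset.card_union_le _ _
    nlinarith
  set κ := 6 * (log X + 2) / X with hκ
  have hκ0 : 0 ≤ κ := by positivity
  have hpt : ∀ n, |hc z β n * (I n - Φ n)| ≤
      4 / (T * d) * (log n / (n:ℝ) ^ (1 + β)) + (if n ∈ S then κ else 0) := by
    intro n
    have hc0 := abs_hc_le z β n
    rcases Nat.eq_zero_or_pos n with rfl | hn1
    · have : 0 ≤ (if 0 ∈ S then κ else 0) := by split_ifs <;> simp [hκ0]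
      simpa [hc] using this
    have hn0 : (0:ℝ) < n := by exact_mod_cast hn1
    have hl0 : 0 ≤ log (n:ℝ) := Real.log_natCast_nonneg n
    rw [abs_mul]
    by_cases hfar : d ≤ |log n - V1| ∧ d ≤ |log n - V2|
    · have h1 := abs_indicator_sub_fejerG_le hT hd0 hV hfar.1 hfar.2
      have : 0 ≤ (if n ∈ S then κ else 0) := by split_ifs <;> simp [hκ0]
      calc _ ≤ 2 * (log n / (n:ℝ) ^ (1 + β)) * (2 / (T * d)) := by gcongr
        _ ≤ _ := by
          have e : 2 * (log n / (n:ℝ) ^ (1 + β)) * (2 / (T * d)) =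
            4 / (T * d) * (log n / (n:ℝ) ^ (1 + β)) := by ring
          linarith
    · have hmem : n ∈ S ∧ log n ≤ log X + 2 ∧ X / 3 ≤ n := by
        rw [not_and_or, not_le, not_le] at hfar
        rcases hfar with h | h
        · obtain ⟨a, b, c⟩ := near_mem hX1 hd0 hd hn1 h
          exact ⟨by rw [hS, mem_union]; exact Or.inl a, by linarith, c⟩
        · obtain ⟨a, b, c⟩ := near_mem (X := X + Y) (by linarith) hd0 hd hn1 h
          have : Y / X ≤ 1 := by rw [div_le_one hX0]; exact hYX
          have : V2 = log (X + Y) := hV2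
          exact ⟨by rw [hS, mem_union]; exact Or.inr a, by linarith, by linarith⟩
      rw [if_pos hmem.1]
      have h1 : log n / (n:ℝ) ^ (1 + β) ≤ (log X + 2) / (X / 3) := by
        have : X / 3 ≤ (n:ℝ) ^ (1 + β) := by
          refine hmem.2.2.trans ?_
          conv_lhs => rw [← Real.rpow_one (n:ℝ)]
          exact Real.rpow_le_rpow_of_exponent_le (by exact_mod_cast hn1) (by linarith)
        have := hmem.2.1
        gcongr
      have h2 : 0 ≤ 4 / (T * d) * (log n / (n:ℝ) ^ (1 + β)) := by positivity
      have h3 := hIΦ n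
      have h4 : |hc z β n| * |I n - Φ n| ≤ |hc z β n| := mul_le_of_le_one_right (abs_nonneg _) h3
      have h5 : κ = 2 * ((log X + 2) / (X / 3)) := by rw [hκ]; field_simp; ring
      linarith
  obtain ⟨hlS, hlT⟩ := log_div_rpow_summable hβ hβ1
  have hsS : HasSum (fun n => if n ∈ S then κ else 0) (∑ n ∈ S, κ) := by
    have : HasSum (fun n => if n ∈ S then κ else 0) (∑ n ∈ S, if n ∈ S then κ else 0) :=
      hasSum_sum_of_ne_finset_zero fun n hn => if_neg hn
    rwa [Finset.sum_congr rfl fun n hn => if_pos hn] at this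
  have herr : |∑' n, hc z β n * (I n - Φ n)| ≤ 24 * log X ^ 2 / (T * d) +
      κ * (9 * d * X + 2) := by
    calc _ ≤ ∑' n, |hc z β n * (I n - Φ n)| := by
          have := norm_tsum_le_tsum_norm (f := fun n => hc z β n * (I n - Φ n)) hsD
          exact this
      _ ≤ ∑' n : ℕ, (4 / (T * d) * (log n / (n:ℝ) ^ (1 + β)) + (if n ∈ S then κ else 0)) :=
          hsD.tsum_le_tsum hpt ((hlS.mul_left _).add hsS.summable)
      _ = 4 / (T * d) * (∑' n : ℕ, log n / (n:ℝ) ^ (1 + β)) + ∑ n ∈ S, κ := by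
          rw [(hlS.mul_left _).tsum_add hsS.summable, tsum_mul_left, hsS.tsum_eq]
      _ ≤ 4 / (T * d) * (6 / β ^ 2) + (9 * d * X + 2) * κ := by
          rw [Finset.sum_const, nsmul_eq_mul]
          gcongr
      _ = _ := by rw [hβd]; field_simp; ring
  have hsplit : ∑' n, hc z β n * I n = ∑' n, hc z β n * Φ n + ∑' n, hc z β n * (I n - Φ n) := by
    rw [← Summable.tsum_add]
    · congr 1; ext n; ring
    · have := hsI.sub hsD.of_abs
      refine this.congr fun n => ?_
      ring
    · exact hsD.of_abs
  rw [hsum, hsplit]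
  refine (abs_add_le _ _).trans ?_
  linarith

end Hoh

namespace Hoh
open Finset Real MeasureTheory
open ArithmeticFunction (vonMangoldt vonMangoldt_nonneg vonMangoldt_le_log)

lemma log_div_rpow_sub_le {X n h β : ℝ} (hX : 1 ≤ X) (hn : X < n) (hh : n ≤ X * (1 + h))
    (hh1 : h ≤ 1) (hβ : 0 < β) (hβ1 : β ≤ 1) :
    |log n / n ^ (1 + β) - log X / X ^ (1 + β)| ≤ (1 + 2 * log X) * h / X := by
  have hX0 : 0 < X := by linarith
  have hn0 : 0 < n := by linarith
  have hl0 : 0 ≤ log X := Real.log_nonneg hX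
  have hh0 : 0 < h := by nlinarith
  have h1 : log n - log X ≤ h := by
    rw [← Real.log_div hn0.ne' hX0.ne']
    refine (Real.log_le_sub_one_of_pos (by positivity)).trans ?_
    rw [sub_le_iff_le_add, div_le_iff₀ hX0]; linarith
  have h1' : 0 ≤ log n - log X := by linarith [Real.log_le_log hX0 hn.le]
  have hXp : X ≤ X ^ (1 + β) := by
    conv_lhs => rw [← Real.rpow_one X]
    exact Real.rpow_le_rpow_of_exponent_le hX (by linarith)
  have hXp0 : 0 < X ^ (1 + β) := by positivity
  have hnp0 : 0 < n ^ (1 + β) := by positivity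
  have hnp : X ^ (1 + β) ≤ n ^ (1 + β) := Real.rpow_le_rpow hX0.le hn.le (by linarith)
  have h2 : 1 - 2 * h ≤ X ^ (1 + β) / n ^ (1 + β) := by
    rw [← Real.div_rpow hX0.le hn0.le]
    have hq0 : 0 < X / n := by positivity
    have hq1 : X / n ≤ 1 := by rw [div_le_one hn0]; exact hn.le
    have hq : 1 - h ≤ X / n := by
      rw [le_div_iff₀ hn0]
      nlinarith
    calc 1 - 2 * h ≤ (X / n) ^ 2 := by nlinarith
      _ = (X / n) ^ (2:ℝ) := by norm_cast
      _ ≤ _ := Real.rpow_le_rpow_of_exponent_ge hq0 hq1 (by linarith)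
  have e : log n / n ^ (1 + β) - log X / X ^ (1 + β) =
      (log n - log X) / n ^ (1 + β) - log X * (1 - X ^ (1 + β) / n ^ (1 + β)) / X ^ (1 + β) := by
    field_simp
    ring
  have h3 : X ^ (1 + β) / n ^ (1 + β) ≤ 1 := by rw [div_le_one hnp0]; exact hnp
  have a1 : (log n - log X) / n ^ (1 + β) ≤ h / X := by
    have := hXp.trans hnp
    gcongr
  have a1' : 0 ≤ (log n - log X) / n ^ (1 + β) := by positivity
  have a2 : log X * (1 - X ^ (1 + β) / n ^ (1 + β)) / X ^ (1 + β) ≤ log X * (2 * h) / X := by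
    gcongr
    linarith
  have a2' : 0 ≤ log X * (1 - X ^ (1 + β) / n ^ (1 + β)) / X ^ (1 + β) := by
    have : 0 ≤ 1 - X ^ (1 + β) / n ^ (1 + β) := by linarith
    positivity
  have a3 : (1 + 2 * log X) * h / X = h / X + log X * (2 * h) / X := by ring
  rw [e, a3, abs_le]
  constructor <;> linarith

set_option maxHeartbeats 1000000 in
lemma moebius_short : ∃ C : ℝ, 1 ≤ C ∧ ∀ z : ℕ, 2 ≤ z → ∀ X Y M : ℝ, exp 2 ≤ X → √X ≤ Y →
    Y * log X ≤ X → 0 ≤ M → 7 * (X / Y) ^ 2 * log X ^ 3 ≤ (z:ℝ) ^ (1/4:ℝ) →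
    (∀ t : ℝ, |t| ≤ (z:ℝ) ^ (1/4:ℝ) → ∀ τ : ℝ, 1 / log X ≤ τ →
      ‖Ls z (1 + τ + t * Complex.I)‖ ≤ M) →
    |∑ n ∈ Ioc ⌊X⌋₊ ⌊X + Y⌋₊, rI z n * ArithmeticFunction.moebius n| ≤
      C * (Y / log X) * (1 + M * √(log X / log z)) := by
  obtain ⟨C0, hC0, hHal⟩ := halasz_integral
  obtain ⟨C1, hC1, hBT⟩ := brun_titchmarsh
  refine ⟨3 * ((186 + C1) * C0), by have := one_le_mul_of_one_le_of_one_le (show 1 ≤ 186 + C1 by linarith) hC0; linarith, fun z hz X Y M hX hXY hYX hM hz4 hL => ?_⟩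
  have hX0 : 0 < X := (exp_pos 2).trans_le hX
  have hXe : exp 1 ≤ X := (Real.exp_le_exp.mpr (by norm_num)).trans hX
  have hX1 : 1 ≤ X := (Real.one_le_exp (by norm_num)).trans hXe
  have hl : 2 ≤ log X := by rw [Real.le_log_iff_exp_le hX0]; exact hX
  set ℓ := log X with hℓ
  have hsq1 : 1 ≤ √X := by rw [Real.le_sqrt' one_pos]; linarith
  have hY1 : 1 ≤ Y := hsq1.trans hXY
  have hY0 : 0 < Y := by linarith
  have hYX2 : 2 * Y ≤ X := by nlinarith
  have hlY : ℓ ≤ 2 * Y := by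
    have h1 : log (√X) ≤ √X - 1 := Real.log_le_sub_one_of_pos (by linarith)
    rw [Real.log_sqrt hX0.le] at h1
    linarith
  have hXYl : ℓ ≤ X / Y := by rw [le_div_iff₀ hY0]; linarith
  have hpi := pi_pos
  set U := (z:ℝ) ^ (1/4:ℝ) with hU
  set T := U / (2 * π) with hT
  have hU16 : 16 ≤ U := by
    refine le_trans ?_ hz4
    have h1 : 2 ^ 2 ≤ (X / Y) ^ 2 := by gcongr; linarith
    have h2 : (2:ℝ) ^ 3 ≤ ℓ ^ 3 := by gcongr
    nlinarith
  have hUT : 2 * π * T = U := by rw [hT]; field_simp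
  have hT0 : 0 < T := by rw [hT]; positivity
  have hTbig : (X / Y) ^ 2 * ℓ ^ 3 ≤ T := by
    rw [hT, le_div_iff₀ (by positivity)]
    have h1 : 0 ≤ (X / Y) ^ 2 * ℓ ^ 3 := by positivity
    have := pi_lt_d2
    nlinarith
  set d := Y / (X * ℓ) with hd
  have hd0 : 0 < d := by positivity
  have hd1 : d ≤ 1 := by
    rw [hd, div_le_one (by positivity)]; nlinarith
  have hβ : 0 < 1 / ℓ := by positivity
  have hβ1 : 1 / ℓ ≤ 1 := by rw [div_le_one (by linarith)]; linarith
  set q := √(ℓ / log z) with hq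
  have hq0 : 0 ≤ q := Real.sqrt_nonneg _
  have hJ : ∫ t in (-(2 * π * T))..(2 * π * T), ‖Zs z (1 + (1 / ℓ : ℝ) + t * Complex.I) *
      (1 - Ls z (1 + (1 / ℓ : ℝ) + t * Complex.I))‖ ≤ C0 * M * q := by
    simp only [norm_mul]
    rw [hUT]
    refine (hHal z hz U hU16 le_rfl M (1 / ℓ) hM hβ hβ1 hL).trans (le_of_eq ?_)
    rw [hq, Real.sqrt_div (show 0 ≤ ℓ by linarith) (log z), Real.sqrt_div zero_le_one ℓ, Real.sqrt_one]
    field_simp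
  have hmain := hc_interval_le z hXe hY0 (by linarith) hT0 hd0 hd1 hJ
  have b1 : 24 * ℓ ^ 2 / (T * d) ≤ 24 * (Y / X) := by
    rw [hd, div_le_iff₀ (by positivity)]
    have : ℓ ^ 2 ≤ T * Y ^ 2 / (X ^ 2 * ℓ) := by
      rw [le_div_iff₀ (by positivity)]
      have h2 : (X / Y) ^ 2 * ℓ ^ 3 * Y ^ 2 ≤ T * Y ^ 2 := by gcongr
      have h3 : (X / Y) ^ 2 * ℓ ^ 3 * Y ^ 2 = ℓ ^ 2 * (X ^ 2 * ℓ) := by field_simp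
      linarith
    calc 24 * ℓ ^ 2 ≤ 24 * (T * Y ^ 2 / (X ^ 2 * ℓ)) := by gcongr
      _ = _ := by field_simp
  have b2 : 6 * (ℓ + 2) / X * (9 * d * X + 2) ≤ 156 * (Y / X) := by
    have h1 : 9 * d * X + 2 ≤ 13 * (Y / ℓ) := by
      have : 2 ≤ 4 * (Y / ℓ) := by rw [← mul_div_assoc, le_div_iff₀ (by linarith)]; linarith
      have e : 9 * d * X = 9 * (Y / ℓ) := by rw [hd]; field_simp
      linarith
    calc _ ≤ 6 * (ℓ + ℓ) / X * (13 * (Y / ℓ)) := by gcongr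
      _ = _ := by field_simp; norm_num
  set I := Ioc ⌊X⌋₊ ⌊X + Y⌋₊ with hI
  have hmem : ∀ n ∈ I, X < n ∧ (n:ℝ) ≤ X + Y := by
    intro n hn
    rwa [hI, mem_Ioc, Nat.floor_lt hX0.le, Nat.le_floor_iff (by positivity)] at hn
  set S := ∑ n ∈ I, rI z n * ArithmeticFunction.moebius n with hS
  have hXp : X ^ (1 + 1 / ℓ) = X * exp 1 := by
    rw [Real.rpow_add hX0, Real.rpow_one, Real.rpow_def_of_pos hX0, ← hℓ]
    congr 2
    field_simp
  have hdec : ℓ / (X * exp 1) * S = ∑ n ∈ I, hc z (1 / ℓ) n -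
      ∑ n ∈ I, rI z n * vonMangoldt n / (n:ℝ) ^ (1 + 1 / ℓ) -
      ∑ n ∈ I, rI z n * ArithmeticFunction.moebius n *
        (log n / (n:ℝ) ^ (1 + 1 / ℓ) - ℓ / X ^ (1 + 1 / ℓ)) := by
    rw [hS, mul_sum, ← sum_sub_distrib, ← sum_sub_distrib]
    refine sum_congr rfl fun n hn => ?_
    rw [hc, hXp]
    ring
  have c1 : |∑ n ∈ I, rI z n * vonMangoldt n / (n:ℝ) ^ (1 + 1 / ℓ)| ≤ C1 * (Y / X) := by
    rw [abs_of_nonneg (sum_nonneg fun n _ => div_nonneg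
      (mul_nonneg (rI_nonneg _ _) vonMangoldt_nonneg) (by positivity))]
    calc _ ≤ ∑ n ∈ I, vonMangoldt n / X := by
          refine sum_le_sum fun n hn => ?_
          have h1 := (hmem n hn).1
          have h2 : X ≤ (n:ℝ) ^ (1 + 1 / ℓ) := by
            refine h1.le.trans ?_
            conv_lhs => rw [← Real.rpow_one (n:ℝ)]
            exact Real.rpow_le_rpow_of_exponent_le (by linarith) (by linarith)
          have h3 := vonMangoldt_nonneg (n := n)
          have h4 : rI z n * vonMangoldt n ≤ vonMangoldt n :=
            mul_le_of_le_one_left h3 (rI_le_one _ _)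
          gcongr
      _ = (∑ n ∈ I, vonMangoldt n) / X := by rw [sum_div]
      _ ≤ C1 * Y / X := by
          gcongr
          exact hBT X Y hX1 hXY (by linarith)
      _ = _ := by ring
  have c2 : |∑ n ∈ I, rI z n * ArithmeticFunction.moebius n *
        (log n / (n:ℝ) ^ (1 + 1 / ℓ) - ℓ / X ^ (1 + 1 / ℓ))| ≤ 6 * (Y / X) := by
    have hcard : (I.card : ℝ) ≤ 2 * Y := by
      have := card_Ioc_floor_le hX0.le hY0.le
      linarith
    calc _ ≤ ∑ n ∈ I, 3 * ℓ * (Y / X) / X := by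
          refine (abs_sum_le_sum_abs _ _).trans (sum_le_sum fun n hn => ?_)
          obtain ⟨h1, h2⟩ := hmem n hn
          have h3 := log_div_rpow_sub_le (h := Y / X) hX1 h1
            (by rw [mul_add, mul_one, mul_div_cancel₀ _ hX0.ne']; exact h2)
            (by rw [div_le_one hX0]; linarith) hβ hβ1
          rw [abs_mul, abs_mul, abs_of_nonneg (rI_nonneg _ _)]
          have h4 : rI z n * |(ArithmeticFunction.moebius n : ℝ)| ≤ 1 :=
            mul_le_one₀ (rI_le_one _ _) (abs_nonneg _) (abs_moebius_le n)
          refine (mul_le_of_le_one_left (abs_nonneg _) h4).trans (h3.trans ?_)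
          gcongr
          linarith
      _ = I.card * (3 * ℓ * (Y / X) / X) := by rw [sum_const, nsmul_eq_mul]
      _ ≤ 2 * Y * (3 * ℓ * (Y / X) / X) := by gcongr
      _ = 6 * (Y / X) * (Y * ℓ / X) := by ring
      _ ≤ 6 * (Y / X) * 1 := by
          gcongr
          rw [div_le_one hX0]; exact hYX
      _ = _ := mul_one _
  have hfin : ℓ / (X * exp 1) * |S| ≤ Y / X * (C0 * M * q + 186 + C1) := by
    have h0 : ℓ / (X * exp 1) * |S| = |ℓ / (X * exp 1) * S| := by
      rw [abs_mul, abs_of_nonneg (show 0 ≤ ℓ / (X * exp 1) by positivity)]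
    rw [h0, hdec]
    refine (abs_sub _ _).trans ?_
    have := abs_sub (∑ n ∈ I, hc z (1 / ℓ) n)
      (∑ n ∈ I, rI z n * vonMangoldt n / (n:ℝ) ^ (1 + 1 / ℓ))
    linarith
  have h5 : |S| = (X * exp 1) / ℓ * (ℓ / (X * exp 1) * |S|) := by
    field_simp
  have h6 : C0 * M * q + 186 + C1 ≤ (186 + C1) * C0 * (1 + M * q) := by
    have : 0 ≤ M * q := by positivity
    linarith [mul_nonneg (mul_nonneg (show 0 ≤ C0 by linarith) this) (show 0 ≤ 185 + C1 by linarith),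
      mul_nonneg (show 0 ≤ C0 - 1 by linarith) (show 0 ≤ 186 + C1 by linarith)]
  rw [h5]
  calc _ ≤ (X * exp 1) / ℓ * (Y / X * (C0 * M * q + 186 + C1)) := by gcongr
    _ = exp 1 * (Y / ℓ) * (C0 * M * q + 186 + C1) := by field_simp
    _ ≤ 3 * (Y / ℓ) * ((186 + C1) * C0 * (1 + M * q)) := by
        have := Real.exp_one_lt_d9
        have : 0 ≤ C0 * M * q := by positivity
        gcongr
        linarith
    _ = _ := by ring

end Hoh

namespace Hoh
open Finset Real MeasureTheory
open ArithmeticFunction (vonMangoldt vonMangoldt_nonneg vonMangoldt_le_log)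

lemma rI_mul_vonMangoldt (z n : ℕ) : rI z n * vonMangoldt n =
    ∑ p ∈ n.divisorsAntidiagonal, (rI z p.1 * log p.1) * (rI z p.2 * ArithmeticFunction.moebius p.2) := by
  have h : vonMangoldt n = ∑ p ∈ n.divisorsAntidiagonal,
      log p.1 * (ArithmeticFunction.moebius p.2 : ℝ) := by
    rw [← ArithmeticFunction.log_mul_moebius_eq_vonMangoldt, ArithmeticFunction.mul_apply]
    rfl
  rw [h, mul_sum]
  refine sum_congr rfl fun p hp => ?_
  rw [← (Nat.mem_divisorsAntidiagonal.mp hp).1, rI_mul]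
  ring

/-- The remainder region in the hyperbola decomposition. -/
def hypRest (N1 N2 A B : ℕ) : Finset (ℕ × ℕ) :=
  (Ioc 0 N2 ×ˢ Ioc 0 N2).filter fun p => (N1 < p.1 * p.2 ∧ p.1 * p.2 ≤ N2) ∧ A < p.1 ∧ B < p.2

lemma sum_hyperbola (f g : ℕ → ℝ) {N1 N2 A B : ℕ} (hAB : A * B ≤ N1) :
    ∑ n ∈ Ioc N1 N2, ∑ p ∈ n.divisorsAntidiagonal, f p.1 * g p.2 =
      ∑ a ∈ Ioc 0 A, f a * ∑ b ∈ Ioc (N1 / a) (N2 / a), g b +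
      ∑ b ∈ Ioc 0 B, g b * ∑ a ∈ Ioc (N1 / b) (N2 / b), f a +
      ∑ p ∈ hypRest N1 N2 A B, f p.1 * g p.2 := by
  set P := (Ioc 0 N2 ×ˢ Ioc 0 N2).filter fun p => N1 < p.1 * p.2 ∧ p.1 * p.2 ≤ N2 with hP
  have hmemP : ∀ a b : ℕ, (a, b) ∈ P ↔ 0 < a ∧ 0 < b ∧ N1 < a * b ∧ a * b ≤ N2 := by
    intro a b
    simp only [hP, mem_filter, mem_product, mem_Ioc]
    constructor
    · rintro ⟨⟨⟨h1, -⟩, h2, -⟩, h3, h4⟩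
      exact ⟨h1, h2, h3, h4⟩
    · rintro ⟨h1, h2, h3, h4⟩
      exact ⟨⟨⟨h1, (Nat.le_mul_of_pos_right a h2).trans h4⟩, h2,
        (Nat.le_mul_of_pos_left b h1).trans h4⟩, h3, h4⟩
  have e0 : ∑ n ∈ Ioc N1 N2, ∑ p ∈ n.divisorsAntidiagonal, f p.1 * g p.2 =
      ∑ p ∈ P, f p.1 * g p.2 := by
    rw [← sum_fiberwise_of_maps_to (s := P) (t := Ioc N1 N2) (g := fun p => p.1 * p.2)]
    · refine sum_congr rfl fun n hn => sum_congr ?_ fun _ _ => rfl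
      ext ⟨a, b⟩
      rw [mem_filter, hmemP, Nat.mem_divisorsAntidiagonal]
      rw [mem_Ioc] at hn
      constructor
      · rintro ⟨h1, h2⟩
        dsimp only at h1
        have : 0 < a * b := by rw [h1]; exact Nat.pos_of_ne_zero h2
        exact ⟨⟨Nat.pos_of_mul_pos_right this, Nat.pos_of_mul_pos_left this, by rw [h1]; omega,
          by rw [h1]; omega⟩, h1⟩
      · rintro ⟨⟨h1, h2, h3, h4⟩, h5⟩
        exact ⟨h5, by omega⟩
    · rintro ⟨a, b⟩ h
      rw [hmemP] at h
      exact mem_Ioc.mpr ⟨h.2.2.1, h.2.2.2⟩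
  have e1 : ∑ p ∈ P with p.1 ≤ A, f p.1 * g p.2 =
      ∑ a ∈ Ioc 0 A, f a * ∑ b ∈ Ioc (N1 / a) (N2 / a), g b := by
    simp only [mul_sum]
    rw [sum_sigma']
    refine sum_bij' (fun p _ => ⟨p.1, p.2⟩) (fun p _ => (p.1, p.2)) ?_ ?_ ?_ ?_ ?_
    · rintro ⟨a, b⟩ h
      rw [mem_filter, hmemP] at h
      obtain ⟨⟨h1, h2, h3, h4⟩, h5⟩ := h
      simp only [mem_sigma, mem_Ioc]
      exact ⟨⟨h1, h5⟩, (Nat.div_lt_iff_lt_mul h1).mpr (by rwa [mul_comm]),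
        (Nat.le_div_iff_mul_le h1).mpr (by rwa [mul_comm])⟩
    · rintro ⟨a, b⟩ h
      simp only [mem_sigma, mem_Ioc] at h
      obtain ⟨⟨h1, h5⟩, h3, h4⟩ := h
      rw [mem_filter, hmemP]
      rw [Nat.div_lt_iff_lt_mul h1, mul_comm] at h3
      rw [Nat.le_div_iff_mul_le h1, mul_comm] at h4
      exact ⟨⟨h1, Nat.pos_of_ne_zero (by rintro rfl; omega), h3, h4⟩, h5⟩
    all_goals (intros; rfl)
  have e2 : ∑ p ∈ P with (¬ p.1 ≤ A) ∧ p.2 ≤ B, f p.1 * g p.2 =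
      ∑ b ∈ Ioc 0 B, g b * ∑ a ∈ Ioc (N1 / b) (N2 / b), f a := by
    simp only [mul_sum]
    rw [sum_sigma']
    refine sum_bij' (fun p _ => ⟨p.2, p.1⟩) (fun p _ => (p.2, p.1)) ?_ ?_ ?_ ?_ ?_
    · rintro ⟨a, b⟩ h
      rw [mem_filter, hmemP] at h
      obtain ⟨⟨h1, h2, h3, h4⟩, h5⟩ := h
      simp only [mem_sigma, mem_Ioc]
      exact ⟨⟨h2, h5.2⟩, (Nat.div_lt_iff_lt_mul h2).mpr h3, (Nat.le_div_iff_mul_le h2).mpr h4⟩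
    · rintro ⟨b, a⟩ h
      simp only [mem_sigma, mem_Ioc] at h
      obtain ⟨⟨h1, h5⟩, h3, h4⟩ := h
      rw [mem_filter, hmemP]
      have h6 : A ≤ N1 / b := by
        rw [Nat.le_div_iff_mul_le h1]
        exact (Nat.mul_le_mul_left A h5).trans hAB
      rw [Nat.le_div_iff_mul_le h1] at h4
      have h7 := (Nat.div_lt_iff_lt_mul h1).mp h3
      have h8 : A < a := h6.trans_lt h3
      exact ⟨⟨(Nat.zero_le A).trans_lt h8, h1, h7, h4⟩, not_le.mpr h8, h5⟩
    · intros; rfl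
    · intros; rfl
    · intros; exact mul_comm _ _
  have e3 : ∑ p ∈ P with (¬ p.1 ≤ A) ∧ ¬ p.2 ≤ B, f p.1 * g p.2 =
      ∑ p ∈ hypRest N1 N2 A B, f p.1 * g p.2 := by
    refine sum_congr ?_ fun _ _ => rfl
    rw [hP, filter_filter, hypRest]
    simp only [not_le]
  rw [e0, ← e1, ← e2, ← e3, ← sum_filter_add_sum_filter_not P fun p => p.1 ≤ A, add_assoc]
  congr 1
  clear_value P
  rw [← sum_filter_add_sum_filter_not (P.filter fun p => ¬ p.1 ≤ A) fun p => p.2 ≤ B,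
    filter_filter, filter_filter]

lemma card_hypRest_le {N1 N2 A B : ℕ} (hN : 0 < N1) (hA : 0 < A) (hB : B = N1 / A) (h12 : N1 ≤ N2) :
    ((hypRest N1 N2 A B).card : ℝ) ≤
      (A * (N2 - N1 : ℝ) / N1 + 1) * ((N2 - N1 : ℝ) / A + 1) := by
  have hN0 : (0:ℝ) < N1 := by exact_mod_cast hN
  have hA0 : (0:ℝ) < A := by exact_mod_cast hA
  have h12' : (N1:ℝ) ≤ N2 := by exact_mod_cast h12
  have hsub : hypRest N1 N2 A B ⊆
      Ioc ⌊(A:ℝ)⌋₊ ⌊(A:ℝ) + A * (N2 - N1 : ℝ) / N1⌋₊ ×ˢ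
      Ioc ⌊(N1:ℝ) / A⌋₊ ⌊(N1:ℝ) / A + (N2 - N1 : ℝ) / A⌋₊ := by
    rintro ⟨a, b⟩ h
    simp only [hypRest, mem_filter, mem_product, mem_Ioc] at h
    obtain ⟨⟨⟨h1, -⟩, h2, -⟩, ⟨h3, h4⟩, h5, h6⟩ := h
    have k1 : N1 < b * A := by
      rw [hB] at h6; exact (Nat.div_lt_iff_lt_mul hA).mp h6
    have k1' : (N1:ℝ) ≤ b * A := by exact_mod_cast k1.le
    have k2 : (a:ℝ) * b ≤ N2 := by exact_mod_cast h4
    have k3 : (A:ℝ) ≤ a := by exact_mod_cast h5.le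
    have ha0 : (0:ℝ) < a := by exact_mod_cast h1
    have hb0 : (0:ℝ) < b := by exact_mod_cast h2
    rw [mem_product, mem_Ioc, mem_Ioc, Nat.floor_natCast]
    refine ⟨⟨h5, Nat.le_floor ?_⟩, ?_, Nat.le_floor ?_⟩
    · have e : (A:ℝ) + A * (N2 - N1 : ℝ) / N1 = A * N2 / N1 := by field_simp; ring
      rw [e, le_div_iff₀ hN0]
      calc (a:ℝ) * N1 ≤ a * (b * A) := by gcongr
        _ = a * b * A := by ring
        _ ≤ N2 * A := by gcongr
        _ = _ := mul_comm _ _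
    · rw [Nat.floor_div_natCast, Nat.floor_natCast, ← hB]; exact h6
    · rw [← add_div, le_div_iff₀ hA0]
      calc (b:ℝ) * A ≤ b * a := by gcongr
        _ ≤ N1 + (N2 - N1) := by linarith
  have hc := card_le_card hsub
  rw [card_product] at hc
  have c1 := card_Ioc_floor_le (X := A) (Y := A * (N2 - N1 : ℝ) / N1) hA0.le
    (div_nonneg (mul_nonneg hA0.le (by linarith)) hN0.le)
  have c2 := card_Ioc_floor_le (X := (N1:ℝ) / A) (Y := (N2 - N1 : ℝ) / A) (by positivity)
    (div_nonneg (by linarith) hA0.le)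
  refine (Nat.cast_le.mpr hc).trans ?_
  rw [Nat.cast_mul]
  exact mul_le_mul c1 c2 (Nat.cast_nonneg _)
    (add_nonneg (div_nonneg (mul_nonneg hA0.le (by linarith)) hN0.le) zero_le_one)

end Hoh

namespace Hoh
open Finset Real MeasureTheory
open ArithmeticFunction (vonMangoldt vonMangoldt_nonneg vonMangoldt_le_log)

/-- The range of parameters in which the short interval estimate is carried out. -/
structure Setup (x y η : ℝ) (z K : ℕ) : Prop where
  η_pos : 0 < η
  η_le : η ≤ 1
  le_K : 5 ≤ K
  exp_le : exp K ≤ z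
  le_log_z : η * log x ≤ 2 * log z
  log_z_le : log z ≤ 2 * η * log x
  inv_le : 2 / η ≤ exp ((K:ℝ) / 2)
  pow_le : (((z ^ (4 * K + 13) : ℕ) : ℝ)) ^ 4 ≤ x
  y_pos : 0 < y
  y_le : y * log x ^ 2 ≤ x
  le_y : 7 * (x / y) ^ 2 * log x ^ 3 ≤ (z:ℝ) ^ (1/4:ℝ)

namespace Setup

variable {x y η : ℝ} {z K : ℕ}

lemma z_ge (h : Setup x y η z K) : (32:ℝ) ≤ z := by
  refine le_trans ?_ h.exp_le
  have h5 : (5:ℝ) ≤ K := by exact_mod_cast h.le_K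
  calc (32:ℝ) = 2 ^ 5 := by norm_num
    _ ≤ exp 1 ^ 5 := by gcongr; linarith [Real.exp_one_gt_d9]
    _ = exp 5 := by rw [← Real.exp_nat_mul]; norm_num
    _ ≤ _ := Real.exp_le_exp.mpr h5

lemma two_le_z (h : Setup x y η z K) : 2 ≤ z := by
  have := h.z_ge
  exact_mod_cast (by linarith : (2:ℝ) ≤ z)

lemma K_le_log (h : Setup x y η z K) : (K:ℝ) ≤ log z := by
  rw [Real.le_log_iff_exp_le (by linarith [h.z_ge])]; exact h.exp_le

lemma log_z_ge (h : Setup x y η z K) : 5 ≤ log z := by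
  have h5 : (5:ℝ) ≤ K := by exact_mod_cast h.le_K
  linarith [h.K_le_log]

lemma z_le_A (h : Setup x y η z K) : (z:ℝ) ≤ ((z ^ (4 * K + 13) : ℕ) : ℝ) := by
  have := h.two_le_z
  exact_mod_cast Nat.le_self_pow (by omega) z

lemma one_le_A (h : Setup x y η z K) : 1 ≤ z ^ (4 * K + 13) :=
  Nat.one_le_pow _ _ (by have := h.two_le_z; omega)

lemma z_le_x (h : Setup x y η z K) : (z:ℝ) ≤ x := by
  have h1 := h.z_le_A
  have h2 := h.z_ge
  refine le_trans ?_ h.pow_le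
  have h3 : (1:ℝ) ≤ ((z ^ (4 * K + 13) : ℕ) : ℝ) := by linarith
  exact h1.trans (le_self_pow₀ h3 (by norm_num))

lemma x_pos (h : Setup x y η z K) : 0 < x := by linarith [h.z_le_x, h.z_ge]

lemma log_z_le_log_x (h : Setup x y η z K) : log z ≤ log x :=
  Real.log_le_log (by linarith [h.z_ge]) h.z_le_x

lemma L_ge (h : Setup x y η z K) : 5 ≤ log x := h.log_z_ge.trans h.log_z_le_log_x

lemma y_lt (h : Setup x y η z K) : 25 * y ≤ x := by
  have h25 : 25 ≤ log x ^ 2 := by nlinarith [h.L_ge]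
  nlinarith [mul_le_mul_of_nonneg_left h25 h.y_pos.le, h.y_le]

lemma le_z (h : Setup x y η z K) : (x / y) ^ 2 * log x ^ 3 ≤ z := by
  have h1 := h.le_y
  have h2 := h.z_ge
  have h3 : (z:ℝ) ^ (1/4:ℝ) ≤ z := by
    conv_rhs => rw [← Real.rpow_one (z:ℝ)]
    exact Real.rpow_le_rpow_of_exponent_le (by linarith) (by norm_num)
  have h4 : 0 ≤ (x / y) ^ 2 * log x ^ 3 := by
    have := h.L_ge; positivity
  linarith

lemma xy_ge (h : Setup x y η z K) : log x ^ 2 ≤ x / y := by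
  rw [le_div_iff₀ h.y_pos, mul_comm]; exact h.y_le

lemma xy_mul_log_le (h : Setup x y η z K) : x / y * log x ≤ z := by
  refine le_trans ?_ h.le_z
  have h1 := h.L_ge
  have h2 := h.xy_ge
  have h3 : 1 ≤ x / y := by nlinarith
  have h4 : x / y ≤ (x / y) ^ 2 := le_self_pow₀ h3 (by norm_num)
  have h5 : log x ≤ log x ^ 3 := le_self_pow₀ (by linarith) (by norm_num)
  gcongr

lemma xy_le (h : Setup x y η z K) : x ≤ z * y := by
  rw [← div_le_iff₀ h.y_pos]
  refine le_trans ?_ h.xy_mul_log_le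
  have := h.L_ge
  have : 0 < x / y := div_pos h.x_pos h.y_pos
  nlinarith

lemma L_sq_le (h : Setup x y η z K) : log x ^ 2 ≤ z := by
  refine h.xy_ge.trans ((div_le_iff₀ h.y_pos).mpr h.xy_le)

lemma z_cube_le_A (h : Setup x y η z K) : (z:ℝ) ^ 3 ≤ ((z ^ (4 * K + 13) : ℕ) : ℝ) := by
  push_cast
  exact pow_le_pow_right₀ (by linarith [h.z_ge]) (by omega)

lemma A_le_y (h : Setup x y η z K) : (z:ℝ) * ((z ^ (4 * K + 13) : ℕ) : ℝ) ^ 2 ≤ y := by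
  have h0 := h.z_ge
  have h1 := h.z_le_A
  set A : ℝ := ((z ^ (4 * K + 13) : ℕ) : ℝ)
  have h2 := h.pow_le
  have h3 := h.xy_le
  have hz : (0:ℝ) < z := by linarith
  have hA : 0 < A := by linarith
  have h4 : (z:ℝ) * (z * A ^ 2) ≤ z * y := by
    refine le_trans ?_ (h2.trans h3)
    calc (z:ℝ) * (z * A ^ 2) ≤ A * (A * A ^ 2) := by gcongr
      _ = A ^ 4 := by ring
  exact le_of_mul_le_mul_left h4 hz

lemma y_ge_z (h : Setup x y η z K) : (z:ℝ) ≤ y := by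
  refine le_trans ?_ h.A_le_y
  have := h.z_ge
  have := h.z_le_A
  have h1 : (1:ℝ) ≤ ((z ^ (4 * K + 13) : ℕ) : ℝ) ^ 2 := one_le_pow₀ (by linarith)
  nlinarith

lemma log_A_le (h : Setup x y η z K) : log ((z ^ (4 * K + 13) : ℕ) : ℝ) ≤ 7 * K * log z := by
  push_cast
  rw [Real.log_pow]
  have h5 : (5:ℝ) ≤ K := by exact_mod_cast h.le_K
  have := h.log_z_ge
  push_cast
  gcongr
  linarith

lemma log_A_le_L (h : Setup x y η z K) : 4 * log ((z ^ (4 * K + 13) : ℕ) : ℝ) ≤ log x := by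
  have hA : (0:ℝ) < ((z ^ (4 * K + 13) : ℕ) : ℝ) := by exact_mod_cast h.one_le_A
  have := Real.log_le_log (by positivity) h.pow_le
  rw [Real.log_pow] at this
  exact_mod_cast this

lemma V_mul_le (h : Setup x y η z K) : V z * log x ≤ 2 / η := by
  have h1 := V_mul_log_le z (by have := h.two_le_z; omega)
  have h2 := h.le_log_z
  have h3 := V_pos z
  rw [le_div_iff₀ h.η_pos]
  nlinarith

end Setup

lemma Ioc_div_eq (x y : ℝ) (a : ℕ) :
    Ioc (⌊x⌋₊ / a) (⌊x + y⌋₊ / a) = Ioc ⌊x / a⌋₊ ⌊x / a + y / a⌋₊ := by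
  rw [← Nat.floor_div_natCast, ← Nat.floor_div_natCast, add_div]

set_option maxHeartbeats 1000000 in
lemma type_small_le : ∃ C : ℝ, 1 ≤ C ∧ ∃ K0 : ℕ, ∀ (x y η : ℝ) (z K : ℕ), K0 ≤ K → Setup x y η z K →
    |∑ a ∈ Ioc 0 (z ^ (4 * K + 13)), rI z a * log a * ∑ b ∈ Ioc (⌊x⌋₊ / a) (⌊x + y⌋₊ / a),
      rI z b * ArithmeticFunction.moebius b| ≤ C * y * (K ^ 11 * √η) := by
  obtain ⟨C1, hC1, hmo⟩ := moebius_short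
  obtain ⟨C2, hC2, K1, hK1, hLs⟩ := Ls_bound
  obtain ⟨C3, hC3, hrI⟩ := sum_rI_div_le
  refine ⟨588 * (C1 * C2 * (C3 + 1)), ?_, K1, fun x y η z K hK h => ?_⟩
  · have : 1 ≤ C1 * C2 := by nlinarith
    nlinarith
  have hx0 := h.x_pos
  have hy0 := h.y_pos
  have hL := h.L_ge
  have hη := h.η_pos
  have hz2 := h.two_le_z
  have hzr := h.z_ge
  have hlz := h.log_z_ge
  have hA1 := h.one_le_A
  have hlA := h.log_A_le
  have hlAL := h.log_A_le_L
  have hAy := h.A_le_y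
  have hpow := h.pow_le
  have hzA := h.z_cube_le_A
  have hzA1 := h.z_le_A
  set A := z ^ (4 * K + 13) with hA
  have hA0 : (0:ℝ) < A := by exact_mod_cast hA1
  have hK5 : (5:ℝ) ≤ K := by exact_mod_cast h.le_K
  set M := C2 * (K:ℝ) ^ 9 with hM
  have hM1 : 1 ≤ M := by
    have : 1 ≤ (K:ℝ) ^ 9 := one_le_pow₀ (by linarith)
    nlinarith
  have hsη : 0 < √η := Real.sqrt_pos.mpr hη
  have hsη1 : √η ≤ 1 := Real.sqrt_le_one.mpr h.η_le
  have hLz : log x / log z ≤ 2 / η := by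
    rw [div_le_div_iff₀ (by linarith) hη]; linarith [h.le_log_z]
  have hq : ∀ X, log X ≤ log x → 1 + M * √(log X / log z) ≤ 3 * M / √η := by
    intro X hX
    have h1 : √(log X / log z) ≤ 2 / √η := by
      refine Real.sqrt_le_iff.mpr ⟨by positivity, ?_⟩
      rw [div_pow, Real.sq_sqrt hη.le]
      calc log X / log z ≤ log x / log z := by gcongr
        _ ≤ 2 / η := hLz
        _ ≤ _ := by gcongr; norm_num
    have h2 : 1 ≤ M / √η := by rw [le_div_iff₀ hsη]; linarith
    calc _ ≤ M / √η + M * (2 / √η) := by gcongr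
      _ = _ := by ring
  have hper : ∀ a ∈ Ioc 0 A, |rI z a * log a * ∑ b ∈ Ioc (⌊x⌋₊ / a) (⌊x + y⌋₊ / a),
      rI z b * ArithmeticFunction.moebius b| ≤
      rI z a / a * (log A * (C1 * (2 * y / log x) * (3 * M / √η))) := by
    intro a ha
    obtain ⟨ha0, haA⟩ := mem_Ioc.mp ha
    have ha0' : (0:ℝ) < a := by exact_mod_cast ha0
    have ha1' : (1:ℝ) ≤ a := by exact_mod_cast ha0
    have haA' : (a:ℝ) ≤ A := by exact_mod_cast haA
    have hla : log a ≤ log A := Real.log_le_log ha0' haA'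
    have hla0 : 0 ≤ log (a:ℝ) := Real.log_natCast_nonneg a
    rw [Ioc_div_eq]
    have hlX : log (x / a) = log x - log a := Real.log_div hx0.ne' ha0'.ne'
    have hlX2 : log x / 2 ≤ log (x / a) := by rw [hlX]; linarith
    have hlX3 : log (x / a) ≤ log x := by rw [hlX]; linarith
    have c1 : exp 2 ≤ x / a := by
      rw [← Real.le_log_iff_exp_le (by positivity)]; linarith
    have c2 : √(x / a) ≤ y / a := by
      refine Real.sqrt_le_iff.mpr ⟨by positivity, ?_⟩
      rw [div_pow, div_le_div_iff₀ ha0' (by positivity)]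
      have e1 : x * (a:ℝ) ≤ y ^ 2 := by
        calc x * a ≤ (z * y) * A := by
              have := h.xy_le
              gcongr
          _ = (z * A) * y := by ring
          _ ≤ y * y := by
              gcongr
              refine le_trans ?_ hAy
              have : (A:ℝ) ≤ (A:ℝ) ^ 2 := le_self_pow₀ (by exact_mod_cast hA1) (by norm_num)
              gcongr
          _ = _ := by ring
      nlinarith
    have c3 : y / a * log (x / a) ≤ x / a := by
      rw [div_mul_eq_mul_div]
      gcongr
      refine le_trans ?_ h.y_le
      have : log x ≤ log x ^ 2 := le_self_pow₀ (by linarith) (by norm_num)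
      gcongr
      linarith
    have c4 : 7 * (x / a / (y / a)) ^ 2 * log (x / a) ^ 3 ≤ (z:ℝ) ^ (1/4:ℝ) := by
      refine le_trans ?_ h.le_y
      rw [div_div_div_cancel_right₀ ha0'.ne']
      have : 0 ≤ log (x / a) := by linarith
      gcongr
    have c5 := hmo z hz2 (x / a) (y / a) M c1 c2 c3 (by linarith) c4 (by
      intro t ht τ hτ
      refine hLs K hK z h.exp_le τ (le_trans ?_ hτ) t ht
      have h1 : 1 / log x ≤ 1 / log (x / a) := by
        have : 0 < log (x / a) := by linarith
        gcongr
      refine le_trans ?_ h1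
      rw [div_le_div_iff₀ (by linarith) (by linarith), neg_div, Real.exp_neg, one_mul,
        inv_mul_le_iff₀ (Real.exp_pos _)]
      have h2 := h.inv_le
      rw [div_le_iff₀ (by linarith)] at hLz
      calc log x ≤ 2 / η * log z := hLz
        _ ≤ _ := by gcongr)
    rw [abs_mul, abs_mul, abs_of_nonneg (rI_nonneg _ _), abs_of_nonneg hla0]
    have hr := rI_nonneg z a
    calc _ ≤ rI z a * log A * (C1 * (y / a / log (x / a)) * (1 + M * √(log (x / a) / log z))) := by
          gcongr
      _ ≤ rI z a * log A * (C1 * (y / a / (log x / 2)) * (3 * M / √η)) := by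
          have := hq (x / a) hlX3
          have : 0 ≤ log (A:ℝ) := by linarith
          gcongr
      _ = _ := by field_simp
  refine (abs_sum_le_sum_abs _ _).trans ((sum_le_sum hper).trans ?_)
  rw [← sum_mul]
  have h1 := hrI z hz2 A hzA1
  rw [Nat.floor_natCast] at h1
  have hV := V_pos z
  have hVl := V_mul_log_le z (by omega)
  have h2 : ∑ a ∈ Ioc 0 A, rI z a / (a:ℝ) ≤ (C3 + 1) * (7 * K) := by
    refine h1.trans ?_
    calc C3 * V z * log A ≤ C3 * V z * (7 * K * log z) := by gcongr
      _ = C3 * (V z * log z) * (7 * K) := by ring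
      _ ≤ C3 * 1 * (7 * K) := by gcongr
      _ ≤ _ := by gcongr; linarith
  have h3 : log z / log x ≤ 2 * η := by
    rw [div_le_iff₀ (by linarith)]; exact h.log_z_le
  have hlA0 : 0 ≤ log (A:ℝ) := Real.log_natCast_nonneg A
  calc _ ≤ ((C3 + 1) * (7 * K)) * ((7 * K * log z) * (C1 * (2 * y / log x) * (3 * M / √η))) := by
        gcongr
    _ = 294 * (C1 * C2 * (C3 + 1)) * y * (K:ℝ) ^ 11 * (log z / log x) / √η := by
        rw [hM]; field_simp; ring
    _ ≤ 294 * (C1 * C2 * (C3 + 1)) * y * (K:ℝ) ^ 11 * (2 * η) / √η := by gcongr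
    _ = 588 * (C1 * C2 * (C3 + 1)) * y * (K:ℝ) ^ 11 * (η / √η) := by ring
    _ = _ := by rw [Real.div_sqrt]; ring

end Hoh

namespace Hoh
open Finset Real MeasureTheory
open ArithmeticFunction (vonMangoldt vonMangoldt_nonneg vonMangoldt_le_log)

/-- The main term coefficient: the sifted density times a truncated logarithmic Möbius sum. -/
noncomputable def mainCoeff (x : ℝ) (z A : ℕ) : ℝ :=
  V z * ∑ b ∈ Ioc 0 (⌊x⌋₊ / A), rI z b * ArithmeticFunction.moebius b / b * log (x / b)

set_option maxHeartbeats 1000000 in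
lemma type_large_le : ∃ C : ℝ, 1 ≤ C ∧ ∃ K0 : ℕ, ∀ (x y η : ℝ) (z K : ℕ), K0 ≤ K → Setup x y η z K →
    |∑ b ∈ Ioc 0 (⌊x⌋₊ / z ^ (4 * K + 13)), rI z b * ArithmeticFunction.moebius b *
      ∑ a ∈ Ioc (⌊x⌋₊ / b) (⌊x + y⌋₊ / b), rI z a * log a - y * mainCoeff x z (z ^ (4 * K + 13))|
      ≤ C * y * (exp (-(K:ℝ)) / η ^ 2 + 1 / log x) := by
  obtain ⟨b0, hb0, hrc⟩ := rough_count
  obtain ⟨C3, hC3, hrI⟩ := sum_rI_div_le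
  refine ⟨11 * C3 + 1, by linarith, b0, fun x y η z K hK h => ?_⟩
  have hx0 := h.x_pos
  have hy0 := h.y_pos
  have hL := h.L_ge
  have hη := h.η_pos
  have hz2 := h.two_le_z
  have hzr := h.z_ge
  have hA1 := h.one_le_A
  have hzA1 := h.z_le_A
  have hxzy := h.xy_le
  have hVL := h.V_mul_le
  have hLz := h.L_sq_le
  have hyL := h.y_le
  have hA3 : z ^ (4 * K + 13) = z ^ (4 * K + 10) * z ^ 3 := by rw [← pow_add]
  set A := z ^ (4 * K + 13) with hA
  set L := log x with hLd
  set q := z ^ (4 * K + 10) with hq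
  have hA0 : (0:ℝ) < A := by exact_mod_cast hA1
  have hA3' : (A:ℝ) = q * (z:ℝ) ^ 3 := by exact_mod_cast hA3
  have hz0 : (0:ℝ) < z := by linarith
  have hV := V_pos z
  have hV1 := V_le_one z
  have hE := Real.exp_pos (-(K:ℝ))
  have hper : ∀ b ∈ Ioc 0 (⌊x⌋₊ / A), |rI z b * ArithmeticFunction.moebius b *
      ∑ a ∈ Ioc (⌊x⌋₊ / b) (⌊x + y⌋₊ / b), rI z a * log a -
      y * (V z * (rI z b * ArithmeticFunction.moebius b / b * log (x / b)))| ≤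
      rI z b / b * (2 * y ^ 2 / x + L * (2 * exp (-(K:ℝ)) * V z * y) + L * x / z ^ 3) := by
    intro b hb
    obtain ⟨hb1, hb2⟩ := mem_Ioc.mp hb
    have hb0' : (0:ℝ) < b := by exact_mod_cast hb1
    have hb1' : (1:ℝ) ≤ b := by exact_mod_cast hb1
    have hbx : (b:ℝ) * A ≤ x := by
      have h1 : b * A ≤ ⌊x⌋₊ := (Nat.le_div_iff_mul_le hA1).mp hb2
      exact le_trans (by exact_mod_cast h1) (Nat.floor_le hx0.le)
    have hby : (b:ℝ) ≤ y := by
      have : (b:ℝ) * A ≤ y * A := by nlinarith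
      exact le_of_mul_le_mul_right this hA0
    have hbx1 : (b:ℝ) ≤ x := by nlinarith
    have hl0 : 0 ≤ log (x / b) := Real.log_nonneg (by rw [le_div_iff₀ hb0']; linarith)
    have hlL : log (x / b) ≤ L := by
      refine Real.log_le_log (by positivity) ?_
      exact div_le_self hx0.le hb1'
    rw [Ioc_div_eq]
    set I := Ioc ⌊x / b⌋₊ ⌊x / b + y / b⌋₊ with hI
    have h1 : |∑ a ∈ I, rI z a * log a - log (x / b) * ∑ a ∈ I, rI z a| ≤ (2 * y / b) * (y / x) := by
      rw [mul_sum, ← sum_sub_distrib]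
      refine (abs_sum_le_sum_abs _ _).trans ?_
      have hp : ∀ a ∈ I, |rI z a * log a - log (x / b) * rI z a| ≤ y / x := by
        intro a ha
        obtain ⟨ha1, ha2⟩ := mem_Ioc.mp ha
        have ha1' : x / b < a := Nat.lt_of_floor_lt ha1
        have ha2' : (a:ℝ) ≤ x / b + y / b := (Nat.le_floor_iff (by positivity)).mp ha2
        have ha0 : (0:ℝ) < a := lt_trans (by positivity) ha1'
        have e : rI z a * log a - log (x / b) * rI z a = rI z a * log (a / (x / b)) := by
          rw [Real.log_div ha0.ne' (by positivity)]; ring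
        have e1 : 0 ≤ log (a / (x / b)) := Real.log_nonneg (by
          rw [le_div_iff₀ (by positivity)]; linarith)
        have e2 : log (a / (x / b)) ≤ y / x := by
          refine (Real.log_le_sub_one_of_pos (by positivity)).trans ?_
          rw [sub_le_iff_le_add, div_le_iff₀ (by positivity)]
          refine ha2'.trans (le_of_eq ?_)
          field_simp
          ring
        rw [e, abs_of_nonneg (mul_nonneg (rI_nonneg _ _) e1)]
        nlinarith [rI_nonneg z a, rI_le_one z a]
      refine (sum_le_sum hp).trans ?_
      rw [sum_const, nsmul_eq_mul]
      have hc := card_Ioc_floor_le (X := x / b) (Y := y / b) (by positivity) (by positivity)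
      have : 1 ≤ y / b := by rw [le_div_iff₀ hb0']; linarith
      gcongr
      refine hc.trans ?_
      rw [mul_div_assoc]; linarith
    have h2 := hrc z (by omega) K hK (x / b) (y / b) (by positivity) (by positivity)
    have h3 : ((z:ℝ) ^ (4 * K + 10)) ≤ x / (b * z ^ 3) := by
      rw [le_div_iff₀ (by positivity)]
      refine le_trans (le_of_eq ?_) hbx
      rw [hA3', hq]; push_cast; ring
    have h4 : |∑ a ∈ I, rI z a * log a - V z * (y / b) * log (x / b)| ≤
        1 / b * (2 * y ^ 2 / x + L * (2 * exp (-(K:ℝ)) * V z * y) + L * x / z ^ 3) := by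
      have e : ∑ a ∈ I, rI z a * log a - V z * (y / b) * log (x / b) =
          (∑ a ∈ I, rI z a * log a - log (x / b) * ∑ a ∈ I, rI z a) +
          log (x / b) * (∑ a ∈ I, rI z a - V z * (y / b)) := by ring
      rw [e]
      refine (abs_add_le _ _).trans ?_
      rw [abs_mul, abs_of_nonneg hl0]
      calc _ ≤ (2 * y / b) * (y / x) + L * (2 * exp (-(K:ℝ)) * V z * (y / b) + x / (b * z ^ 3)) := by
            gcongr
            refine h2.trans ?_
            gcongr
        _ = _ := by field_simp; ring
    have e : rI z b * ArithmeticFunction.moebius b * ∑ a ∈ I, rI z a * log a -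
        y * (V z * (rI z b * ArithmeticFunction.moebius b / b * log (x / b))) =
        rI z b * (ArithmeticFunction.moebius b *
          (∑ a ∈ I, rI z a * log a - V z * (y / b) * log (x / b))) := by
      field_simp
    rw [e, abs_mul, abs_mul, abs_of_nonneg (rI_nonneg _ _)]
    have hmu := abs_moebius_le b
    have hr := rI_nonneg z b
    calc _ ≤ rI z b * (1 * (1 / b * (2 * y ^ 2 / x + L * (2 * exp (-(K:ℝ)) * V z * y) + L * x / z ^ 3))) := by
          gcongr
      _ = _ := by ring
  rw [mainCoeff, mul_sum, mul_sum, ← sum_sub_distrib]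
  refine (abs_sum_le_sum_abs _ _).trans ((sum_le_sum hper).trans ?_)
  rw [← sum_mul]
  have hs : ∑ b ∈ Ioc 0 (⌊x⌋₊ / A), rI z b / (b:ℝ) ≤ C3 * V z * L := by
    refine le_trans ?_ (hrI z hz2 x h.z_le_x)
    refine sum_le_sum_of_subset_of_nonneg (Ioc_subset_Ioc_right (Nat.div_le_self _ _)) ?_
    intro i _ _
    have := rI_nonneg z i
    positivity
  have t1 : 2 * y ^ 2 / x * (C3 * V z * L) ≤ 2 * C3 * y * (1 / L) := by
    rw [mul_one_div, div_mul_eq_mul_div, div_le_div_iff₀ hx0 (by linarith)]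
    calc 2 * y ^ 2 * (C3 * V z * L) * L = (2 * C3 * y) * (V z * (y * L ^ 2)) := by ring
      _ ≤ (2 * C3 * y) * (1 * x) := by gcongr
      _ = _ := by ring
  have t2 : L * (2 * exp (-(K:ℝ)) * V z * y) * (C3 * V z * L) ≤ 8 * C3 * y * (exp (-(K:ℝ)) / η ^ 2) := by
    calc _ = (2 * C3 * y * exp (-(K:ℝ))) * (V z * L) ^ 2 := by ring
      _ ≤ (2 * C3 * y * exp (-(K:ℝ))) * (2 / η) ^ 2 := by
          have : 0 ≤ V z * L := mul_nonneg hV.le (by linarith)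
          gcongr
      _ = _ := by ring
  have t3 : L * x / z ^ 3 * (C3 * V z * L) ≤ C3 * y * (exp (-(K:ℝ)) / η ^ 2) := by
    have hη2 : η ^ 2 ≤ 1 := pow_le_one₀ hη.le h.η_le
    have hze : 1 / (z:ℝ) ≤ exp (-(K:ℝ)) := by
      rw [Real.exp_neg, ← one_div]
      exact one_div_le_one_div_of_le (Real.exp_pos _) h.exp_le
    calc _ = C3 * V z * (L ^ 2) * x / z ^ 3 := by ring
      _ ≤ C3 * 1 * z * (z * y) / z ^ 3 := by gcongr
      _ = C3 * y * (1 / z) := by field_simp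
      _ ≤ C3 * y * (exp (-(K:ℝ)) / η ^ 2) := by
          refine mul_le_mul_of_nonneg_left (hze.trans ?_) (by positivity)
          rw [le_div_iff₀ (by positivity)]
          nlinarith
  have hD : 0 ≤ 2 * y ^ 2 / x + L * (2 * exp (-(K:ℝ)) * V z * y) + L * x / z ^ 3 := by
    have : 0 ≤ L := by linarith
    positivity
  have p1 : 0 ≤ y * (1 / L) := by
    have : 0 < L := by linarith
    positivity
  have p2 : 0 ≤ y * (exp (-(K:ℝ)) / η ^ 2) := by positivity
  calc _ ≤ (C3 * V z * L) * (2 * y ^ 2 / x + L * (2 * exp (-(K:ℝ)) * V z * y) + L * x / z ^ 3) := by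
        gcongr
    _ = 2 * y ^ 2 / x * (C3 * V z * L) + L * (2 * exp (-(K:ℝ)) * V z * y) * (C3 * V z * L) +
        L * x / z ^ 3 * (C3 * V z * L) := by ring
    _ ≤ 2 * C3 * y * (1 / L) + 8 * C3 * y * (exp (-(K:ℝ)) / η ^ 2) + C3 * y * (exp (-(K:ℝ)) / η ^ 2) := by
        gcongr
    _ ≤ _ := by nlinarith

set_option maxHeartbeats 1000000 in
lemma rest_le {x y η : ℝ} {z K : ℕ} (h : Setup x y η z K) :
    |∑ p ∈ hypRest ⌊x⌋₊ ⌊x + y⌋₊ (z ^ (4 * K + 13)) (⌊x⌋₊ / z ^ (4 * K + 13)),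
      rI z p.1 * log p.1 * (rI z p.2 * ArithmeticFunction.moebius p.2)| ≤ 30 * y * (1 / log x) ∧
    |∑ n ∈ Ioc ⌊x⌋₊ ⌊x + y⌋₊, vonMangoldt n * (1 - rI z n)| ≤ 2 * y * (1 / log x) := by
  have hx0 := h.x_pos
  have hy0 := h.y_pos
  have hL := h.L_ge
  have hz2 := h.two_le_z
  have hzr := h.z_ge
  have hA1 := h.one_le_A
  have hzA1 := h.z_le_A
  have hLz := h.L_sq_le
  have hyL := h.y_le
  have hyx := h.y_lt
  have hyz := h.y_ge_z
  have hAy := h.A_le_y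
  have hpow := h.pow_le
  set A := z ^ (4 * K + 13) with hA
  set L := log x with hLd
  have hA0 : (0:ℝ) < A := by exact_mod_cast hA1
  have hN2x : (⌊x + y⌋₊:ℝ) ≤ x + y := Nat.floor_le (by positivity)
  have hN1x : (⌊x⌋₊:ℝ) ≤ x := Nat.floor_le hx0.le
  have hN1l : x - 1 < ⌊x⌋₊ := by linarith [Nat.lt_floor_add_one x]
  have hxz : (32:ℝ) ≤ x := by linarith
  have hN12 : ⌊x⌋₊ ≤ ⌊x + y⌋₊ := Nat.floor_mono (by linarith)
  have hN1 : 0 < ⌊x⌋₊ := Nat.floor_pos.mpr (by linarith)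
  have hlogN2 : ∀ a : ℕ, 0 < a → a ≤ ⌊x + y⌋₊ → log a ≤ 2 * L := by
    intro a ha0 ha
    have ha0' : (0:ℝ) < a := by exact_mod_cast ha0
    have ha' : (a:ℝ) ≤ ⌊x + y⌋₊ := by exact_mod_cast ha
    have : (a:ℝ) ≤ x ^ 2 := by nlinarith
    have := Real.log_le_log ha0' this
    rw [Real.log_pow] at this
    exact_mod_cast this
  have hAz : (A:ℝ) * z ≤ x := by
    have hAone : (1:ℝ) ≤ A := by exact_mod_cast hA1
    calc (A:ℝ) * z ≤ A * A := by gcongr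
      _ = (A:ℝ) ^ 2 := by ring
      _ ≤ (A:ℝ) ^ 4 := pow_le_pow_right₀ hAone (by norm_num)
      _ ≤ x := hpow
  have hL0 : 0 < L := by linarith
  constructor
  · have hc := card_hypRest_le hN1 hA1 rfl hN12
    have hterm : ∀ p ∈ hypRest ⌊x⌋₊ ⌊x + y⌋₊ A (⌊x⌋₊ / A),
        |rI z p.1 * log p.1 * (rI z p.2 * ArithmeticFunction.moebius p.2)| ≤ 2 * L := by
      intro p hp
      simp only [hypRest, mem_filter, mem_product, mem_Ioc] at hp
      have hl := hlogN2 p.1 hp.1.1.1 hp.1.1.2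
      have hl0 : 0 ≤ log (p.1:ℝ) := Real.log_natCast_nonneg _
      rw [abs_mul, abs_mul, abs_mul, abs_of_nonneg (rI_nonneg _ _), abs_of_nonneg (rI_nonneg _ _),
        abs_of_nonneg hl0]
      have r1 := rI_nonneg z p.1
      have r2 := rI_nonneg z p.2
      calc _ ≤ 1 * (2 * L) * (1 * 1) := by
            gcongr
            · exact rI_le_one _ _
            · exact rI_le_one _ _
            · exact abs_moebius_le _
        _ = _ := by ring
    refine (abs_sum_le_sum_abs _ _).trans ((sum_le_sum hterm).trans ?_)
    rw [sum_const, nsmul_eq_mul]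
    have hd : ((⌊x + y⌋₊:ℝ) - ⌊x⌋₊) ≤ 2 * y := by linarith
    have hd0 : 0 ≤ ((⌊x + y⌋₊:ℝ) - ⌊x⌋₊) := by
      have : (⌊x⌋₊:ℝ) ≤ ⌊x + y⌋₊ := by exact_mod_cast hN12
      linarith
    have hc2 : ((hypRest ⌊x⌋₊ ⌊x + y⌋₊ A (⌊x⌋₊ / A)).card : ℝ) ≤
        (A * (2 * y) / (x / 2) + 1) * (2 * y / A + 1) := by
      refine hc.trans ?_
      gcongr
      linarith
    have e : (A * (2 * y) / (x / 2) + 1) * (2 * y / A + 1) * (2 * L) =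
        16 * (y ^ 2 * L / x) + 8 * (A * y * L / x) + 4 * (y * L / A) + 2 * L := by
      field_simp; ring
    have e1 : y ^ 2 * L / x ≤ y * (1 / L) := by
      rw [mul_one_div, div_le_div_iff₀ hx0 hL0]; nlinarith
    have e2 : A * y * L / x ≤ y * (1 / L) := by
      rw [mul_one_div, div_le_div_iff₀ hx0 hL0]
      calc A * y * L * L = y * (A * L ^ 2) := by ring
        _ ≤ y * (A * z) := by gcongr
        _ ≤ y * x := by gcongr
    have e3 : y * L / A ≤ y * (1 / L) := by
      rw [mul_one_div, div_le_div_iff₀ hA0 hL0]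
      calc y * L * L = y * L ^ 2 := by ring
        _ ≤ y * A := by gcongr; linarith
    have e4 : L ≤ y * (1 / L) := by
      rw [mul_one_div, le_div_iff₀ hL0]; nlinarith
    calc _ ≤ (A * (2 * y) / (x / 2) + 1) * (2 * y / A + 1) * (2 * L) := by gcongr
      _ ≤ _ := by rw [e]; linarith
  · have hpos : ∀ n, 0 ≤ vonMangoldt n * (1 - rI z n) := fun n =>
      mul_nonneg vonMangoldt_nonneg (by linarith [rI_le_one z n])
    rw [abs_of_nonneg (sum_nonneg fun n _ => hpos n)]
    have h1 : ∑ n ∈ Ioc ⌊x⌋₊ ⌊x + y⌋₊, vonMangoldt n * (1 - rI z n) ≤ z * log ⌊x + y⌋₊ := by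
      refine le_trans ?_ (sum_vonMangoldt_nonrough z ⌊x + y⌋₊)
      exact sum_le_sum_of_subset_of_nonneg (Ioc_subset_Ioc_left (Nat.zero_le _)) fun n _ _ => hpos n
    have h2 := hlogN2 ⌊x + y⌋₊ (by omega) le_rfl
    have h3 : z * L ≤ y * (1 / L) := by
      rw [mul_one_div, le_div_iff₀ hL0]
      calc z * L * L = z * L ^ 2 := by ring
        _ ≤ z * (A:ℝ) ^ 2 := by
            gcongr
            have : (1:ℝ) ≤ A := by exact_mod_cast hA1
            nlinarith
        _ ≤ y := hAy
    calc _ ≤ z * (2 * L) := h1.trans (by gcongr)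
      _ ≤ _ := by linarith

theorem short_interval : ∃ C : ℝ, 1 ≤ C ∧ ∃ K0 : ℕ, ∀ (x y η : ℝ) (z K : ℕ), K0 ≤ K → Setup x y η z K →
    |∑ n ∈ Ioc ⌊x⌋₊ ⌊x + y⌋₊, vonMangoldt n - y * mainCoeff x z (z ^ (4 * K + 13))| ≤
      C * y * (K ^ 11 * √η + exp (-(K:ℝ)) / η ^ 2 + 1 / log x) := by
  obtain ⟨C1, hC1, K1, h1⟩ := type_small_le
  obtain ⟨C2, hC2, K2, h2⟩ := type_large_le
  refine ⟨C1 + C2 + 32, by linarith, max K1 K2, fun x y η z K hK h => ?_⟩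
  have hK1 := le_trans (le_max_left _ _) hK
  have hK2 := le_trans (le_max_right _ _) hK
  have s1 := h1 x y η z K hK1 h
  have s2 := h2 x y η z K hK2 h
  obtain ⟨s3, s4⟩ := rest_le h
  have hh := sum_hyperbola (fun a => rI z a * log a) (fun b => rI z b * ArithmeticFunction.moebius b)
    (N1 := ⌊x⌋₊) (N2 := ⌊x + y⌋₊) (Nat.mul_div_le ⌊x⌋₊ (z ^ (4 * K + 13)))
  have e : ∑ n ∈ Ioc ⌊x⌋₊ ⌊x + y⌋₊, vonMangoldt n =
      ∑ n ∈ Ioc ⌊x⌋₊ ⌊x + y⌋₊, ∑ p ∈ n.divisorsAntidiagonal,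
        (rI z p.1 * log p.1) * (rI z p.2 * ArithmeticFunction.moebius p.2) +
      ∑ n ∈ Ioc ⌊x⌋₊ ⌊x + y⌋₊, vonMangoldt n * (1 - rI z n) := by
    rw [← sum_add_distrib]
    refine sum_congr rfl fun n _ => ?_
    rw [← rI_mul_vonMangoldt]; ring
  rw [e, hh]
  have hL := h.L_ge
  have hy := h.y_pos
  have p1 : 0 ≤ y * (1 / log x) := by positivity
  have p2 : 0 ≤ y * (exp (-(K:ℝ)) / η ^ 2) := by positivity
  have p3 : 0 ≤ y * ((K:ℝ) ^ 11 * √η) := by positivity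
  rw [abs_le] at *
  constructor <;> nlinarith [s1.1, s1.2, s2.1, s2.2, s3.1, s3.2, s4.1, s4.2]

end Hoh

namespace Hoh
open Finset Real MeasureTheory
open ArithmeticFunction (vonMangoldt vonMangoldt_nonneg vonMangoldt_le_log)

lemma sum_Ioc_telescope {N : ℕ → ℕ} (hN : Monotone N) (f : ℕ → ℝ) (m : ℕ) :
    ∑ i ∈ range m, ∑ n ∈ Ioc (N i) (N (i + 1)), f n = ∑ n ∈ Ioc (N 0) (N m), f n := by
  induction m with
  | zero => simp
  | succ k ih =>
    rw [sum_range_succ, ih, sum_Ioc_consecutive _ (hN (Nat.zero_le _)) (hN (Nat.le_succ _))]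

lemma abs_log_floor_sub_le {X : ℝ} (hX : 1 ≤ X) : |log ⌊X⌋₊ - log X| ≤ 1 := by
  have h1 : 1 ≤ ⌊X⌋₊ := Nat.le_floor (by exact_mod_cast hX)
  have h1' : (1:ℝ) ≤ ⌊X⌋₊ := by exact_mod_cast h1
  have h2 : (⌊X⌋₊:ℝ) ≤ X := Nat.floor_le (by linarith)
  have h3 : X ≤ 2 * ⌊X⌋₊ := by linarith [Nat.lt_floor_add_one X]
  have h4 := Real.log_le_log (by linarith) h2
  have h5 := Real.log_le_log (by linarith) h3
  rw [Real.log_mul (by norm_num) (by linarith)] at h5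
  have := Real.log_two_lt_d9
  rw [abs_le]
  constructor <;> linarith

/-- Comparison with Mertens' theorem: if short intervals tiling a long multiplicative range all
have density close to `c`, then `c` is close to one. -/
lemma abs_density_sub_one_le : ∃ C : ℝ, 0 < C ∧ ∀ (x θ c D : ℝ) (m : ℕ), 1 ≤ x → 0 < θ → θ ≤ 1 →
    1 ≤ m → 0 ≤ D →
    (∀ i < m, |∑ n ∈ Ioc ⌊x * (1 + θ) ^ i⌋₊ ⌊x * (1 + θ) ^ i + θ * (x * (1 + θ) ^ i)⌋₊, vonMangoldt n
      - θ * (x * (1 + θ) ^ i) * c| ≤ D * (θ * (x * (1 + θ) ^ i))) →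
    |c - 1| ≤ D + θ + C / (m * θ) := by
  obtain ⟨C0, hC0, hmert⟩ := mertens_one
  refine ⟨2 * (2 * C0 + 2), by linarith, fun x θ c D m hx hθ hθ1 hm hD h => ?_⟩
  set N : ℕ → ℕ := fun i => ⌊x * (1 + θ) ^ i⌋₊ with hN
  have hxi : ∀ i, 1 ≤ x * (1 + θ) ^ i := fun i => by
    have : 1 ≤ (1 + θ) ^ i := one_le_pow₀ (by linarith)
    nlinarith
  have hmono : Monotone N := monotone_nat_of_le_succ fun i => Nat.floor_mono (by
    rw [pow_succ]
    have := hxi i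
    nlinarith)
  have hstep : ∀ i, ⌊x * (1 + θ) ^ i + θ * (x * (1 + θ) ^ i)⌋₊ = N (i + 1) := fun i => by
    rw [hN]; congr 1; ring
  have hm0 : (0:ℝ) < m := by exact_mod_cast hm
  have hT := sum_Ioc_telescope hmono (fun n => vonMangoldt n / n) m
  set T := ∑ n ∈ Ioc (N 0) (N m), vonMangoldt n / (n:ℝ) with hTd
  have hup : T ≤ m * (θ * (c + D)) := by
    rw [← hT, ← nsmul_eq_mul]
    conv_rhs => rw [← card_range m]
    refine sum_le_card_nsmul _ _ _ fun i hi => ?_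
    have hi' := (abs_le.mp (h i (mem_range.mp hi))).2
    rw [hstep] at hi'
    have hx0 : 0 < x * (1 + θ) ^ i := by linarith [hxi i]
    calc ∑ n ∈ Ioc (N i) (N (i + 1)), vonMangoldt n / (n:ℝ) ≤
        ∑ n ∈ Ioc (N i) (N (i + 1)), vonMangoldt n / (x * (1 + θ) ^ i) := by
          refine sum_le_sum fun n hn => ?_
          have := Nat.lt_of_floor_lt (mem_Ioc.mp hn).1
          have hv := vonMangoldt_nonneg (n := n)
          gcongr
      _ = (∑ n ∈ Ioc (N i) (N (i + 1)), vonMangoldt n) / (x * (1 + θ) ^ i) := by rw [sum_div]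
      _ ≤ θ * (c + D) := by
          rw [div_le_iff₀ hx0]; nlinarith
  have hlo : m * (θ * (c - D) / (1 + θ)) ≤ T := by
    rw [← hT, ← nsmul_eq_mul]
    conv_lhs => rw [← card_range m]
    refine card_nsmul_le_sum _ _ _ fun i hi => ?_
    have hi' := (abs_le.mp (h i (mem_range.mp hi))).1
    rw [hstep] at hi'
    have hx0 : 0 < x * (1 + θ) ^ i := by linarith [hxi i]
    have hx1 : 0 < x * (1 + θ) ^ (i + 1) := by linarith [hxi (i + 1)]
    calc θ * (c - D) / (1 + θ) ≤ (∑ n ∈ Ioc (N i) (N (i + 1)), vonMangoldt n) / (x * (1 + θ) ^ (i + 1)) := by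
          rw [div_le_div_iff₀ (by linarith) hx1, pow_succ]
          nlinarith
      _ = ∑ n ∈ Ioc (N i) (N (i + 1)), vonMangoldt n / (x * (1 + θ) ^ (i + 1)) := by rw [sum_div]
      _ ≤ _ := by
          refine sum_le_sum fun n hn => ?_
          have h1 := (mem_Ioc.mp hn).1
          have h2 := (Nat.le_floor_iff hx1.le).mp (mem_Ioc.mp hn).2
          have hv := vonMangoldt_nonneg (n := n)
          have : (0:ℝ) < n := by exact_mod_cast (Nat.zero_le _).trans_lt h1
          gcongr
  have hTm : |T - m * log (1 + θ)| ≤ 2 * C0 + 2 := by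
    have hN0 : 1 ≤ N 0 := Nat.le_floor (by have := hxi 0; exact_mod_cast this)
    have hNm : 1 ≤ N m := Nat.le_floor (by have := hxi m; exact_mod_cast this)
    have e0 := sum_Ioc_consecutive (fun n => vonMangoldt n / (n:ℝ)) (Nat.zero_le _) (hmono (Nat.zero_le m))
    have e1 := hmert (N 0) hN0
    have e2 := hmert (N m) hNm
    have e3 := abs_log_floor_sub_le (hxi 0)
    have e4 := abs_log_floor_sub_le (hxi m)
    have e5 : log (x * (1 + θ) ^ m) = log x + m * log (1 + θ) := by
      rw [Real.log_mul (by linarith) (by positivity), Real.log_pow]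
    have e6 : log (x * (1 + θ) ^ 0) = log x := by simp
    rw [e5] at e4
    rw [e6] at e3
    rw [abs_le] at *
    change -1 ≤ log (N 0) - _ ∧ log (N 0) - _ ≤ 1 at e3
    change -1 ≤ log (N m) - _ ∧ log (N m) - _ ≤ 1 at e4
    constructor <;> linarith [e1.1, e1.2, e2.1, e2.2, e3.1, e3.2, e4.1, e4.2]
  have hl1 : log (1 + θ) ≤ θ := by linarith [Real.log_le_sub_one_of_pos (show 0 < 1 + θ by linarith)]
  have hl2 : θ / (1 + θ) ≤ log (1 + θ) := by
    have := Real.one_sub_inv_le_log_of_pos (show 0 < 1 + θ by linarith)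
    refine le_trans (le_of_eq ?_) this
    field_simp; ring
  obtain ⟨t1, t2⟩ := abs_le.mp hTm
  set C5 := 2 * C0 + 2 with hC5
  have hmθ : 0 < m * θ := by positivity
  have hq : 2 * C5 / (m * θ) * (m * θ) = 2 * C5 := div_mul_cancel₀ _ hmθ.ne'
  have hq0 : 0 ≤ 2 * C5 / (m * θ) := by positivity
  set Q := 2 * C5 / (m * θ) with hQ
  rw [abs_le]
  constructor
  · have k1 : m * (θ / (1 + θ)) ≤ m * log (1 + θ) := by gcongr
    have k2 : θ * (1 - θ) ≤ θ / (1 + θ) := by rw [le_div_iff₀ (by linarith)]; nlinarith [pow_pos hθ 3]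
    have k3 : m * (θ * (1 - θ)) ≤ m * (θ / (1 + θ)) := by gcongr
    have k4 : m * θ * (1 - θ) ≤ m * θ * (c + D + Q) := by
      have e1 : m * θ * (c + D + Q) = m * (θ * (c + D)) + Q * (m * θ) := by ring
      rw [e1, hq, mul_assoc]
      linarith
    have := le_of_mul_le_mul_left k4 hmθ
    linarith
  · have k1 : m * log (1 + θ) ≤ m * θ := by gcongr
    have k2 : m * (θ * (c - D) / (1 + θ)) ≤ m * θ + C5 := by linarith
    rw [mul_div_assoc', div_le_iff₀ (by linarith)] at k2
    have k3 : m * θ * (c - D) ≤ m * θ * (1 + θ + Q) := by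
      have e1 : m * θ * (1 + θ + Q) = m * θ * (1 + θ) + Q * (m * θ) := by ring
      rw [e1, hq]
      nlinarith
    have := le_of_mul_le_mul_left k3 hmθ
    linarith

lemma sum_rI_div_interval_le : ∃ g : ℕ, ∃ C : ℝ, 0 < C ∧ ∀ w : ℕ, 2 ≤ w → ∀ X R : ℝ, 0 ≤ R →
    (w:ℝ) ^ g ≤ X → ∑ n ∈ Ioc ⌊X⌋₊ ⌊X * exp R⌋₊, rI w n / (n:ℝ) ≤ C * (R + 1) / log w := by
  obtain ⟨g, C, hC, hg, h⟩ := rough_count_le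
  refine ⟨g, 2 * C, by linarith, fun w hw X R hR hX => ?_⟩
  have hw1 : (1:ℝ) < w := by exact_mod_cast hw
  have hlw : 0 < log (w:ℝ) := Real.log_pos hw1
  have hX1 : 1 ≤ X := le_trans (one_le_pow₀ hw1.le) hX
  set N : ℕ → ℕ := fun i => ⌊X * 2 ^ i⌋₊ with hN
  have hxi : ∀ i, X ≤ X * 2 ^ i := fun i => by
    have : (1:ℝ) ≤ 2 ^ i := one_le_pow₀ (by norm_num)
    nlinarith
  have hmono : Monotone N := monotone_nat_of_le_succ fun i => Nat.floor_mono (by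
    rw [pow_succ]
    have := hxi i
    nlinarith)
  set j := ⌈R / log 2⌉₊ with hj
  have hl2 := Real.log_two_gt_d9
  have hjR : R ≤ j * log 2 := by
    rw [← div_le_iff₀ (by linarith)]; exact Nat.le_ceil _
  have hjle : (j:ℝ) ≤ 2 * (R + 1) := by
    have h1 := Nat.ceil_lt_add_one (a := R / log 2) (by positivity)
    have h2 : R / log 2 ≤ 2 * R := by rw [div_le_iff₀ (by linarith)]; nlinarith
    linarith
  have hexp : exp R ≤ 2 ^ j := by
    calc exp R ≤ exp (j * log 2) := Real.exp_le_exp.mpr hjR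
      _ = 2 ^ j := by rw [Real.exp_nat_mul, Real.exp_log (by norm_num)]
  have hnn : ∀ n : ℕ, 0 ≤ rI w n / (n:ℝ) := fun n => by have := rI_nonneg w n; positivity
  have h1 : ∑ n ∈ Ioc ⌊X⌋₊ ⌊X * exp R⌋₊, rI w n / (n:ℝ) ≤ ∑ n ∈ Ioc (N 0) (N j), rI w n / (n:ℝ) := by
    have : N 0 = ⌊X⌋₊ := by simp [hN]
    rw [this]
    exact sum_le_sum_of_subset_of_nonneg (Ioc_subset_Ioc_right (Nat.floor_mono (by gcongr)))
      fun n _ _ => hnn n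
  refine h1.trans ?_
  rw [← sum_Ioc_telescope hmono (fun n => rI w n / (n:ℝ)) j]
  have h2 : ∀ i ∈ range j, ∑ n ∈ Ioc (N i) (N (i + 1)), rI w n / (n:ℝ) ≤ C / log w := by
    intro i _
    have hY := hxi i
    have hx0 : 0 < X * 2 ^ i := by linarith
    have := h w hw (X * 2 ^ i) (X * 2 ^ i) hx0.le (hX.trans hY)
    have e : ⌊X * 2 ^ i + X * 2 ^ i⌋₊ = N (i + 1) := by rw [hN]; congr 1; ring
    rw [e] at this
    calc _ ≤ ∑ n ∈ Ioc (N i) (N (i + 1)), rI w n / (X * 2 ^ i) := by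
          refine sum_le_sum fun n hn => ?_
          have := Nat.lt_of_floor_lt (mem_Ioc.mp hn).1
          have hv := rI_nonneg w n
          gcongr
      _ = (∑ n ∈ Ioc (N i) (N (i + 1)), rI w n) / (X * 2 ^ i) := by rw [sum_div]
      _ ≤ C * (X * 2 ^ i) / log w / (X * 2 ^ i) := by gcongr
      _ = _ := by field_simp
  refine (sum_le_sum h2).trans ?_
  rw [sum_const, card_range, nsmul_eq_mul, mul_div_assoc', div_le_div_iff_of_pos_right hlw]
  nlinarith

end Hoh

namespace Hoh
open Finset Real MeasureTheory
open ArithmeticFunction (vonMangoldt vonMangoldt_nonneg vonMangoldt_le_log)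

set_option maxHeartbeats 1000000 in
lemma mainCoeff_sub_le : ∃ C : ℝ, 1 ≤ C ∧ ∃ K0 : ℕ, ∀ (x y η x' R : ℝ) (z K : ℕ), K0 ≤ K →
    Setup x y η z K → 0 ≤ R → x ≤ x' → x' ≤ x * exp R →
    |mainCoeff x' z (z ^ (4 * K + 13)) - mainCoeff x z (z ^ (4 * K + 13))| ≤
      C * (R / (η * log z) + (R + 1) * (K * log z + R) / log z ^ 2) := by
  obtain ⟨g, C1, hC1, hintg⟩ := sum_rI_div_interval_le
  obtain ⟨C3, hC3, hrI⟩ := sum_rI_div_le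
  refine ⟨2 * C3 + 7 * C1 + 1, by linarith, g, fun x y η x' R z K hK h hR hx hx' => ?_⟩
  have hx0 := h.x_pos
  have hη := h.η_pos
  have hz2 := h.two_le_z
  have hzr := h.z_ge
  have hlz := h.log_z_ge
  have hA1 := h.one_le_A
  have hzA1 := h.z_le_A
  have hVL := h.V_mul_le
  have hlA := h.log_A_le
  have hpow := h.pow_le
  have hzgA : (z:ℝ) ^ g ≤ ((z ^ (4 * K + 13) : ℕ) : ℝ) := by
    push_cast
    exact pow_le_pow_right₀ (by linarith) (by omega)
  set A := z ^ (4 * K + 13) with hA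
  have hA0 : (0:ℝ) < A := by exact_mod_cast hA1
  have hA1' : (1:ℝ) ≤ A := by exact_mod_cast hA1
  have hlA0 : 0 ≤ log (A:ℝ) := Real.log_natCast_nonneg A
  have hV := V_pos z
  have hV1 : V z ≤ 1 / log z := by
    rw [le_div_iff₀ (by linarith)]; exact V_mul_log_le z (by omega)
  have hx'0 : 0 < x' := by linarith
  have hlx' : log (x' / x) ≤ R := by
    rw [Real.log_le_iff_le_exp (by positivity), div_le_iff₀ hx0]; linarith
  have hlx'0 : 0 ≤ log (x' / x) := Real.log_nonneg (by rw [le_div_iff₀ hx0]; linarith)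
  have hBB : ⌊x⌋₊ / A ≤ ⌊x'⌋₊ / A := Nat.div_le_div_right (Nat.floor_mono hx)
  set f : ℕ → ℝ := fun b => rI z b * ArithmeticFunction.moebius b / b with hf
  have hfle : ∀ b, |f b| ≤ rI z b / b := by
    intro b
    have := abs_moebius_le b
    have hr := rI_nonneg z b
    rw [hf, abs_div, abs_mul, abs_of_nonneg hr, Nat.abs_cast]
    calc _ ≤ rI z b * 1 / b := by gcongr
      _ = _ := by rw [mul_one]
  have hnn : ∀ b : ℕ, 0 ≤ rI z b / (b:ℝ) := fun b => by have := rI_nonneg z b; positivity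
  have e : mainCoeff x' z A - mainCoeff x z A = V z * (log (x' / x) * ∑ b ∈ Ioc 0 (⌊x⌋₊ / A), f b +
      ∑ b ∈ Ioc (⌊x⌋₊ / A) (⌊x'⌋₊ / A), f b * log (x' / b)) := by
    rw [mainCoeff, mainCoeff, ← mul_sub, ← sum_Ioc_consecutive _ (Nat.zero_le _) hBB,
      add_sub_right_comm, ← sum_sub_distrib, mul_sum]
    congr 2
    refine sum_congr rfl fun b hb => ?_
    have hb0 : (b:ℝ) ≠ 0 := by
      have := (mem_Ioc.mp hb).1
      positivity
    rw [Real.log_div hx'0.ne' hb0, Real.log_div hx0.ne' hb0, Real.log_div hx'0.ne' hx0.ne']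
    ring
  have s1 : |∑ b ∈ Ioc 0 (⌊x⌋₊ / A), f b| ≤ 2 * C3 / η := by
    refine (abs_sum_le_sum_abs _ _).trans ((sum_le_sum fun b _ => hfle b).trans ?_)
    calc _ ≤ ∑ b ∈ Ioc 0 ⌊x⌋₊, rI z b / (b:ℝ) :=
          sum_le_sum_of_subset_of_nonneg (Ioc_subset_Ioc_right (Nat.div_le_self _ _)) fun b _ _ => hnn b
      _ ≤ C3 * V z * log x := hrI z hz2 x h.z_le_x
      _ = C3 * (V z * log x) := by ring
      _ ≤ C3 * (2 / η) := by gcongr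
      _ = _ := by ring
  have s2 : |∑ b ∈ Ioc (⌊x⌋₊ / A) (⌊x'⌋₊ / A), f b * log (x' / b)| ≤
      C1 * (R + 1) / log z * (7 * (K * log z + R)) := by
    have hp : ∀ b ∈ Ioc (⌊x⌋₊ / A) (⌊x'⌋₊ / A), |f b * log (x' / b)| ≤
        rI z b / b * (7 * (K * log z + R)) := by
      intro b hb
      rw [← Nat.floor_div_natCast, ← Nat.floor_div_natCast, mem_Ioc] at hb
      have hb1 : x / A < b := Nat.lt_of_floor_lt hb.1
      have hb2 : (b:ℝ) ≤ x' / A := (Nat.le_floor_iff (by positivity)).mp hb.2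
      have hb0 : (0:ℝ) < b := lt_trans (by positivity) hb1
      have l0 : 0 ≤ log (x' / b) := Real.log_nonneg (by
        rw [le_div_iff₀ hb0, one_mul]
        exact hb2.trans (div_le_self hx'0.le hA1'))
      have l1 : log (x' / b) ≤ log A + R := by
        rw [Real.log_le_iff_le_exp (by positivity), Real.exp_add, Real.exp_log hA0,
          div_le_iff₀ hb0]
        rw [div_lt_iff₀ hA0] at hb1
        calc x' ≤ x * exp R := hx'
          _ ≤ (b * A) * exp R := by gcongr
          _ = _ := by ring
      rw [abs_mul, abs_of_nonneg l0]
      have := hnn b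
      gcongr
      · exact hfle b
      · linarith
    refine (abs_sum_le_sum_abs _ _).trans ((sum_le_sum hp).trans ?_)
    rw [← sum_mul]
    have hq : ∑ b ∈ Ioc (⌊x⌋₊ / A) (⌊x'⌋₊ / A), rI z b / (b:ℝ) ≤ C1 * (R + 1) / log z := by
      rw [← Nat.floor_div_natCast, ← Nat.floor_div_natCast]
      have hg : (z:ℝ) ^ g ≤ x / A := by
        rw [le_div_iff₀ hA0]
        refine le_trans ?_ hpow
        calc (z:ℝ) ^ g * A ≤ A * A := by gcongr
          _ = (A:ℝ) ^ 2 := by ring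
          _ ≤ (A:ℝ) ^ 4 := pow_le_pow_right₀ hA1' (by norm_num)
      refine le_trans ?_ (hintg z hz2 (x / A) R hR hg)
      refine sum_le_sum_of_subset_of_nonneg (Ioc_subset_Ioc_right (Nat.floor_mono ?_)) fun b _ _ => hnn b
      rw [div_mul_eq_mul_div]
      gcongr
    gcongr
  rw [e, abs_mul, abs_of_pos hV]
  have hlz0 : 0 < log (z:ℝ) := by linarith
  calc _ ≤ 1 / log z * (R * (2 * C3 / η) + C1 * (R + 1) / log z * (7 * (K * log z + R))) := by
        gcongr
        refine (abs_add_le _ _).trans ?_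
        rw [abs_mul, abs_of_nonneg hlx'0]
        gcongr
    _ = 2 * C3 * (R / (η * log z)) + 7 * C1 * ((R + 1) * (K * log z + R) / log z ^ 2) := by
        field_simp
    _ ≤ _ := by
        have p1 : 0 ≤ R / (η * log z) := by positivity
        have p2 : 0 ≤ (R + 1) * (K * log z + R) / log z ^ 2 := by positivity
        nlinarith

end Hoh

namespace Hoh
open Finset Real MeasureTheory
open ArithmeticFunction (vonMangoldt vonMangoldt_nonneg vonMangoldt_le_log)

/-- The sifting level attached to `x` and `K`. -/
noncomputable def level (x : ℝ) (K : ℕ) : ℕ := ⌊exp (log x / (K:ℝ) ^ 50)⌋₊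

lemma pow_150_le {K : ℕ} (hK : 6 ≤ K) {L : ℝ} (hL : (K:ℝ) ^ 200 ≤ L) :
    (K:ℝ) ^ 150 ≤ L / (K:ℝ) ^ 50 := by
  have hK0 : (0:ℝ) < K := by positivity
  rw [le_div_iff₀ (by positivity), ← pow_add]; exact hL

lemma big_pow {K : ℕ} (hK : 6 ≤ K) {n : ℕ} (hn : n ≠ 0) : (K:ℝ) ≤ (K:ℝ) ^ n := by
  have : (6:ℝ) ≤ K := by exact_mod_cast hK
  exact le_self_pow₀ (by linarith) hn

lemma level_bounds {K : ℕ} (hK : 6 ≤ K) {x : ℝ} (hL : (K:ℝ) ^ 200 ≤ log x) :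
    exp (log x / (K:ℝ) ^ 50 - 1) ≤ level x K ∧ (level x K : ℝ) ≤ exp (log x / (K:ℝ) ^ 50) := by
  have h1 := pow_150_le hK hL
  have h2 := big_pow hK (show 150 ≠ 0 by norm_num)
  have h3 : (6:ℝ) ≤ K := by exact_mod_cast hK
  set l := log x / (K:ℝ) ^ 50
  refine ⟨?_, Nat.floor_le (Real.exp_pos _).le⟩
  have h4 := Nat.lt_floor_add_one (exp l)
  have h5 : exp l = exp (l - 1) * exp 1 := by rw [← Real.exp_add]; congr 1; ring
  have h6 := Real.exp_one_gt_d9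
  have h7 := Real.add_one_le_exp (l - 1)
  change exp (l - 1) ≤ (⌊exp l⌋₊ : ℝ)
  nlinarith

lemma log_level_bounds {K : ℕ} (hK : 6 ≤ K) {x : ℝ} (hL : (K:ℝ) ^ 200 ≤ log x) :
    log x / (K:ℝ) ^ 50 - 1 ≤ log (level x K) ∧ log (level x K) ≤ log x / (K:ℝ) ^ 50 := by
  obtain ⟨h1, h2⟩ := level_bounds hK hL
  have h0 : (0:ℝ) < level x K := lt_of_lt_of_le (Real.exp_pos _) h1
  exact ⟨(Real.le_log_iff_exp_le h0).mpr h1, (Real.log_le_iff_le_exp h0).mpr h2⟩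

lemma log_pow_le_exp_div_forty {K : ℕ} (hK : 6 ≤ K) {L : ℝ} (hL : (K:ℝ) ^ 200 ≤ L) :
    1000 * L ^ 7 ≤ exp (L / (K:ℝ) ^ 50 / 40) := by
  have hK6 : (6:ℝ) ≤ K := by exact_mod_cast hK
  have hK0 : (0:ℝ) < K := by linarith
  have hL2 : (2:ℝ) ^ 60 ≤ L := by
    refine le_trans ?_ hL
    calc (2:ℝ) ^ 60 ≤ 2 ^ 200 := by norm_num
      _ ≤ (K:ℝ) ^ 200 := by gcongr; linarith
  have hL0 : 0 < L := lt_of_lt_of_le (by norm_num) hL2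
  refine le_trans ?_ (Real.pow_div_factorial_le_exp (L / (K:ℝ) ^ 50 / 40) (by positivity) 12)
  rw [le_div_iff₀ (by positivity), div_pow, div_pow, ← pow_mul, le_div_iff₀ (by positivity),
    le_div_iff₀ (by positivity)]
  have h1 : (K:ℝ) ^ (50 * 12) ≤ L ^ 3 := by
    calc (K:ℝ) ^ (50 * 12) = ((K:ℝ) ^ 200) ^ 3 := by rw [← pow_mul]
      _ ≤ L ^ 3 := by gcongr
  have h2 : (1000 * (Nat.factorial 12 : ℝ) * 40 ^ 12) ≤ L ^ 2 := by
    calc (1000 * (Nat.factorial 12 : ℝ) * 40 ^ 12) ≤ ((2:ℝ) ^ 60) ^ 2 := by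
          norm_num [Nat.factorial]
      _ ≤ L ^ 2 := by gcongr
  calc 1000 * L ^ 7 * (Nat.factorial 12 : ℝ) * 40 ^ 12 * (K:ℝ) ^ (50 * 12)
      = (1000 * (Nat.factorial 12 : ℝ) * 40 ^ 12) * L ^ 7 * (K:ℝ) ^ (50 * 12) := by ring
    _ ≤ L ^ 2 * L ^ 7 * L ^ 3 := by gcongr
    _ = L ^ 12 := by ring

lemma log_pow_le_exp {K : ℕ} (hK : 6 ≤ K) {L : ℝ} (hL : (K:ℝ) ^ 200 ≤ L) :
    1000 * L ^ 7 ≤ exp (L / (K:ℝ) ^ 50 / 8) := by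
  have h0 : 0 ≤ L / (K:ℝ) ^ 50 := le_trans (by positivity) (pow_150_le hK hL)
  exact (log_pow_le_exp_div_forty hK hL).trans (Real.exp_le_exp.mpr (by linarith))

lemma setup_level : ∃ K0 : ℕ, 6 ≤ K0 ∧ ∀ K : ℕ, K0 ≤ K → ∀ x : ℝ, (K:ℝ) ^ 200 ≤ log x →
    ∀ x' y : ℝ, 1 ≤ x → x ≤ x' → log x' ≤ log x + 2 * (K:ℝ) ^ 50 → 0 < y → y * log x' ^ 2 ≤ x' →
    7 * (x' / y) ^ 2 * log x' ^ 3 ≤ (level x K : ℝ) ^ (1/4:ℝ) →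
    Setup x' y (1 / (K:ℝ) ^ 50) (level x K) K := by
  obtain ⟨K1, hK1⟩ := exists_nat_pow_mul_exp_le 50 (show (0:ℝ) < 1 / 2 by norm_num)
  refine ⟨max K1 6, le_max_right _ _, fun K hK x hL x' y hx1 hx hx' hy hy1 hy2 => ?_⟩
  have hK6 : 6 ≤ K := (le_max_right _ _).trans hK
  have hK6' : (6:ℝ) ≤ K := by exact_mod_cast hK6
  have hK0 : (0:ℝ) < K := by linarith
  obtain ⟨a1, a2⟩ := level_bounds hK6 hL
  obtain ⟨b1, b2⟩ := log_level_bounds hK6 hL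
  have c1 := pow_150_le hK6 hL
  have c2 : (K:ℝ) + 1 ≤ (K:ℝ) ^ 150 := by
    calc (K:ℝ) + 1 ≤ (K:ℝ) ^ 2 := by nlinarith
      _ ≤ (K:ℝ) ^ 150 := pow_le_pow_right₀ (by linarith) (by norm_num)
  have hP : (0:ℝ) < (K:ℝ) ^ 50 := by positivity
  have hP1 : (1:ℝ) ≤ (K:ℝ) ^ 50 := one_le_pow₀ (by linarith)
  have hlx : log x ≤ log x' := Real.log_le_log (by linarith) hx
  have hPe : 1 / (K:ℝ) ^ 50 * log x = log x / (K:ℝ) ^ 50 := by ring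
  set l := log x / (K:ℝ) ^ 50 with hl
  refine ⟨by positivity, ?_, by omega, ?_, ?_, ?_, ?_, ?_, hy, hy1, hy2⟩
  · rw [div_le_one hP]; exact hP1
  · exact le_trans (Real.exp_le_exp.mpr (by linarith)) a1
  · calc 1 / (K:ℝ) ^ 50 * log x' ≤ 1 / (K:ℝ) ^ 50 * (log x + 2 * (K:ℝ) ^ 50) := by gcongr
      _ = l + 2 := by rw [hl]; field_simp
      _ ≤ _ := by linarith
  · calc log (level x K) ≤ 1 / (K:ℝ) ^ 50 * log x := by rw [hPe]; exact b2
      _ ≤ 1 / (K:ℝ) ^ 50 * log x' := by gcongr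
      _ ≤ _ := by
        have : 0 ≤ 1 / (K:ℝ) ^ 50 * log x' := by
          have : 0 ≤ log x' := le_trans (Real.log_nonneg hx1) hlx
          positivity
        linarith
  · have h1 := hK1 K ((le_max_left _ _).trans hK)
    rw [neg_div, Real.exp_neg, ← div_eq_mul_inv, div_le_iff₀ (Real.exp_pos _)] at h1
    have h2 : exp ((K:ℝ) / 4) ≤ exp ((K:ℝ) / 2) := Real.exp_le_exp.mpr (by linarith)
    rw [div_div_eq_mul_div, div_one]
    linarith
  · push_cast
    rw [← pow_mul]
    calc (level x K : ℝ) ^ ((4 * K + 13) * 4) ≤ exp l ^ ((4 * K + 13) * 4) := by gcongr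
      _ = exp (((4 * K + 13) * 4 : ℕ) * l) := by rw [Real.exp_nat_mul]
      _ ≤ exp (log x) := by
          refine Real.exp_le_exp.mpr ?_
          have e : log x = (K:ℝ) ^ 50 * l := by rw [hl]; field_simp
          rw [e]
          have hl0 : 0 ≤ l := by linarith
          gcongr
          push_cast
          calc (4 * (K:ℝ) + 13) * 4 ≤ (K:ℝ) ^ 3 := by
                  have h36 : 36 ≤ (K:ℝ) ^ 2 := by nlinarith
                  nlinarith [mul_le_mul_of_nonneg_right h36 hK0.le]
            _ ≤ (K:ℝ) ^ 50 := pow_le_pow_right₀ (by linarith) (by norm_num)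
      _ = x := Real.exp_log (by linarith)
      _ ≤ x' := hx

lemma error_terms_le : ∃ K0 : ℕ, 6 ≤ K0 ∧ ∀ K : ℕ, K0 ≤ K → ∀ l : ℝ, (K:ℝ) ^ 200 ≤ l →
    (K:ℝ) ^ 11 * √(1 / (K:ℝ) ^ 50) + exp (-(K:ℝ)) / (1 / (K:ℝ) ^ 50) ^ 2 + 1 / l ≤ 3 / (K:ℝ) ^ 10 := by
  obtain ⟨K1, hK1⟩ := exists_nat_pow_mul_exp_le 110 (show (0:ℝ) < 1 by norm_num)
  refine ⟨max K1 6, le_max_right _ _, fun K hK l hl => ?_⟩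
  have hK6 : (6:ℝ) ≤ K := by exact_mod_cast (le_max_right _ _).trans hK
  have hK0 : (0:ℝ) < K := by linarith
  have hK1' : (1:ℝ) ≤ K := by linarith
  have e1 : (K:ℝ) ^ 11 * √(1 / (K:ℝ) ^ 50) ≤ 1 / (K:ℝ) ^ 10 := by
    have : √(1 / (K:ℝ) ^ 50) = 1 / (K:ℝ) ^ 25 := by
      rw [show 1 / (K:ℝ) ^ 50 = (1 / (K:ℝ) ^ 25) ^ 2 by rw [div_pow, ← pow_mul]; norm_num]
      exact Real.sqrt_sq (by positivity)
    rw [this, mul_one_div, div_le_div_iff₀ (by positivity) (by positivity), ← pow_add, one_mul]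
    exact pow_le_pow_right₀ hK1' (by norm_num)
  have e2 : exp (-(K:ℝ)) / (1 / (K:ℝ) ^ 50) ^ 2 ≤ 1 / (K:ℝ) ^ 10 := by
    rw [le_div_iff₀ (by positivity), one_div, inv_pow, div_inv_eq_mul, ← pow_mul, mul_assoc, ← pow_add]
    refine le_trans ?_ (hK1 K ((le_max_left _ _).trans hK))
    rw [mul_comm]
    gcongr
    linarith
  have e3 : 1 / l ≤ 1 / (K:ℝ) ^ 10 := by
    refine one_div_le_one_div_of_le (by positivity) (le_trans ?_ hl)
    exact pow_le_pow_right₀ hK1' (by norm_num)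
  calc _ ≤ 1 / (K:ℝ) ^ 10 + 1 / (K:ℝ) ^ 10 + 1 / (K:ℝ) ^ 10 := by gcongr
    _ = _ := by ring

lemma variation_terms_le {K : ℕ} (hK : 6 ≤ K) {Z : ℝ} (hZ : (K:ℝ) ^ 150 ≤ 2 * Z) :
    2 * (K:ℝ) ^ 50 / (1 / (K:ℝ) ^ 50 * Z) + (2 * (K:ℝ) ^ 50 + 1) * (K * Z + 2 * (K:ℝ) ^ 50) / Z ^ 2 ≤
      16 / (K:ℝ) ^ 10 := by
  have hK6 : (6:ℝ) ≤ K := by exact_mod_cast hK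
  have hK0 : (0:ℝ) < K := by linarith
  have hK1 : (1:ℝ) ≤ K := by linarith
  have hZ0 : 0 < Z := by
    have : 0 < (K:ℝ) ^ 150 := by positivity
    linarith
  have hP : (1:ℝ) ≤ (K:ℝ) ^ 50 := one_le_pow₀ hK1
  have q : ∀ n, n ≤ 140 → (K:ℝ) ^ n / Z ≤ 2 / (K:ℝ) ^ 10 := by
    intro n hn
    rw [div_le_div_iff₀ hZ0 (by positivity), ← pow_add]
    exact (pow_le_pow_right₀ hK1 (by omega)).trans hZ
  have e1 : 2 * (K:ℝ) ^ 50 / (1 / (K:ℝ) ^ 50 * Z) = 2 * ((K:ℝ) ^ 100 / Z) := by field_simp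
  have e2 : (2 * (K:ℝ) ^ 50 + 1) * (K * Z + 2 * (K:ℝ) ^ 50) / Z ^ 2 ≤ 6 * ((K:ℝ) ^ 51 / Z) := by
    have h1 : 2 * (K:ℝ) ^ 50 ≤ K * Z := by
      have h2 : (K:ℝ) ^ 50 * 4 ≤ K * (K:ℝ) ^ 150 := by
        have h3 : (K:ℝ) ^ 50 ≤ (K:ℝ) ^ 150 := pow_le_pow_right₀ hK1 (by norm_num)
        have h4 : 0 < (K:ℝ) ^ 50 := by positivity
        nlinarith
      nlinarith
    calc _ ≤ (3 * (K:ℝ) ^ 50) * (K * Z + K * Z) / Z ^ 2 := by gcongr; linarith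
      _ = _ := by field_simp; ring
  rw [e1]
  have q1 := q 100 (by norm_num)
  have q2 := q 51 (by norm_num)
  calc _ ≤ 2 * (2 / (K:ℝ) ^ 10) + 6 * (2 / (K:ℝ) ^ 10) := by linarith
    _ = _ := by ring

end Hoh

namespace Hoh
open Finset Real MeasureTheory
open ArithmeticFunction (vonMangoldt vonMangoldt_nonneg vonMangoldt_le_log)

set_option maxHeartbeats 1000000 in
lemma mainCoeff_near_one : ∃ C : ℝ, 1 ≤ C ∧ ∃ K0 : ℕ, 6 ≤ K0 ∧ ∀ K : ℕ, K0 ≤ K → ∀ x : ℝ, 1 ≤ x →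
    (K:ℝ) ^ 200 ≤ log x →
    |mainCoeff x (level x K) (level x K ^ (4 * K + 13)) - 1| ≤ C / (K:ℝ) ^ 10 := by
  obtain ⟨C1, hC1, K1, h1⟩ := short_interval
  obtain ⟨C2, hC2, K2, h2⟩ := mainCoeff_sub_le
  obtain ⟨C3, hC3, h3⟩ := abs_density_sub_one_le
  obtain ⟨K4, hK4, h4⟩ := setup_level
  obtain ⟨K5, hK5, h5⟩ := error_terms_le
  refine ⟨3 * C1 + 16 * C2 + 1 + C3, by linarith, max (max K1 K2) (max K4 K5),
    hK4.trans ((le_max_left _ _).trans (le_max_right _ _)), fun K hK x hx1 hL => ?_⟩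
  have hKK1 : K1 ≤ K := by omega
  have hKK2 : K2 ≤ K := by omega
  have hKK4 : K4 ≤ K := by omega
  have hKK5 : K5 ≤ K := by omega
  have hK6 : 6 ≤ K := hK4.trans hKK4
  have hK6' : (6:ℝ) ≤ K := by exact_mod_cast hK6
  have hK1' : (1:ℝ) ≤ K := by linarith
  have hK0 : (0:ℝ) < K := by linarith
  obtain ⟨b1, b2⟩ := log_level_bounds hK6 hL
  obtain ⟨a1, a2⟩ := level_bounds hK6 hL
  have c1 := pow_150_le hK6 hL
  have hexp := log_pow_le_exp hK6 hL
  have hset := h4 K hKK4 x hL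
  set z := level x K with hz
  set L := log x with hLd
  have hP1 : (1:ℝ) ≤ (K:ℝ) ^ 50 := one_le_pow₀ hK1'
  have hP2 : (K:ℝ) ^ 50 * 2 ≤ L := by
    refine le_trans ?_ hL
    have : (K:ℝ) ^ 200 = (K:ℝ) ^ 50 * (K:ℝ) ^ 150 := by rw [← pow_add]
    rw [this]
    have := big_pow hK6 (show 150 ≠ 0 by norm_num)
    gcongr
    linarith
  have hL2 : 2 ≤ L := by linarith
  have h150 : (6:ℝ) ≤ (K:ℝ) ^ 150 := hK6'.trans (big_pow hK6 (by norm_num))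
  set θ : ℝ := 1 / (4 * L ^ 2) with hθ
  have hθ0 : 0 < θ := by positivity
  have hθL : θ ≤ 1 / L := by
    rw [hθ]
    refine one_div_le_one_div_of_le (by linarith) ?_
    nlinarith
  have hθ1 : θ ≤ 1 := hθL.trans (by rw [div_le_one (by linarith)]; linarith)
  set m := ⌈(K:ℝ) ^ 50 / θ⌉₊ with hm
  have hm1 : (K:ℝ) ^ 50 ≤ m * θ := by
    rw [← div_le_iff₀ hθ0]; exact Nat.le_ceil _
  have hm2 : m * θ ≤ 2 * (K:ℝ) ^ 50 := by
    have := Nat.ceil_lt_add_one (a := (K:ℝ) ^ 50 / θ) (by positivity)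
    have h' : (m:ℝ) * θ ≤ ((K:ℝ) ^ 50 / θ + 1) * θ := by gcongr
    rw [add_mul, div_mul_cancel₀ _ hθ0.ne'] at h'
    linarith
  have hm0 : 1 ≤ m := by
    rw [hm]; exact Nat.one_le_ceil_iff.mpr (by positivity)
  have hz14 : exp (L / (K:ℝ) ^ 50 / 8) ≤ (z:ℝ) ^ (1/4:ℝ) := by
    calc exp (L / (K:ℝ) ^ 50 / 8) ≤ exp ((L / (K:ℝ) ^ 50 - 1) * (1/4:ℝ)) :=
          Real.exp_le_exp.mpr (by linarith)
      _ = exp (L / (K:ℝ) ^ 50 - 1) ^ (1/4:ℝ) := Real.exp_mul _ _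
      _ ≤ _ := Real.rpow_le_rpow (Real.exp_pos _).le a1 (by norm_num)
  have hx0 : 0 < x := by linarith
  have hxi : ∀ i ≤ m, x ≤ x * (1 + θ) ^ i ∧ x * (1 + θ) ^ i ≤ x * exp (2 * (K:ℝ) ^ 50) := by
    intro i hi
    constructor
    · have : 1 ≤ (1 + θ) ^ i := one_le_pow₀ (by linarith)
      nlinarith
    · gcongr
      calc (1 + θ) ^ i ≤ exp θ ^ i := by
            gcongr
            linarith [Real.add_one_le_exp θ]
        _ = exp (i * θ) := by rw [Real.exp_nat_mul]
        _ ≤ exp (2 * (K:ℝ) ^ 50) := by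
            refine Real.exp_le_exp.mpr (le_trans ?_ hm2)
            gcongr
  have hsi : ∀ i ≤ m, Setup (x * (1 + θ) ^ i) (θ * (x * (1 + θ) ^ i)) (1 / (K:ℝ) ^ 50) z K := by
    intro i hi
    obtain ⟨g1, g2⟩ := hxi i hi
    set X := x * (1 + θ) ^ i with hX
    have hX0 : 0 < X := by linarith
    have hlX : log X ≤ L + 2 * (K:ℝ) ^ 50 := by
      rw [Real.log_le_iff_le_exp hX0, Real.exp_add, Real.exp_log hx0]
      exact g2
    have hlX2 : log X ≤ 2 * L := by linarith
    have hlX0 : 0 ≤ log X := Real.log_nonneg (by linarith)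
    refine hset X (θ * X) hx1 g1 hlX (by positivity) ?_ ?_
    · calc θ * X * log X ^ 2 ≤ θ * X * (2 * L) ^ 2 := by gcongr
        _ = X := by rw [hθ]; field_simp; norm_num
    · refine le_trans ?_ hz14
      refine le_trans ?_ hexp
      have e : X / (θ * X) = 4 * L ^ 2 := by rw [hθ]; field_simp
      rw [e]
      calc 7 * (4 * L ^ 2) ^ 2 * log X ^ 3 ≤ 7 * (4 * L ^ 2) ^ 2 * (2 * L) ^ 3 := by gcongr
        _ = 896 * L ^ 7 := by ring
        _ ≤ 1000 * L ^ 7 := by gcongr; norm_num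
  have hs0 := hsi 0 (Nat.zero_le _)
  rw [pow_zero, mul_one] at hs0
  have hvar := variation_terms_le hK6 (Z := log z) (by linarith)
  have hmain := h3 x θ (mainCoeff x z (z ^ (4 * K + 13))) (C1 * (3 / (K:ℝ) ^ 10) + C2 * (16 / (K:ℝ) ^ 10))
    m hx1 hθ0 hθ1 hm0 (by positivity) (by
      intro i hi
      obtain ⟨g1, g2⟩ := hxi i hi.le
      have k1 := h1 _ _ _ z K hKK1 (hsi i hi.le)
      have k2 := h2 _ _ _ (x * (1 + θ) ^ i) (2 * (K:ℝ) ^ 50) z K hKK2 hs0 (by positivity) g1 g2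
      set X := x * (1 + θ) ^ i with hX
      have hX0 : 0 < X := by linarith
      have k3 := h5 K hKK5 (log X) (hL.trans (Real.log_le_log hx0 g1))
      have k2' := k2.trans (mul_le_mul_of_nonneg_left hvar (by linarith))
      have k1' : _ ≤ C1 * (θ * X) * (3 / (K:ℝ) ^ 10) := k1.trans (by gcongr)
      have e : ∑ n ∈ Ioc ⌊X⌋₊ ⌊X + θ * X⌋₊, vonMangoldt n - θ * X * mainCoeff x z (z ^ (4 * K + 13)) =
          (∑ n ∈ Ioc ⌊X⌋₊ ⌊X + θ * X⌋₊, vonMangoldt n - θ * X * mainCoeff X z (z ^ (4 * K + 13))) +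
          θ * X * (mainCoeff X z (z ^ (4 * K + 13)) - mainCoeff x z (z ^ (4 * K + 13))) := by ring
      rw [e]
      refine (abs_add_le _ _).trans ?_
      rw [abs_mul, abs_of_pos (by positivity : 0 < θ * X)]
      calc _ ≤ C1 * (θ * X) * (3 / (K:ℝ) ^ 10) + θ * X * (C2 * (16 / (K:ℝ) ^ 10)) := by gcongr
        _ = _ := by ring)
  refine hmain.trans ?_
  have q1 : θ ≤ 1 / (K:ℝ) ^ 10 := by
    refine hθL.trans (one_div_le_one_div_of_le (by positivity) (le_trans ?_ hL))
    exact pow_le_pow_right₀ hK1' (by norm_num)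
  have q2 : C3 / (m * θ) ≤ C3 / (K:ℝ) ^ 10 := by
    refine div_le_div_of_nonneg_left hC3.le (by positivity) (le_trans ?_ hm1)
    exact pow_le_pow_right₀ hK1' (by norm_num)
  calc _ ≤ C1 * (3 / (K:ℝ) ^ 10) + C2 * (16 / (K:ℝ) ^ 10) + 1 / (K:ℝ) ^ 10 + C3 / (K:ℝ) ^ 10 := by
        gcongr
    _ = _ := by ring

/-- The prime number theorem in intervals shorter than `x / log x ^ 2`. -/
lemma abs_sum_vonMangoldt_sub_le_of_short : ∃ C : ℝ, 1 ≤ C ∧ ∃ K0 : ℕ, 6 ≤ K0 ∧ ∀ K : ℕ, K0 ≤ K →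
    ∀ x y : ℝ, 1 ≤ x → (K:ℝ) ^ 200 ≤ log x → 0 < y → y * log x ^ 2 ≤ x →
    x ≤ y * exp (log x / (K:ℝ) ^ 50 / 20) →
    |∑ n ∈ Ioc ⌊x⌋₊ ⌊x + y⌋₊, vonMangoldt n - y| ≤ C / (K:ℝ) ^ 10 * y := by
  obtain ⟨C1, hC1, K1, h1⟩ := short_interval
  obtain ⟨C2, hC2, K2, hK2, h2⟩ := mainCoeff_near_one
  obtain ⟨K4, hK4, h4⟩ := setup_level
  obtain ⟨K5, hK5, h5⟩ := error_terms_le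
  refine ⟨3 * C1 + C2, by linarith, max (max K1 K2) (max K4 K5),
    hK4.trans ((le_max_left _ _).trans (le_max_right _ _)), fun K hK x y hx1 hL hy hy1 hy2 => ?_⟩
  have hKK1 : K1 ≤ K := by omega
  have hKK2 : K2 ≤ K := by omega
  have hKK4 : K4 ≤ K := by omega
  have hKK5 : K5 ≤ K := by omega
  have hK6 : 6 ≤ K := hK4.trans hKK4
  have hK6' : (6:ℝ) ≤ K := by exact_mod_cast hK6
  have hK0 : (0:ℝ) < K := by linarith
  have hx0 : 0 < x := by linarith
  obtain ⟨a1, a2⟩ := level_bounds hK6 hL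
  have c1 := pow_150_le hK6 hL
  have hexp := log_pow_le_exp hK6 hL
  have h150 : (6:ℝ) ≤ (K:ℝ) ^ 150 := hK6'.trans (big_pow hK6 (by norm_num))
  have hL1 : 1 ≤ log x := by
    have := big_pow hK6 (show 200 ≠ 0 by norm_num)
    linarith
  have hS : Setup x y (1 / (K:ℝ) ^ 50) (level x K) K := by
    refine h4 K hKK4 x hL x y hx1 le_rfl ?_ hy hy1 ?_
    · have : 0 ≤ (K:ℝ) ^ 50 := by positivity
      linarith
    set l := log x / (K:ℝ) ^ 50 with hl
    have k1 : x / y ≤ exp (l / 20) := by rw [div_le_iff₀ hy]; linarith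
    have k2 : 7 * log x ^ 3 ≤ exp (l / 8) := by
      refine le_trans ?_ hexp
      have : log x ^ 3 ≤ log x ^ 7 := pow_le_pow_right₀ hL1 (by norm_num)
      have h0 : 0 ≤ log x ^ 3 := by positivity
      nlinarith
    calc 7 * (x / y) ^ 2 * log x ^ 3 = (x / y) ^ 2 * (7 * log x ^ 3) := by ring
      _ ≤ exp (l / 20) ^ 2 * exp (l / 8) := by gcongr
      _ = exp (l / 10 + l / 8) := by
          rw [← Real.exp_nat_mul, ← Real.exp_add]; congr 1; push_cast; ring
      _ ≤ exp ((l - 1) * (1/4:ℝ)) := Real.exp_le_exp.mpr (by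
          have : (10:ℝ) ≤ (K:ℝ) ^ 150 := by
            calc (10:ℝ) ≤ (K:ℝ) ^ 2 := by nlinarith
              _ ≤ (K:ℝ) ^ 150 := pow_le_pow_right₀ (by linarith) (by norm_num)
          linarith)
      _ = exp (l - 1) ^ (1/4:ℝ) := Real.exp_mul _ _
      _ ≤ _ := Real.rpow_le_rpow (Real.exp_pos _).le a1 (by norm_num)
  have k1 := h1 x y _ _ K hKK1 hS
  have k2 := h2 K hKK2 x hx1 hL
  have k3 := h5 K hKK5 (log x) hL
  have k1' : _ ≤ C1 * y * (3 / (K:ℝ) ^ 10) := k1.trans (by gcongr)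
  have e : ∀ S c : ℝ, S - y = (S - y * c) + y * (c - 1) := fun S c => by ring
  rw [e _ (mainCoeff x (level x K) (level x K ^ (4 * K + 13)))]
  refine (abs_add_le _ _).trans ?_
  rw [abs_mul, abs_of_pos hy]
  calc _ ≤ C1 * y * (3 / (K:ℝ) ^ 10) + y * (C2 / (K:ℝ) ^ 10) := by gcongr
    _ = _ := by ring

end Hoh

namespace Hoh
open Finset Real MeasureTheory
open ArithmeticFunction (vonMangoldt vonMangoldt_nonneg vonMangoldt_le_log)

lemma abs_sum_sub_le_of_pieces {x y ε : ℝ} {k : ℕ} (hk : 1 ≤ k) (hy : 0 ≤ y) (f : ℕ → ℝ)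
    (h : ∀ i < k, |∑ n ∈ Ioc ⌊x + i * (y / k)⌋₊ ⌊x + i * (y / k) + y / k⌋₊, f n - y / k| ≤
      ε * (y / k)) :
    |∑ n ∈ Ioc ⌊x⌋₊ ⌊x + y⌋₊, f n - y| ≤ ε * y := by
  have hk0 : (0:ℝ) < k := by exact_mod_cast hk
  set N : ℕ → ℕ := fun i => ⌊x + i * (y / k)⌋₊ with hN
  have hmono : Monotone N := fun i j hij => Nat.floor_mono (by gcongr)
  have hstep : ∀ i : ℕ, ⌊x + i * (y / k) + y / k⌋₊ = N (i + 1) := fun i => by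
    rw [hN]; congr 1; push_cast; ring
  have e0 : N 0 = ⌊x⌋₊ := by simp [hN]
  have ek : N k = ⌊x + y⌋₊ := by
    rw [hN]; field_simp
  have hs : k • (y / k) = y := by rw [nsmul_eq_mul]; field_simp
  rw [← e0, ← ek, ← sum_Ioc_telescope hmono f k]
  have e1 : ∑ i ∈ range k, ∑ n ∈ Ioc (N i) (N (i + 1)), f n - y =
      ∑ i ∈ range k, (∑ n ∈ Ioc (N i) (N (i + 1)), f n - y / k) := by
    rw [sum_sub_distrib, sum_const, card_range, hs]
  rw [e1]
  refine (abs_sum_le_sum_abs _ _).trans ?_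
  calc _ ≤ ∑ i ∈ range k, ε * (y / k) := by
        refine sum_le_sum fun i hi => ?_
        have := h i (mem_range.mp hi)
        rwa [hstep] at this
    _ = ε * y := by rw [← mul_sum, sum_const, card_range, hs]

/-- The prime number theorem in short intervals, in terms of the parameter `K`. -/
lemma abs_sum_vonMangoldt_sub_le : ∃ C : ℝ, 1 ≤ C ∧ ∃ K0 : ℕ, 6 ≤ K0 ∧ ∀ K : ℕ, K0 ≤ K →
    ∀ x y : ℝ, 1 ≤ x → (K:ℝ) ^ 200 ≤ log x → 0 < y → y ≤ x →
    x ≤ y * exp (log x / (K:ℝ) ^ 50 / 40) →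
    |∑ n ∈ Ioc ⌊x⌋₊ ⌊x + y⌋₊, vonMangoldt n - y| ≤ C / (K:ℝ) ^ 10 * y := by
  obtain ⟨C, hC, K0, hK0, h⟩ := abs_sum_vonMangoldt_sub_le_of_short
  refine ⟨C, hC, K0, hK0, fun K hK x y hx hL hy hyx hy2 => ?_⟩
  have hK6 : 6 ≤ K := hK0.trans hK
  have hK6' : (6:ℝ) ≤ K := by exact_mod_cast hK6
  have hKp : (0:ℝ) < K := by linarith
  have hexp := log_pow_le_exp_div_forty hK6 hL
  have hL6 : 6 ≤ log x := by
    have := big_pow hK6 (show 200 ≠ 0 by norm_num)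
    linarith
  have hx0 : 0 < x := by linarith
  set L := log x with hLd
  set k := ⌈4 * L ^ 2⌉₊ with hk
  have hL36 : 36 ≤ L ^ 2 := by nlinarith
  have hk1 : 4 * L ^ 2 ≤ k := Nat.le_ceil _
  have hk2 : (k:ℝ) ≤ 5 * L ^ 2 := by
    have := Nat.ceil_lt_add_one (a := 4 * L ^ 2) (by positivity)
    linarith
  have hk0 : (0:ℝ) < k := by linarith
  refine abs_sum_sub_le_of_pieces (by exact_mod_cast hk0) hy.le _ fun i hi => ?_
  have hi' : (i:ℝ) ≤ k := by exact_mod_cast hi.le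
  have hpos : 0 ≤ (i:ℝ) * (y / k) := by positivity
  have hle : (i:ℝ) * (y / k) ≤ y := by
    rw [mul_div_assoc', div_le_iff₀ hk0]; nlinarith
  set X := x + i * (y / k) with hX
  have hX1 : x ≤ X := by linarith
  have hX2 : X ≤ 2 * x := by linarith
  have hX0 : 0 < X := by linarith
  have hlX : L ≤ log X := Real.log_le_log hx0 hX1
  have hlX2 : log X ≤ 2 * L := by
    have h1 := Real.log_le_log hX0 hX2
    rw [Real.log_mul (by norm_num) hx0.ne'] at h1
    have := Real.log_two_lt_d9
    linarith
  refine h K hK X (y / k) (by linarith) (hL.trans hlX) (by positivity) ?_ ?_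
  · have hl0 : 0 ≤ log X := by linarith
    calc y / k * log X ^ 2 ≤ y / k * (2 * L) ^ 2 := by gcongr
      _ ≤ y := by
        rw [div_mul_eq_mul_div, div_le_iff₀ hk0]
        nlinarith
      _ ≤ X := by linarith
  · set l := L / (K:ℝ) ^ 50 with hl
    have e1 : 2 * k ≤ exp (l / 40) := by
      refine le_trans ?_ hexp
      have : L ^ 2 ≤ L ^ 7 := pow_le_pow_right₀ (by linarith) (by norm_num)
      linarith
    calc X ≤ 2 * x := hX2
      _ ≤ 2 * (y * exp (l / 40)) := by gcongr
      _ = y / k * ((2 * k) * exp (l / 40)) := by field_simp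
      _ ≤ y / k * (exp (l / 40) * exp (l / 40)) := by gcongr
      _ = y / k * exp (l / 20) := by rw [← Real.exp_add]; congr 2; ring
      _ ≤ y / k * exp (log X / (K:ℝ) ^ 50 / 20) := by
          rw [hl]; gcongr

lemma abs_sum_vonMangoldt_sub_rpow_le : ∃ C : ℝ, 1 ≤ C ∧ ∀ δ x : ℝ, 0 < δ → δ < 1 / 4 → exp 1 ≤ x →
    |∑ n ∈ Ioc ⌊x⌋₊ ⌊x + x ^ (1 - δ)⌋₊, vonMangoldt n - x ^ (1 - δ)| ≤
      C * x ^ (1 - δ) * (δ ^ ((1:ℝ) / 5) + log x ^ (-(1:ℝ) / 20)) := by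
  obtain ⟨C1, hC1, K0, hK0, h⟩ := abs_sum_vonMangoldt_sub_le
  obtain ⟨C2, hC2, hbt⟩ := brun_titchmarsh
  refine ⟨40 * (C1 * 2 ^ 10 + (C2 + 1) * (K0:ℝ) ^ 10), ?_, fun δ x hδ hδ1 hx => ?_⟩
  · have : 0 ≤ (C2 + 1) * (K0:ℝ) ^ 10 := by positivity
    linarith
  have hx1 : 1 < x := lt_of_lt_of_le (by linarith [Real.exp_one_gt_d9]) hx
  have hx0 : 0 < x := by linarith
  have hL1 : 1 ≤ log x := by rwa [Real.le_log_iff_exp_le hx0]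
  have hL0 : 0 < log x := by linarith
  set L := log x with hLd
  set y := x ^ (1 - δ) with hy
  have hy0 : 0 < y := Real.rpow_pos_of_pos hx0 _
  have hyx : y ≤ x := by
    calc y ≤ x ^ (1:ℝ) := Real.rpow_le_rpow_of_exponent_le hx1.le (by linarith)
      _ = x := Real.rpow_one x
  have hsy : √x ≤ y := by
    rw [Real.sqrt_eq_rpow]
    exact Real.rpow_le_rpow_of_exponent_le hx1.le (by linarith)
  set t := 40 * δ + L ^ (-(1:ℝ) / 4) with ht
  have hLp : 0 < L ^ (-(1:ℝ) / 4) := Real.rpow_pos_of_pos hL0 _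
  have ht0 : 0 < t := by positivity
  have hfin : t ^ ((1:ℝ) / 5) ≤ 40 * (δ ^ ((1:ℝ) / 5) + L ^ (-(1:ℝ) / 20)) := by
    have h1 := Real.rpow_add_le_add_rpow (p := (1:ℝ) / 5) (show 0 ≤ 40 * δ by positivity) hLp.le
      (by norm_num) (by norm_num)
    have h2 : (40 * δ) ^ ((1:ℝ) / 5) ≤ 40 * δ ^ ((1:ℝ) / 5) := by
      rw [Real.mul_rpow (by norm_num) hδ.le]
      gcongr
      calc (40:ℝ) ^ ((1:ℝ) / 5) ≤ 40 ^ (1:ℝ) :=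
            Real.rpow_le_rpow_of_exponent_le (by norm_num) (by norm_num)
        _ = 40 := Real.rpow_one _
    have h3 : (L ^ (-(1:ℝ) / 4)) ^ ((1:ℝ) / 5) = L ^ (-(1:ℝ) / 20) := by
      rw [← Real.rpow_mul hL0.le]; norm_num
    have h4 : 0 ≤ L ^ (-(1:ℝ) / 20) := Real.rpow_nonneg hL0.le _
    rw [h3, ← ht] at h1
    linarith
  have ht5 : 0 < t ^ ((1:ℝ) / 5) := Real.rpow_pos_of_pos ht0 _
  suffices hsuff : |∑ n ∈ Ioc ⌊x⌋₊ ⌊x + y⌋₊, vonMangoldt n - y| ≤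
      (C1 * 2 ^ 10 + (C2 + 1) * (K0:ℝ) ^ 10) * y * t ^ ((1:ℝ) / 5) by
    refine hsuff.trans ?_
    calc _ ≤ (C1 * 2 ^ 10 + (C2 + 1) * (K0:ℝ) ^ 10) * y *
          (40 * (δ ^ ((1:ℝ) / 5) + L ^ (-(1:ℝ) / 20))) := by gcongr
      _ = _ := by ring
  set u := t ^ (-(1:ℝ) / 50) with hu
  have hu0 : 0 < u := Real.rpow_pos_of_pos ht0 _
  have hu50 : u ^ 50 = t⁻¹ := by
    rw [hu, ← Real.rpow_natCast, ← Real.rpow_mul ht0.le, ← Real.rpow_neg_one]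
    norm_num
  have hu10 : u ^ 10 = (t ^ ((1:ℝ) / 5))⁻¹ := by
    rw [hu, ← Real.rpow_natCast, ← Real.rpow_mul ht0.le, ← Real.rpow_neg ht0.le]
    norm_num
  set K := ⌊u⌋₊ with hK
  have hKu : (K:ℝ) ≤ u := Nat.floor_le hu0.le
  have huK : u ≤ K + 1 := (Nat.lt_floor_add_one u).le
  by_cases hKK : K0 ≤ K
  · have hK6 : (6:ℝ) ≤ K := by exact_mod_cast hK0.trans hKK
    have hKp : (0:ℝ) < K := by linarith
    have hK50 : (K:ℝ) ^ 50 * t ≤ 1 := by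
      calc (K:ℝ) ^ 50 * t ≤ u ^ 50 * t := by gcongr
        _ = 1 := by rw [hu50, inv_mul_cancel₀ ht0.ne']
    have hK200 : (K:ℝ) ^ 200 ≤ L := by
      have h1 : (K:ℝ) ^ 50 * L ^ (-(1:ℝ) / 4) ≤ 1 := by
        refine le_trans ?_ hK50
        gcongr
        linarith
      have h2 : ((K:ℝ) ^ 50 * L ^ (-(1:ℝ) / 4)) ^ 4 ≤ 1 := pow_le_one₀ (by positivity) h1
      have h3 : (L ^ (-(1:ℝ) / 4)) ^ 4 = L⁻¹ := by
        rw [← Real.rpow_natCast, ← Real.rpow_mul hL0.le, ← Real.rpow_neg_one]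
        norm_num
      rw [mul_pow, h3, ← pow_mul, ← div_eq_mul_inv, div_le_one hL0] at h2
      exact h2
    have hδK : δ * L ≤ L / (K:ℝ) ^ 50 / 40 := by
      rw [div_div, le_div_iff₀ (by positivity)]
      have h1 : (K:ℝ) ^ 50 * (40 * δ) ≤ 1 := by
        refine le_trans ?_ hK50
        gcongr
        linarith
      calc δ * L * ((K:ℝ) ^ 50 * 40) = L * ((K:ℝ) ^ 50 * (40 * δ)) := by ring
        _ ≤ L * 1 := by gcongr
        _ = L := mul_one L
    have hxy : x ≤ y * exp (L / (K:ℝ) ^ 50 / 40) := by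
      calc x = y * exp (δ * L) := by
            rw [hy, Real.rpow_def_of_pos hx0, ← Real.exp_add]
            conv_lhs => rw [← Real.exp_log hx0]
            congr 1
            rw [hLd]; ring
        _ ≤ _ := by gcongr
    refine (h K hKK x y hx1.le hK200 hy0 hyx hxy).trans ?_
    have hKt : 1 / (K:ℝ) ^ 10 ≤ 2 ^ 10 * t ^ ((1:ℝ) / 5) := by
      rw [div_le_iff₀ (by positivity)]
      have h1 : u ^ 10 ≤ (2 * (K:ℝ)) ^ 10 := by
        gcongr
        linarith
      rw [hu10, inv_le_iff_one_le_mul₀ ht5, mul_pow] at h1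
      linarith
    calc C1 / (K:ℝ) ^ 10 * y = C1 * y * (1 / (K:ℝ) ^ 10) := by ring
      _ ≤ C1 * y * (2 ^ 10 * t ^ ((1:ℝ) / 5)) := by gcongr
      _ = (C1 * 2 ^ 10 + 0) * y * t ^ ((1:ℝ) / 5) := by ring
      _ ≤ _ := by gcongr; positivity
  · have hKK' : K + 1 ≤ K0 := by omega
    have hKK2 : (K:ℝ) + 1 ≤ K0 := by exact_mod_cast hKK'
    have h1 : 1 ≤ (K0:ℝ) ^ 10 * t ^ ((1:ℝ) / 5) := by
      have : u ^ 10 ≤ (K0:ℝ) ^ 10 := by gcongr; linarith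
      rwa [hu10, inv_le_iff_one_le_mul₀ ht5] at this
    have h2 := hbt x y hx1.le hsy hyx
    have h3 : 0 ≤ ∑ n ∈ Ioc ⌊x⌋₊ ⌊x + y⌋₊, vonMangoldt n := sum_nonneg fun _ _ => vonMangoldt_nonneg
    calc |∑ n ∈ Ioc ⌊x⌋₊ ⌊x + y⌋₊, vonMangoldt n - y| ≤ (C2 + 1) * y * 1 := by
          rw [abs_le]
          constructor <;> nlinarith
      _ ≤ (C2 + 1) * y * ((K0:ℝ) ^ 10 * t ^ ((1:ℝ) / 5)) := by gcongr
      _ = (0 + (C2 + 1) * (K0:ℝ) ^ 10) * y * t ^ ((1:ℝ) / 5) := by ring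
      _ ≤ _ := by gcongr; positivity

lemma sum_vonMangoldt_le_of_no_prime : ∃ C : ℝ, 0 < C ∧ ∀ x y : ℝ, 1 ≤ x → 0 ≤ y → y ≤ x →
    (¬ ∃ p : ℕ, p.Prime ∧ x < p ∧ (p:ℝ) ≤ x + y) →
    ∑ n ∈ Ioc ⌊x⌋₊ ⌊x + y⌋₊, vonMangoldt n ≤ C * √x := by
  obtain ⟨c, hc⟩ := Chebyshev.psi_sub_theta_le_mul_sqrt
  refine ⟨2 * |c| + 1, by positivity, fun x y hx hy hyx hno => ?_⟩
  have hmono : ⌊x⌋₊ ≤ ⌊x + y⌋₊ := Nat.floor_mono (by linarith)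
  have e1 : ∑ n ∈ Ioc ⌊x⌋₊ ⌊x + y⌋₊, vonMangoldt n = Chebyshev.psi (x + y) - Chebyshev.psi x := by
    rw [Chebyshev.psi, Chebyshev.psi, ← sum_Ioc_consecutive _ (Nat.zero_le _) hmono]
    ring
  have e2 : Chebyshev.theta (x + y) = Chebyshev.theta x := by
    rw [Chebyshev.theta, Chebyshev.theta]
    congr 1
    ext p
    simp only [mem_filter, mem_Ioc]
    constructor
    · rintro ⟨⟨h1, h2⟩, h3⟩
      refine ⟨⟨h1, ?_⟩, h3⟩
      by_contra hlt
      exact hno ⟨p, h3, Nat.lt_of_floor_lt (not_le.mp hlt), (Nat.le_floor_iff (by linarith)).mp h2⟩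
    · rintro ⟨⟨h1, h2⟩, h3⟩
      exact ⟨⟨h1, h2.trans hmono⟩, h3⟩
  have h1 := hc (x + y)
  have h2 := Chebyshev.theta_le_psi x
  have h3 : √(x + y) ≤ 2 * √x := by
    refine Real.sqrt_le_iff.mpr ⟨by positivity, ?_⟩
    rw [mul_pow, Real.sq_sqrt (by linarith)]
    linarith
  have h4 : c * √(x + y) ≤ |c| * (2 * √x) := by
    calc c * √(x + y) ≤ |c| * √(x + y) := by gcongr; exact le_abs_self c
      _ ≤ _ := by gcongr
  have h5 := Real.sqrt_nonneg x
  rw [e1]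
  linarith

lemma exists_prime_short : ∃ δ₀ : ℝ, 0 < δ₀ ∧ ∀ δ : ℝ, 0 < δ → δ ≤ δ₀ →
    ∃ x₀ : ℝ, ∀ x : ℝ, x₀ ≤ x → ∃ p : ℕ, p.Prime ∧ x < (p : ℝ) ∧ (p : ℝ) ≤ x + x ^ (1 - δ) := by
  obtain ⟨C, hC, h⟩ := abs_sum_vonMangoldt_sub_rpow_le
  obtain ⟨c, hc, hno⟩ := sum_vonMangoldt_le_of_no_prime
  have hC4 : 0 < 1 / (4 * C) := by positivity
  refine ⟨min (1 / 8) ((1 / (4 * C)) ^ 5), by positivity, fun δ hδ hδ0 => ?_⟩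
  have hδ1 : δ ≤ 1 / 8 := hδ0.trans (min_le_left _ _)
  have hδ2 : δ ^ ((1:ℝ) / 5) ≤ 1 / (4 * C) := by
    calc δ ^ ((1:ℝ) / 5) ≤ ((1 / (4 * C)) ^ 5) ^ ((1:ℝ) / 5) :=
          Real.rpow_le_rpow hδ.le (hδ0.trans (min_le_right _ _)) (by norm_num)
      _ = 1 / (4 * C) := by
          rw [← Real.rpow_natCast, ← Real.rpow_mul hC4.le]; norm_num
  have ev1 : ∀ᶠ x : ℝ in Filter.atTop, log x ^ (-(1:ℝ) / 20) < 1 / (8 * C) := by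
    have := (tendsto_rpow_neg_atTop (show (0:ℝ) < 1 / 20 by norm_num)).comp Real.tendsto_log_atTop
    rw [show -((1:ℝ) / 20) = -(1:ℝ) / 20 by norm_num] at this
    exact this.eventually (gt_mem_nhds (by positivity))
  have ev2 : ∀ᶠ x : ℝ in Filter.atTop, 4 * c < x ^ ((1:ℝ) / 4) :=
    (tendsto_rpow_atTop (by norm_num)).eventually (Filter.eventually_gt_atTop _)
  obtain ⟨x₀, hx₀⟩ := Filter.eventually_atTop.mp (ev1.and ev2)
  refine ⟨max x₀ (exp 1), fun x hx => ?_⟩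
  obtain ⟨k1, k2⟩ := hx₀ x ((le_max_left _ _).trans hx)
  have hxe : exp 1 ≤ x := (le_max_right _ _).trans hx
  have hx1 : 1 ≤ x := by linarith [Real.exp_one_gt_d9]
  have hx0 : 0 < x := by linarith
  have hy0 : 0 < x ^ (1 - δ) := Real.rpow_pos_of_pos hx0 _
  have hyx : x ^ (1 - δ) ≤ x := by
    calc x ^ (1 - δ) ≤ x ^ (1:ℝ) := Real.rpow_le_rpow_of_exponent_le hx1 (by linarith)
      _ = x := Real.rpow_one x
  by_contra hcon
  have m1 := (abs_le.mp (h δ x hδ (by linarith) hxe)).1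
  have m2 := hno x _ hx1 hy0.le hyx hcon
  have m3 : x ^ ((1:ℝ) / 4) * √x ≤ x ^ (1 - δ) := by
    rw [Real.sqrt_eq_rpow, ← Real.rpow_add hx0]
    exact Real.rpow_le_rpow_of_exponent_le hx1 (by linarith)
  have hs : 0 < √x := Real.sqrt_pos.mpr hx0
  have m4 : 4 * c * √x < x ^ (1 - δ) := lt_of_lt_of_le (by gcongr) m3
  have m5 : C * x ^ (1 - δ) * (δ ^ ((1:ℝ) / 5) + log x ^ (-(1:ℝ) / 20)) ≤
      C * x ^ (1 - δ) * (1 / (4 * C) + 1 / (8 * C)) := by gcongr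
  have m6 : C * x ^ (1 - δ) * (1 / (4 * C) + 1 / (8 * C)) = 3 / 8 * x ^ (1 - δ) := by
    field_simp; ring
  linarith

end Hoh

open scoped Classical

noncomputable section

theorem hoheisel :
    ∃ C : ℝ, 0 < C ∧
      (∀ δ x : ℝ, 0 < δ → δ < 1 / 4 → C ≤ x →
        |(∑ n ∈ Finset.Ioc ⌊x⌋₊ ⌊x + x ^ (1 - δ)⌋₊, ArithmeticFunction.vonMangoldt n)
            - x ^ (1 - δ)| ≤
          C * x ^ (1 - δ) * (δ ^ ((1 : ℝ) / 5) + Real.log x ^ (-(1 : ℝ) / 20))) ∧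
      (∃ δ₀ : ℝ, 0 < δ₀ ∧ ∀ δ : ℝ, 0 < δ → δ ≤ δ₀ →
        ∃ x₀ : ℝ, ∀ x : ℝ, x₀ ≤ x →
          ∃ p : ℕ, p.Prime ∧ x < (p : ℝ) ∧ (p : ℝ) ≤ x + x ^ (1 - δ)) := by
  obtain ⟨C, hC, h⟩ := Hoh.abs_sum_vonMangoldt_sub_rpow_le
  have he : 0 < Real.exp 1 := Real.exp_pos 1
  refine ⟨C + Real.exp 1, by linarith, fun δ x hδ hδ1 hx => ?_, Hoh.exists_prime_short⟩
  have hxe : Real.exp 1 ≤ x := by linarith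
  have hx0 : 0 < x := by linarith
  have hL : 0 ≤ Real.log x := by
    have := (Real.le_log_iff_exp_le hx0).mpr hxe
    linarith
  have h1 : 0 ≤ x ^ (1 - δ) := Real.rpow_nonneg hx0.le _
  have h2 : 0 ≤ δ ^ ((1 : ℝ) / 5) := Real.rpow_nonneg hδ.le _
  have h3 : 0 ≤ Real.log x ^ (-(1 : ℝ) / 20) := Real.rpow_nonneg hL _
  refine (h δ x hδ hδ1 hxe).trans ?_
  gcongr
  linarith
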